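/- Every bounded domain U ⊆ ℝ² is uniquely determined in the class of all domains in ℝ² by the relative metric of its Hausdorff boundary. -/

import Mathlib

open Set Metric Filter

noncomputable section

/-- Euclidean `n`-space. -/
abbrev Euc (n : ℕ) := EuclideanSpace ℝ (Fin n)

/-- A domain: a nonempty open connected subset of Euclidean space. -/
def IsEucDomain {n : ℕ} (U : Set (Euc n)) : Prop := IsOpen U ∧ IsConnected U

/-- Intrinsic extended distance inside `S`: the infimum of the lengths (total
variations) of continuous paths joining `x` and `y` within `S`. -/
def intrinsicDist {n : ℕ} (S : Set (Euc n)) (x y : Euc n) : ENNReal :=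
  ⨅ (γ : ℝ → Euc n) (_ : ContinuousOn γ (Icc (0:ℝ) 1)) (_ : γ 0 = x) (_ : γ 1 = y)
    (_ : MapsTo γ (Icc (0:ℝ) 1) S), eVariationOn γ (Icc (0:ℝ) 1)

/-- A Cauchy sequence (in the intrinsic metric) of points of `U` that does not
converge (in the intrinsic metric) to a point of `U`; such sequences represent
elements of the Hausdorff boundary of `U`. -/
structure HBSeq {n : ℕ} (U : Set (Euc n)) where
  seq : ℕ → Euc n
  mem : ∀ k, seq k ∈ U
  cauchy : ∀ ε : ENNReal, 0 < ε → ∃ N : ℕ, ∀ j ≥ N, ∀ k ≥ N,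
    intrinsicDist U (seq j) (seq k) < ε
  notConv : ¬ ∃ u ∈ U, Tendsto (fun k => intrinsicDist U (seq k) u) atTop (nhds 0)

/-- Two Cauchy sequences represent the same Hausdorff-boundary element iff the
intrinsic distance between corresponding terms tends to `0`. -/
def HBEquiv {n : ℕ} (U : Set (Euc n)) (s t : HBSeq U) : Prop :=
  Tendsto (fun k => intrinsicDist U (s.seq k) (t.seq k)) atTop (nhds 0)

/-- The Hausdorff boundary of `U`: points of the completion of `(U, ρ_U)` not
corresponding to points of `U`. -/
def HausdorffBoundary {n : ℕ} (U : Set (Euc n)) : Type := Quot (HBEquiv U)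

/-- The relative metric on the Hausdorff boundary (the completion metric). -/
def hbDist {n : ℕ} {U : Set (Euc n)} (a b : HausdorffBoundary U) : ENNReal :=
  limsup (fun k => intrinsicDist U ((Quot.out a).seq k) ((Quot.out b).seq k)) atTop

/-- The support of a Hausdorff-boundary element: the Euclidean limit of a
representing Cauchy sequence. -/
def hbSupport {n : ℕ} {U : Set (Euc n)} (a : HausdorffBoundary U) : Euc n :=
  limUnder atTop (Quot.out a).seq

/-- A (bijective) isometry of Hausdorff boundaries in the relative metrics. -/
def IsHBIsometry {n : ℕ} {U V : Set (Euc n)}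
    (f : HausdorffBoundary U → HausdorffBoundary V) : Prop :=
  Function.Bijective f ∧ ∀ a b : HausdorffBoundary U, hbDist (f a) (f b) = hbDist a b

/-- `U` is uniquely determined in the class `𝒰` by the relative metric of its
Hausdorff boundary: any member of `𝒰` with Hausdorff boundary isometric (in the
relative metrics) to that of `U` is the image of `U` under a Euclidean isometry. -/
def UniquelyDeterminedIn {n : ℕ} (𝒰 : Set (Set (Euc n))) (U : Set (Euc n)) : Prop :=
  ∀ V ∈ 𝒰, (∃ f : HausdorffBoundary U → HausdorffBoundary V, IsHBIsometry f) →
    ∃ J : Euc n ≃ᵢ Euc n, J '' U = V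

section IntrinsicDist

variable {n : ℕ} {S : Set (Euc n)} {x y z : Euc n}

theorem intrinsicDist_le_eVariationOn {γ : ℝ → Euc n} {a b : ℝ} (hab : a ≤ b)
    (hc : ContinuousOn γ (Icc a b)) (hm : MapsTo γ (Icc a b) S) :
    intrinsicDist S (γ a) (γ b) ≤ eVariationOn γ (Icc a b) := by
  have himg : (fun t : ℝ => a + t * (b - a)) '' Icc 0 1 ⊆ Icc a b := by
    rintro _ ⟨t, ht, rfl⟩
    constructor <;> dsimp only <;> nlinarith [ht.1, ht.2]
  have hmono : MonotoneOn (fun t : ℝ => a + t * (b - a)) (Icc 0 1) := by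
    intro s _ t _ hst
    dsimp only
    nlinarith
  have hvar : eVariationOn (γ ∘ fun t : ℝ => a + t * (b - a)) (Icc 0 1) ≤
      eVariationOn γ (Icc a b) := by
    rw [eVariationOn.comp_eq_of_monotoneOn _ _ hmono]
    exact eVariationOn.mono _ himg
  refine le_trans ?_ hvar
  refine iInf_le_of_le (γ ∘ fun t : ℝ => a + t * (b - a)) (iInf_le_of_le ?_ (iInf_le_of_le ?_
    (iInf_le_of_le ?_ (iInf_le_of_le ?_ le_rfl))))
  · exact hc.comp (by fun_prop) (fun t ht => himg ⟨t, ht, rfl⟩)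
  · simp
  · simp
  · exact fun t ht => hm (himg ⟨t, ht, rfl⟩)

theorem exists_path_of_intrinsicDist_lt {c : ENNReal} (h : intrinsicDist S x y < c) :
    ∃ γ : ℝ → Euc n, ContinuousOn γ (Icc (0:ℝ) 1) ∧ γ 0 = x ∧ γ 1 = y ∧
      MapsTo γ (Icc (0:ℝ) 1) S ∧ eVariationOn γ (Icc (0:ℝ) 1) < c := by
  simp only [intrinsicDist, iInf_lt_iff] at h
  obtain ⟨γ, h1, h2, h3, h4, h5⟩ := h
  exact ⟨γ, h1, h2, h3, h4, h5⟩

theorem edist_le_intrinsicDist : edist x y ≤ intrinsicDist S x y := by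
  refine le_iInf fun γ => le_iInf fun _ => le_iInf fun h0 => le_iInf fun h1 => le_iInf fun _ => ?_
  rw [← h0, ← h1]
  exact eVariationOn.edist_le _ (by simp) (by simp)

theorem intrinsicDist_comm : intrinsicDist S x y = intrinsicDist S y x := by
  suffices h : ∀ x y : Euc n, intrinsicDist S x y ≤ intrinsicDist S y x from
    le_antisymm (h x y) (h y x)
  intro x y
  refine le_iInf fun γ => le_iInf fun hc => le_iInf fun h0 => le_iInf fun h1 => le_iInf fun hm => ?_
  have himg : (fun t : ℝ => 1 - t) '' Icc 0 1 ⊆ Icc 0 1 := by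
    rintro _ ⟨t, ht, rfl⟩
    constructor <;> dsimp only <;> linarith [ht.1, ht.2]
  have hanti : AntitoneOn (fun t : ℝ => 1 - t) (Icc 0 1) := by
    intro s _ t _ hst
    dsimp only
    linarith
  have hvar : eVariationOn (γ ∘ fun t : ℝ => 1 - t) (Icc 0 1) ≤ eVariationOn γ (Icc 0 1) := by
    rw [eVariationOn.comp_eq_of_antitoneOn _ _ hanti]
    exact eVariationOn.mono _ himg
  refine le_trans (le_trans ?_ (intrinsicDist_le_eVariationOn (S := S) zero_le_one ?_ ?_)) hvar
  · simp [h0, h1]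
  · exact hc.comp (by fun_prop) (fun t ht => himg ⟨t, ht, rfl⟩)
  · exact fun t ht => hm (himg ⟨t, ht, rfl⟩)

theorem intrinsicDist_triangle :
    intrinsicDist S x z ≤ intrinsicDist S x y + intrinsicDist S y z := by
  refine ENNReal.le_of_forall_pos_le_add fun ε hε hfin => ?_
  have hxy : intrinsicDist S x y ≠ ⊤ := fun h => by simp [h] at hfin
  have hyz : intrinsicDist S y z ≠ ⊤ := fun h => by simp [h] at hfin
  have hε2 : (ε / 2 : ENNReal) ≠ 0 := by simp [hε.ne']
  obtain ⟨γ, hc, h0, h1, hm, hv⟩ :=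
    exists_path_of_intrinsicDist_lt (ENNReal.lt_add_right hxy hε2)
  obtain ⟨δ, dc, d0, d1, dm, dv⟩ :=
    exists_path_of_intrinsicDist_lt (ENNReal.lt_add_right hyz hε2)
  let η : ℝ → Euc n := fun t => if t ≤ 1 then γ t else δ (t - 1)
  have e1 : EqOn η γ (Icc 0 1) := fun t ht => by simp [η, ht.2]
  have e2 : EqOn η (δ ∘ fun t : ℝ => t - 1) (Icc 1 2) := fun t ht => by
    rcases ht.1.eq_or_lt with h | h
    · subst h; simp [η, h1, d0]
    · simp [η, not_le.2 h]
  have him : (fun t : ℝ => t - 1) '' Icc 1 2 ⊆ Icc 0 1 := by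
    rintro _ ⟨t, ht, rfl⟩
    constructor <;> dsimp only <;> linarith [ht.1, ht.2]
  have v1 : eVariationOn η (Icc 0 1) = eVariationOn γ (Icc 0 1) := eVariationOn.congr e1
  have v2 : eVariationOn η (Icc 1 2) ≤ eVariationOn δ (Icc 0 1) := by
    rw [eVariationOn.congr e2, eVariationOn.comp_eq_of_monotoneOn]
    · exact eVariationOn.mono _ him
    · intro s _ t _ hst
      dsimp only
      linarith
  have v : eVariationOn η (Icc 0 1) + eVariationOn η (Icc 1 2) = eVariationOn η (Icc 0 2) := by
    simpa using eVariationOn.Icc_add_Icc η (s := univ) (a := 0) (b := 1) (c := 2)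
      zero_le_one one_le_two (mem_univ _)
  have hu : Icc (0:ℝ) 2 = Icc 0 1 ∪ Icc 1 2 := (Icc_union_Icc_eq_Icc zero_le_one one_le_two).symm
  have key := intrinsicDist_le_eVariationOn (γ := η) (S := S) (a := 0) (b := 2) zero_le_two ?_ ?_
  · have hη0 : η 0 = x := by simp [η, h0]
    have hη2 : η 2 = z := by
      have : (2:ℝ) - 1 = 1 := by norm_num
      simp [η, this, d1]
    rw [hη0, hη2, ← v, v1] at key
    calc _ ≤ _ := key
      _ ≤ (intrinsicDist S x y + ε / 2) + (intrinsicDist S y z + ε / 2) :=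
          add_le_add hv.le (v2.trans dv.le)
      _ = _ := by
          rw [add_add_add_comm, ENNReal.add_halves]
  · rw [hu]
    refine ContinuousOn.union_of_isClosed (hc.congr e1) ?_ isClosed_Icc isClosed_Icc
    exact (dc.comp (by fun_prop) (fun t ht => him ⟨t, ht, rfl⟩)).congr e2
  · rw [hu]
    rintro t (ht | ht)
    · rw [e1 ht]; exact hm ht
    · rw [e2 ht]; exact dm (him ⟨t, ht, rfl⟩)

theorem intrinsicDist_le_edist (h : segment ℝ x y ⊆ S) : intrinsicDist S x y ≤ edist x y := by
  have key := intrinsicDist_le_eVariationOn (γ := AffineMap.lineMap (k := ℝ) x y) (S := S)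
    (a := 0) (b := 1) zero_le_one AffineMap.lineMap_continuous.continuousOn
    (fun t ht => h (by rw [segment_eq_image_lineMap]; exact ⟨t, ht, rfl⟩))
  simp only [AffineMap.lineMap_apply_zero, AffineMap.lineMap_apply_one] at key
  refine key.trans ?_
  have hl : LipschitzOnWith (nndist x y) (AffineMap.lineMap (k := ℝ) x y) (Icc (0:ℝ) 1) :=
    (lipschitzWith_lineMap x y).lipschitzOnWith
  have h2 := hl.comp_eVariationOn_le (g := id) (s := Icc (0:ℝ) 1) (fun t ht => ht)
  have h3 : eVariationOn (id : ℝ → ℝ) (Icc (0:ℝ) 1) ≤ 1 := by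
    have := (monotone_id (α := ℝ)).monotoneOn (Icc (0:ℝ) 1) |>.eVariationOn_eq
      (a := 0) (b := 1) (by simp) (by simp)
    simp only [inter_self, id, sub_zero, ENNReal.ofReal_one] at this
    exact this.le
  calc _ ≤ _ := h2
    _ ≤ nndist x y * 1 := by gcongr
    _ = edist x y := by rw [mul_one, edist_nndist]

theorem intrinsicDist_self (h : x ∈ S) : intrinsicDist S x x = 0 := by
  have := intrinsicDist_le_edist (S := S) (x := x) (y := x) (by simpa using h)
  simpa using this

end IntrinsicDist

/-- Cauchy sequences of points of `U` in the intrinsic metric. -/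
structure ISeq {n : ℕ} (U : Set (Euc n)) where
  seq : ℕ → Euc n
  mem : ∀ k, seq k ∈ U
  cauchy : ∀ ε : ENNReal, 0 < ε → ∃ N : ℕ, ∀ j ≥ N, ∀ k ≥ N,
    intrinsicDist U (seq j) (seq k) < ε

namespace ISeq

variable {n : ℕ} {U : Set (Euc n)}

instance : PseudoEMetricSpace (ISeq U) where
  edist s t := limsup (fun k => intrinsicDist U (s.seq k) (t.seq k)) atTop
  edist_self s := by
    simp only [intrinsicDist_self (s.mem _)]
    simp
  edist_comm s t := by
    simp only [intrinsicDist_comm]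
  edist_triangle s t u := by
    refine ENNReal.le_of_forall_pos_le_add fun ε hε hfin => ?_
    have hxy : limsup (fun k => intrinsicDist U (s.seq k) (t.seq k)) atTop ≠ ⊤ :=
      fun h => by simp [h] at hfin
    have hyz : limsup (fun k => intrinsicDist U (t.seq k) (u.seq k)) atTop ≠ ⊤ :=
      fun h => by simp [h] at hfin
    have hε2 : (ε / 2 : ENNReal) ≠ 0 := by simp [hε.ne']
    have h1 := eventually_lt_of_limsup_lt (ENNReal.lt_add_right hxy hε2)
    have h2 := eventually_lt_of_limsup_lt (ENNReal.lt_add_right hyz hε2)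
    refine limsup_le_of_le (h := ?_)
    filter_upwards [h1, h2] with k hk1 hk2
    refine intrinsicDist_triangle.trans ((add_le_add hk1.le hk2.le).trans ?_)
    rw [add_add_add_comm, ENNReal.add_halves]

theorem edist_def (s t : ISeq U) :
    edist s t = limsup (fun k => intrinsicDist U (s.seq k) (t.seq k)) atTop := rfl

/-- The constant sequence at a point of `U`. -/
def pt (z : Euc n) (hz : z ∈ U) : ISeq U where
  seq _ := z
  mem _ := hz
  cauchy ε hε := ⟨0, fun _ _ _ _ => by rwa [intrinsicDist_self hz]⟩

theorem edist_pt_pt {y z : Euc n} (hy : y ∈ U) (hz : z ∈ U) :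
    edist (pt y hy) (pt z hz) = intrinsicDist U y z := by
  simp [edist_def, pt]

theorem edist_pt_le {y z : Euc n} (h : segment ℝ y z ⊆ U) :
    edist (pt y (h (left_mem_segment ℝ y z))) (pt z (h (right_mem_segment ℝ y z))) ≤ edist y z := by
  rw [edist_pt_pt]
  exact intrinsicDist_le_edist h

theorem tendsto_edist_pt (s : ISeq U) :
    Tendsto (fun k => edist s (pt (s.seq k) (s.mem k))) atTop (nhds 0) := by
  rw [ENNReal.tendsto_nhds_zero]
  intro ε hε
  obtain ⟨N, hN⟩ := s.cauchy ε hε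
  filter_upwards [eventually_ge_atTop N] with k hk
  refine limsup_le_of_le (h := ?_)
  filter_upwards [eventually_ge_atTop N] with j hj
  exact (hN j hj k hk).le

theorem cauchySeq (s : ISeq U) : CauchySeq s.seq := by
  rw [EMetric.cauchySeq_iff]
  intro ε hε
  obtain ⟨N, hN⟩ := s.cauchy ε hε
  exact ⟨N, fun j hj k hk => edist_le_intrinsicDist.trans_lt (hN j hj k hk)⟩

/-- The Euclidean limit of a Cauchy sequence. -/
def supp (s : ISeq U) : Euc n := limUnder atTop s.seq

theorem tendsto_supp (s : ISeq U) : Tendsto s.seq atTop (nhds s.supp) :=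
  s.cauchySeq.tendsto_limUnder

theorem supp_pt {z : Euc n} (hz : z ∈ U) : (pt z hz).supp = z :=
  tendsto_nhds_unique (pt z hz).tendsto_supp tendsto_const_nhds

theorem edist_supp_le (s t : ISeq U) : edist s.supp t.supp ≤ edist s t := by
  have h : Tendsto (fun k => edist (s.seq k) (t.seq k)) atTop (nhds (edist s.supp t.supp)) :=
    s.tendsto_supp.edist t.tendsto_supp
  rw [← h.limsup_eq, edist_def]
  exact limsup_le_limsup (Eventually.of_forall fun k => edist_le_intrinsicDist)

theorem dist_supp_le {s t : ISeq U} {r : ℝ} (hr : 0 ≤ r) (h : edist s t ≤ ENNReal.ofReal r) :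
    dist s.supp t.supp ≤ r := by
  have := (edist_supp_le s t).trans h
  rwa [edist_dist, ENNReal.ofReal_le_ofReal_iff hr] at this

theorem dist_supp_pt_le {s : ISeq U} {z : Euc n} {hz : z ∈ U} {r : ℝ} (hr : 0 ≤ r)
    (h : edist s (pt z hz) ≤ ENNReal.ofReal r) : dist s.supp z ≤ r := by
  simpa [supp_pt] using dist_supp_le hr h

theorem supp_eq_of_edist_eq_zero {s t : ISeq U} (h : edist s t = 0) : s.supp = t.supp := by
  have := (edist_supp_le s t).trans h.le
  simpa using this

theorem edist_trans_le {s t u : ISeq U} {a b : ℝ} (ha : 0 ≤ a) (hb : 0 ≤ b)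
    (h1 : edist s t ≤ ENNReal.ofReal a) (h2 : edist t u ≤ ENNReal.ofReal b) :
    edist s u ≤ ENNReal.ofReal (a + b) := by
  rw [ENNReal.ofReal_add ha hb]
  exact (edist_triangle s t u).trans (add_le_add h1 h2)

theorem edist_pt_le_dist {y z : Euc n} (h : segment ℝ y z ⊆ U) (hy : y ∈ U) (hz : z ∈ U) :
    edist (pt y hy) (pt z hz) ≤ ENNReal.ofReal (dist y z) := by
  rw [← edist_dist]
  exact edist_pt_le h

theorem edist_pt_le_of_ball {p y z : Euc n} {r : ℝ} (h : ball p r ⊆ U) (hy : y ∈ ball p r)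
    (hz : z ∈ ball p r) :
    edist (pt y (h hy)) (pt z (h hz)) ≤ ENNReal.ofReal (dist y z) :=
  edist_pt_le_dist (((convex_ball p r).segment_subset hy hz).trans h) _ _

/-- A Cauchy sequence whose support lies in the open set `U` converges to it. -/
theorem edist_pt_supp (hU : IsOpen U) (s : ISeq U) (h : s.supp ∈ U) :
    edist s (pt s.supp h) = 0 := by
  obtain ⟨r, hr, hball⟩ := Metric.isOpen_iff.1 hU _ h
  have h1 : Tendsto (fun k => intrinsicDist U (s.seq k) s.supp) atTop (nhds 0) := by
    have h2 : Tendsto (fun k => edist (s.seq k) s.supp) atTop (nhds 0) :=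
      tendsto_iff_edist_tendsto_0.1 s.tendsto_supp
    refine tendsto_of_tendsto_of_tendsto_of_le_of_le' tendsto_const_nhds h2
      (Eventually.of_forall fun _ => zero_le) ?_
    filter_upwards [s.tendsto_supp.eventually (ball_mem_nhds _ hr)] with k hk
    exact intrinsicDist_le_edist (((convex_ball _ r).segment_subset hk (mem_ball_self hr)).trans
      hball)
  exact h1.limsup_eq

end ISeq

section Segments

variable {n : ℕ} {U : Set (Euc n)}

/-- Moving from a point of an open set towards a point outside of it, there is a first point
outside of the set. -/
theorem exists_first_exit (hU : IsOpen U) {y η : Euc n} (hy : y ∈ U) (hη : η ∉ U) :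
    ∃ t ∈ Ioc (0:ℝ) 1, AffineMap.lineMap y η t ∉ U ∧
      ∀ s ∈ Ico (0:ℝ) t, AffineMap.lineMap y η s ∈ U := by
  let T : Set ℝ := Icc 0 1 ∩ (AffineMap.lineMap (k := ℝ) y η) ⁻¹' Uᶜ
  have hT : IsCompact T := isCompact_Icc.inter_right
    (hU.isClosed_compl.preimage AffineMap.lineMap_continuous)
  have hne : T.Nonempty := ⟨1, by simp, by simpa using hη⟩
  obtain ⟨t, ht, hmin⟩ := hT.exists_isLeast hne
  refine ⟨t, ⟨?_, ht.1.2⟩, ht.2, fun s hs => ?_⟩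
  · refine lt_of_le_of_ne ht.1.1 fun h0 => ht.2 ?_
    simpa [← h0] using hy
  · by_contra hsU
    exact absurd (hmin ⟨⟨hs.1, hs.2.le.trans ht.1.2⟩, hsU⟩) (not_le.2 hs.2)

theorem exists_exit_of_not_ball_subset (hU : IsOpen U) {y : Euc n} {r : ℝ} (hy : y ∈ U)
    (h : ¬ ball y r ⊆ U) :
    ∃ η ∉ U, dist y η < r ∧ openSegment ℝ y η ⊆ U := by
  obtain ⟨η, hη, hηU⟩ := not_subset.1 h
  obtain ⟨t, ht, htU, hs⟩ := exists_first_exit hU hy hηU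
  refine ⟨_, htU, ?_, ?_⟩
  · rw [dist_left_lineMap, Real.norm_of_nonneg ht.1.le]
    rw [mem_ball'] at hη
    nlinarith [ht.2, dist_nonneg (x := y) (y := η)]
  · rw [openSegment_eq_image_lineMap]
    rintro _ ⟨s, hs1, rfl⟩
    have : AffineMap.lineMap y (AffineMap.lineMap y η t) s = AffineMap.lineMap y η (s * t) := by
      simp [AffineMap.lineMap_apply, smul_smul]
    rw [this]
    exact hs _ ⟨mul_nonneg hs1.1.le ht.1.le, by nlinarith [hs1.2, ht.1]⟩

end Segments

namespace ISeq

variable {n : ℕ} {U : Set (Euc n)}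

/-- A point of the closure of a convex subset of `U` supports an element of the completion. -/
theorem exists_of_mem_closure {C : Set (Euc n)} {α : Euc n} (hC : Convex ℝ C) (hCU : C ⊆ U)
    (hα : α ∈ closure C) :
    ∃ b : ISeq U, b.supp = α ∧
      ∀ z (hz : z ∈ C), edist b (pt z (hCU hz)) ≤ ENNReal.ofReal (dist α z) := by
  obtain ⟨x, hx, hlim⟩ := mem_closure_iff_seq_limit.1 hα
  have hle : ∀ y ∈ C, ∀ z ∈ C, intrinsicDist U y z ≤ edist y z := fun y hy z hz =>
    intrinsicDist_le_edist ((hC.segment_subset hy hz).trans hCU)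
  let b : ISeq U := ⟨x, fun k => hCU (hx k), fun ε hε => by
    obtain ⟨N, hN⟩ := EMetric.cauchySeq_iff.1 hlim.cauchySeq ε hε
    exact ⟨N, fun j hj k hk => (hle _ (hx j) _ (hx k)).trans_lt (hN j hj k hk)⟩⟩
  refine ⟨b, tendsto_nhds_unique b.tendsto_supp hlim, fun z hz => ?_⟩
  have h : Tendsto (fun k => edist (x k) z) atTop (nhds (edist α z)) :=
    hlim.edist tendsto_const_nhds
  rw [← edist_dist, ← h.limsup_eq, edist_def]
  exact limsup_le_limsup (Eventually.of_forall fun k => hle _ (hx k) _ hz)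

/-- The end of a segment of `U` at a point outside of `U`. -/
theorem exists_end {p α : Euc n} (hp : p ∈ U) (hα : α ∉ U) (h : openSegment ℝ p α ⊆ U) :
    ∃ b : ISeq U, b.supp = α ∧ ∀ z ∈ segment ℝ p α, ∀ hz : z ∈ U,
      edist b (pt z hz) ≤ ENNReal.ofReal (dist α z) := by
  let C : Set (Euc n) := AffineMap.lineMap (k := ℝ) p α '' Ico 0 1
  have hC : Convex ℝ C := (convex_Ico 0 1).affine_image _
  have hCU : C ⊆ U := by
    rintro _ ⟨t, ht, rfl⟩
    rcases ht.1.eq_or_lt with h0 | h0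
    · simpa [← h0] using hp
    · refine h ?_
      rw [openSegment_eq_image_lineMap]
      exact ⟨t, ⟨h0, ht.2⟩, rfl⟩
  have hcl : α ∈ closure C := by
    have h1 : (1:ℝ) ∈ closure (Ico (0:ℝ) 1) := by
      rw [closure_Ico zero_ne_one]; simp
    have := image_closure_subset_closure_image
      (AffineMap.lineMap_continuous (R := ℝ) (p := p) (q := α)) (mem_image_of_mem _ h1)
    simpa using this
  obtain ⟨b, hb, hbz⟩ := exists_of_mem_closure hC hCU hcl
  refine ⟨b, hb, fun z hz hzU => hbz z ?_⟩
  rw [segment_eq_image_lineMap] at hz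
  obtain ⟨t, ht, rfl⟩ := hz
  refine ⟨t, ⟨ht.1, lt_of_le_of_ne ht.2 fun h1 => hα ?_⟩, rfl⟩
  simpa [h1] using hzU

theorem continuous_pt (hU : IsOpen U) : Continuous fun z : U => pt (z : Euc n) z.2 := by
  refine continuous_iff_continuousAt.2 fun z => ?_
  obtain ⟨r, hr, hball⟩ := Metric.isOpen_iff.1 hU _ z.2
  rw [ContinuousAt, tendsto_iff_edist_tendsto_0]
  have h : Tendsto (fun y : U => edist (y : Euc n) z) (nhds z) (nhds 0) :=
    tendsto_iff_edist_tendsto_0.1 continuous_subtype_val.continuousAt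
  refine tendsto_of_tendsto_of_tendsto_of_le_of_le' tendsto_const_nhds h
    (Eventually.of_forall fun _ => zero_le) ?_
  filter_upwards [continuous_subtype_val.continuousAt.eventually (ball_mem_nhds _ hr)] with y hy
  exact edist_pt_le (((convex_ball _ r).segment_subset hy (mem_ball_self hr)).trans hball)

theorem exists_edist_pt_lt (s : ISeq U) {ε : ℝ} (hε : 0 < ε) :
    ∃ z, ∃ hz : z ∈ U, edist s (pt z hz) ≤ ENNReal.ofReal ε := by
  obtain ⟨k, hk⟩ := (s.tendsto_edist_pt.eventually
    (eventually_lt_nhds (ENNReal.ofReal_pos.2 hε))).exists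
  exact ⟨_, s.mem k, hk.le⟩

/-- The completion of a domain is a length space. -/
theorem exists_between (hU : IsOpen U) {s t : ISeq U} {L σ ε : ℝ} (hσ : 0 ≤ σ) (hσL : σ ≤ L)
    (hε : 0 < ε) (h : edist s t ≤ ENNReal.ofReal L) :
    ∃ z, ∃ hz : z ∈ U, edist s (pt z hz) ≤ ENNReal.ofReal (σ + ε) ∧
      edist (pt z hz) t ≤ ENNReal.ofReal (L - σ + ε) := by
  obtain ⟨x, hx, hsx⟩ := s.exists_edist_pt_lt (ε := ε / 4) (by linarith)
  obtain ⟨y, hy, hty⟩ := t.exists_edist_pt_lt (ε := ε / 4) (by linarith)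
  have hL : 0 ≤ L := hσ.trans hσL
  have hxy : intrinsicDist U x y < ENNReal.ofReal (L + 3 * ε / 4) := by
    rw [← edist_pt_pt hx hy]
    have h1 := edist_trans_le (by linarith) (by linarith)
      (edist_trans_le (by linarith) hL ((edist_comm _ _).trans_le hsx) h) hty
    refine h1.trans_lt ?_
    rw [ENNReal.ofReal_lt_ofReal_iff] <;> linarith
  obtain ⟨γ, hc, h0, h1, hm, hv⟩ := exists_path_of_intrinsicDist_lt hxy
  let f : Icc (0:ℝ) 1 → ENNReal := fun u => edist (pt x hx) (pt (γ u) (hm u.2))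
  have hf : Continuous f := by
    have hg : Continuous fun u : Icc (0:ℝ) 1 => (⟨γ u, hm u.2⟩ : U) :=
      (continuousOn_iff_continuous_domRestrict.1 hc).subtype_mk _
    exact continuous_const.edist ((continuous_pt hU).comp hg)
  have hadd : ∀ u ∈ Icc (0:ℝ) 1, eVariationOn γ (Icc 0 u) + eVariationOn γ (Icc u 1) =
      eVariationOn γ (Icc 0 1) := fun u hu => by
    simpa using eVariationOn.Icc_add_Icc γ (s := univ) (a := 0) (b := u) (c := 1)
      hu.1 hu.2 (mem_univ _)
  by_cases hcase : edist (pt x hx) (pt y hy) ≤ ENNReal.ofReal σ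
  · refine ⟨y, hy, ?_, ?_⟩
    · refine (edist_trans_le (by linarith) hσ hsx hcase).trans (ENNReal.ofReal_le_ofReal ?_)
      linarith
    · rw [edist_comm]
      exact hty.trans (ENNReal.ofReal_le_ofReal (by linarith))
  · have hf0 : f ⟨0, by simp⟩ = 0 := by
      simp only [f, h0, edist_pt_pt]
      exact intrinsicDist_self hx
    have hf1 : ENNReal.ofReal σ ≤ f ⟨1, by simp⟩ := by
      simp only [f, h1]
      exact (not_le.1 hcase).le
    obtain ⟨⟨u, hu⟩, hfu⟩ : ENNReal.ofReal σ ∈ range f :=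
      mem_range_of_exists_le_of_exists_ge hf ⟨_, by rw [hf0]; exact zero_le⟩ ⟨_, hf1⟩
    refine ⟨γ u, hm hu, ?_, ?_⟩
    · refine (edist_trans_le (by linarith) hσ hsx hfu.le).trans (ENNReal.ofReal_le_ofReal ?_)
      linarith
    · have e1 : ENNReal.ofReal σ ≤ eVariationOn γ (Icc 0 u) := by
        rw [← hfu]
        simp only [f, edist_pt_pt]
        rw [← h0]
        exact intrinsicDist_le_eVariationOn hu.1 (hc.mono (Icc_subset_Icc le_rfl hu.2))
          (hm.mono_left (Icc_subset_Icc le_rfl hu.2))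
      have e2 : edist (pt (γ u) (hm hu)) (pt y hy) ≤ eVariationOn γ (Icc u 1) := by
        rw [edist_pt_pt, ← h1]
        exact intrinsicDist_le_eVariationOn hu.2 (hc.mono (Icc_subset_Icc hu.1 le_rfl))
          (hm.mono_left (Icc_subset_Icc hu.1 le_rfl))
      have e3 : ENNReal.ofReal σ + edist (pt (γ u) (hm hu)) (pt y hy) ≤
          ENNReal.ofReal σ + ENNReal.ofReal (L - σ + 3 * ε / 4) := by
        rw [← ENNReal.ofReal_add hσ (by linarith)]
        refine (add_le_add e1 e2).trans (((hadd u hu).trans_le hv.le).trans_eq ?_)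
        congr 1; ring
      have e4 := (ENNReal.add_le_add_iff_left ENNReal.ofReal_ne_top).1 e3
      refine (edist_trans_le (by linarith) (by linarith) e4
        ((edist_comm _ _).trans_le hty)).trans (ENNReal.ofReal_le_ofReal ?_)
      linarith

end ISeq

/-- A map between completions that restricts to an isometry of the Hausdorff boundaries. -/
structure BIso {n : ℕ} (U V : Set (Euc n)) where
  toFun : ISeq U → ISeq V
  supp_notMem : ∀ s : ISeq U, s.supp ∉ U → (toFun s).supp ∉ V
  edist_eq : ∀ s t : ISeq U, s.supp ∉ U → t.supp ∉ U → edist (toFun s) (toFun t) = edist s t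
  exists_preimage : ∀ t : ISeq V, t.supp ∉ V → ∃ s : ISeq U, s.supp ∉ U ∧ edist (toFun s) t = 0

/-- Two boundary elements joined by a straight segment of `U`. -/
structure IsChord {n : ℕ} {U : Set (Euc n)} (a b : ISeq U) : Prop where
  left_notMem : a.supp ∉ U
  right_notMem : b.supp ∉ U
  ne : a.supp ≠ b.supp
  subset : openSegment ℝ a.supp b.supp ⊆ U
  left_le : ∀ z (hz : z ∈ openSegment ℝ a.supp b.supp),
    edist a (ISeq.pt z (subset hz)) ≤ ENNReal.ofReal (dist a.supp z)
  right_le : ∀ z (hz : z ∈ openSegment ℝ a.supp b.supp),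
    edist b (ISeq.pt z (subset hz)) ≤ ENNReal.ofReal (dist b.supp z)

namespace IsChord

variable {n : ℕ} {U : Set (Euc n)} {a b : ISeq U}

theorem symm (h : IsChord a b) : IsChord b a where
  left_notMem := h.right_notMem
  right_notMem := h.left_notMem
  ne := h.ne.symm
  subset := by rw [openSegment_symm]; exact h.subset
  left_le z hz := h.right_le z (by rwa [openSegment_symm])
  right_le z hz := h.left_le z (by rwa [openSegment_symm])

theorem edist_le (h : IsChord a b) {z : Euc n} (hz : z ∈ openSegment ℝ a.supp b.supp) :
    edist a b ≤ ENNReal.ofReal (dist a.supp b.supp) := by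
  rw [← dist_add_dist_of_mem_segment (openSegment_subset_segment ℝ _ _ hz)]
  refine ISeq.edist_trans_le dist_nonneg dist_nonneg (h.left_le z hz) ?_
  rw [edist_comm, dist_comm]
  exact h.right_le z hz

theorem edist_eq (h : IsChord a b) : edist a b = ENNReal.ofReal (dist a.supp b.supp) := by
  refine le_antisymm ?_ ?_
  · exact h.edist_le (midpoint_mem_openSegment a.supp b.supp)
  · rw [← edist_dist]
    exact ISeq.edist_supp_le a b

end IsChord

section Stewart

variable {n : ℕ}

theorem dist_lineMap_sq (α β w : Euc n) (t : ℝ) :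
    dist w (AffineMap.lineMap α β t) ^ 2 =
      (1 - t) * dist w α ^ 2 + t * dist w β ^ 2 - t * (1 - t) * dist α β ^ 2 := by
  have h1 : w - AffineMap.lineMap α β t = (1 - t) • (w - α) + t • (w - β) := by
    rw [AffineMap.lineMap_apply_module']
    module
  have h2 : α - β = (w - β) - (w - α) := by abel
  rw [dist_eq_norm, dist_eq_norm, dist_eq_norm, dist_eq_norm, h1, h2,
    norm_add_sq_real, norm_sub_sq_real (w - β) (w - α), norm_smul, norm_smul,
    real_inner_smul_left, real_inner_smul_right,
    mul_pow, mul_pow, Real.norm_eq_abs, Real.norm_eq_abs, sq_abs, sq_abs, real_inner_comm]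
  ring

theorem dist_lineMap_sq_le {α β w : Euc n} {L τ r : ℝ} (hL : dist α β = L) (hL0 : 0 < L)
    (hτ0 : 0 ≤ τ) (hτL : τ ≤ L) (hr : 0 ≤ r) (h1 : dist w α ≤ τ + r)
    (h2 : dist w β ≤ L - τ + r) :
    dist w (AffineMap.lineMap α β (τ / L)) ^ 2 ≤ r * L + r ^ 2 := by
  rw [dist_lineMap_sq, hL]
  obtain ⟨t, rfl⟩ : ∃ t, τ = t * L := ⟨τ / L, by field_simp⟩
  have ht : t * L / L = t := by field_simp
  rw [ht]
  have ht0 : 0 ≤ t := nonneg_of_mul_nonneg_left hτ0 hL0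
  have ht1 : t ≤ 1 := by nlinarith
  have e1 : dist w α ^ 2 ≤ (t * L + r) ^ 2 := pow_le_pow_left₀ dist_nonneg h1 2
  have e2 : dist w β ^ 2 ≤ (L - t * L + r) ^ 2 := pow_le_pow_left₀ dist_nonneg h2 2
  have e3 := mul_le_mul_of_nonneg_left e1 (sub_nonneg.2 ht1)
  have e4 := mul_le_mul_of_nonneg_left e2 ht0
  have e5 : 0 ≤ r * L * (1 - 2 * t) ^ 2 := by positivity
  nlinarith

theorem eq_lineMap_of_dist_le {α β w : Euc n} {L τ : ℝ} (hL : dist α β = L) (hL0 : 0 < L)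
    (hτ0 : 0 ≤ τ) (hτL : τ ≤ L) (h1 : dist w α ≤ τ) (h2 : dist w β ≤ L - τ) :
    w = AffineMap.lineMap α β (τ / L) := by
  have := dist_lineMap_sq_le hL hL0 hτ0 hτL le_rfl (by simpa using h1) (by simpa using h2)
  rw [← dist_eq_zero]
  have h0 : dist w (AffineMap.lineMap α β (τ / L)) ^ 2 = 0 := by
    refine le_antisymm (by simpa using this) (sq_nonneg _)
  exact pow_eq_zero_iff two_ne_zero |>.1 h0

theorem eq_of_norm_add_ge {u v : Euc n} {h : ℝ} (hu : ‖u‖ ≤ h) (hv : ‖v‖ ≤ h)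
    (huv : 2 * h ≤ ‖u + v‖) : u = v := by
  have h0 : 0 ≤ h := (norm_nonneg u).trans hu
  have h1 := parallelogram_law_with_norm ℝ u v
  have h2 : ‖u - v‖ = 0 := by
    have := norm_nonneg (u - v)
    have := norm_nonneg u
    have := norm_nonneg v
    nlinarith
  rwa [norm_sub_eq_zero_iff] at h2

end Stewart

namespace BIso

open ISeq

variable {n : ℕ} {U V : Set (Euc n)}

/-- Every point outside of `V` that is visible from `y` is seen as a point outside of `U`. -/
theorem exists_of_exit (F : BIso U V) {y η : Euc n} (hy : y ∈ V) (hη : η ∉ V)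
    (hs : openSegment ℝ y η ⊆ V) :
    ∃ c : ISeq U, c.supp ∉ U ∧ edist (F.toFun c) (pt y hy) ≤ ENNReal.ofReal (dist y η) := by
  obtain ⟨c', hc', hcy⟩ := exists_end hy hη hs
  obtain ⟨c, hc, hcc⟩ := F.exists_preimage c' (by rwa [hc'])
  refine ⟨c, hc, (edist_triangle _ c' _).trans ?_⟩
  rw [hcc, zero_add, dist_comm]
  exact hcy y (left_mem_segment ℝ y η) hy

end BIso

section ChordMap

open ISeq

variable {n : ℕ} {U V : Set (Euc n)} {a b : ISeq U}

theorem IsChord.exists_ball_subset (hU : IsOpen U) (hV : IsOpen V) (F : BIso U V)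
    (h : IsChord a b) {L τ₀ : ℝ} (hL : dist a.supp b.supp = L) (hτ₀ : 0 < τ₀) :
    ∃ r > 0, ∀ τ ∈ Icc τ₀ (L - τ₀), ∀ y (hy : y ∈ V),
      edist (F.toFun a) (pt y hy) ≤ ENNReal.ofReal (τ + r) →
      edist (pt y hy) (F.toFun b) ≤ ENNReal.ofReal (L - τ + r) → ball y r ⊆ V := by
  have hL0 : 0 < L := by rw [← hL]; exact dist_pos.2 h.ne
  let K : Set (Euc n) := (fun τ : ℝ => AffineMap.lineMap a.supp b.supp (τ / L)) ''
    Icc τ₀ (L - τ₀)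
  have hK : IsCompact K := isCompact_Icc.image
    (AffineMap.lineMap_continuous.comp (continuous_id.div_const L))
  have hKU : K ⊆ U := by
    rintro _ ⟨τ, hτ, rfl⟩
    refine h.subset ?_
    rw [openSegment_eq_image_lineMap]
    refine ⟨τ / L, ⟨div_pos (hτ₀.trans_le hτ.1) hL0, ?_⟩, rfl⟩
    rw [div_lt_one hL0]
    linarith [hτ.2]
  obtain ⟨r₁, hr₁, hthick⟩ := hK.exists_thickening_subset_open hU hKU
  obtain ⟨r, hr, hr1, hrr⟩ : ∃ r : ℝ, 0 < r ∧ r ≤ 1 ∧ r * (2 * L + 4) < r₁ ^ 2 := by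
    refine ⟨min 1 (r₁ ^ 2 / (2 * L + 5)), by positivity, min_le_left _ _, ?_⟩
    calc _ ≤ r₁ ^ 2 / (2 * L + 5) * (2 * L + 4) := by gcongr; exact min_le_right _ _
      _ < r₁ ^ 2 := by
        rw [div_mul_eq_mul_div, div_lt_iff₀ (by positivity)]
        nlinarith [pow_pos hr₁ 2]
  refine ⟨r, hr, fun τ hτ y hy h1 h2 => ?_⟩
  by_contra hball
  obtain ⟨η, hη, hyη, hs⟩ := exists_exit_of_not_ball_subset hV hy hball
  obtain ⟨c, hc, hcy⟩ := F.exists_of_exit hy hη hs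
  have hcy' := hcy.trans (ENNReal.ofReal_le_ofReal hyη.le)
  have hτL := hτ.2
  have hτ0 := hτ₀.trans_le hτ.1
  have e1 : dist c.supp a.supp ≤ τ + 2 * r := by
    refine dist_supp_le (by linarith) ?_
    rw [← F.edist_eq c a hc h.left_notMem]
    rw [edist_comm] at h1
    convert edist_trans_le hr.le (by linarith) hcy' h1 using 2
    ring
  have e2 : dist c.supp b.supp ≤ L - τ + 2 * r := by
    refine dist_supp_le (by linarith) ?_
    rw [← F.edist_eq c b hc h.right_notMem]
    convert edist_trans_le hr.le (by linarith) hcy' h2 using 2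
    ring
  have e3 := dist_lineMap_sq_le hL hL0 hτ0.le (by linarith) (by linarith) e1 e2
  refine hc (hthick (mem_thickening_iff.2 ⟨_, ⟨τ, hτ, rfl⟩, ?_⟩))
  refine lt_of_pow_lt_pow_left₀ 2 hr₁.le ?_
  dsimp only
  nlinarith

theorem ISeq.exists_step {s b' : ISeq V} (hV : IsOpen V) {l σ r : ℝ} (hσ : 0 ≤ σ) (hσl : σ ≤ l)
    (hr : 0 < r) (h : edist s b' ≤ ENNReal.ofReal l)
    (hball : ∀ y (hy : y ∈ V), edist s (pt y hy) ≤ ENNReal.ofReal (σ + r) →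
      edist (pt y hy) b' ≤ ENNReal.ofReal (l - σ + r) → ball y r ⊆ V) :
    ∃ y, ∃ hy : y ∈ V, edist s (pt y hy) ≤ ENNReal.ofReal σ ∧
      edist (pt y hy) b' ≤ ENNReal.ofReal (l - σ) := by
  let ε : ℕ → ℝ := fun k => r * (1 / ((k : ℝ) + 1))
  have hε : ∀ k, 0 < ε k := fun k => by positivity
  have hεr : ∀ k, ε k ≤ r := fun k => by
    refine mul_le_of_le_one_right hr.le ?_
    rw [div_le_one (by positivity)]
    linarith [(Nat.cast_nonneg k : (0:ℝ) ≤ k)]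
  have hεlim : Tendsto ε atTop (nhds 0) := by
    simpa [ε] using (tendsto_one_div_add_atTop_nhds_zero_nat (𝕜 := ℝ)).const_mul r
  choose z hz h1 h2 using fun k => exists_between hV hσ hσl (hε k) h
  have hb : ∀ k, ball (z k) r ⊆ V := fun k => hball _ (hz k)
    ((h1 k).trans (ENNReal.ofReal_le_ofReal (by linarith [hεr k])))
    ((h2 k).trans (ENNReal.ofReal_le_ofReal (by linarith [hεr k])))
  have hbd : ∀ k, z k ∈ closedBall s.supp (σ + r) := fun k => by
    rw [mem_closedBall']
    have := hεr k
    have := (hε k).le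
    linarith [dist_supp_pt_le (by linarith) (h1 k)]
  obtain ⟨y, -, φ, hφ, hlim⟩ := tendsto_subseq_of_bounded isBounded_closedBall hbd
  have hd : Tendsto (fun k => dist (z (φ k)) y) atTop (nhds 0) :=
    tendsto_iff_dist_tendsto_zero.1 hlim
  have hev := hd.eventually (eventually_lt_nhds hr)
  have hy : y ∈ V := by
    obtain ⟨k, hk⟩ := hev.exists
    exact hb _ (mem_ball'.2 hk)
  have hlim2 : ∀ c : ℝ, Tendsto (fun k => ENNReal.ofReal (c + ε (φ k) + dist (z (φ k)) y)) atTop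
      (nhds (ENNReal.ofReal c)) := fun c => by
    have := ((hεlim.comp hφ.tendsto_atTop).const_add c).add hd
    simpa [Function.comp_def] using (ENNReal.continuous_ofReal.tendsto _).comp this
  have hzy : ∀ᶠ k in atTop, edist (pt (z (φ k)) (hz _)) (pt y hy) ≤
      ENNReal.ofReal (dist (z (φ k)) y) := by
    filter_upwards [hev] with k hk
    exact edist_pt_le_of_ball (hb (φ k)) (mem_ball_self hr) (mem_ball'.2 hk)
  refine ⟨y, hy, ge_of_tendsto (hlim2 σ) ?_, ge_of_tendsto (hlim2 (l - σ)) ?_⟩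
  · filter_upwards [hzy] with k hk
    exact edist_trans_le (by linarith [hε (φ k)]) dist_nonneg (h1 _) hk
  · filter_upwards [hzy] with k hk
    rw [edist_comm]
    have := h2 (φ k)
    rw [edist_comm] at this
    exact edist_trans_le (by linarith [hε (φ k)]) dist_nonneg this hk

/-- `z` is at intrinsic distance at most `τ` from `a` and at most `L - τ` from `b`. -/
def IsBetween (a b : ISeq V) (L τ : ℝ) (z : Euc n) : Prop :=
  ∃ hz : z ∈ V, edist a (pt z hz) ≤ ENNReal.ofReal τ ∧ edist (pt z hz) b ≤ ENNReal.ofReal (L - τ)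

theorem exists_isBetween_line {a b : ISeq V} (hV : IsOpen V) {L τ₀ r : ℝ}
    (hab : edist a b = ENNReal.ofReal L) (hτ₀ : 0 < τ₀) (hτL : 2 * τ₀ < L) (hr : 0 < r)
    (hball : ∀ τ ∈ Icc τ₀ (L - τ₀), ∀ y (hy : y ∈ V),
      edist a (pt y hy) ≤ ENNReal.ofReal (τ + r) →
      edist (pt y hy) b ≤ ENNReal.ofReal (L - τ + r) → ball y r ⊆ V) :
    ∃ p d : Euc n, ‖d‖ = 1 ∧ ∀ τ ∈ Icc τ₀ (L - τ₀), IsBetween a b L τ (p + τ • d) := by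
  have hb : ∀ τ ∈ Icc τ₀ (L - τ₀), ∀ z, IsBetween a b L τ z → ball z r ⊆ V := by
    rintro τ hτ z ⟨hz, h1, h2⟩
    exact hball τ hτ z hz (h1.trans (ENNReal.ofReal_le_ofReal (by linarith)))
      (h2.trans (ENNReal.ofReal_le_ofReal (by linarith)))
  have hstart : ∃ p, IsBetween a b L τ₀ p := by
    obtain ⟨y, hy, h1, h2⟩ := exists_step hV hτ₀.le (by linarith : τ₀ ≤ L) hr hab.le
      (fun y hy => hball τ₀ ⟨le_rfl, by linarith⟩ y hy)
    exact ⟨y, hy, h1, h2⟩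
  have hstep : ∀ τ ∈ Icc τ₀ (L - τ₀), ∀ τ' ∈ Icc τ₀ (L - τ₀), τ ≤ τ' → ∀ z,
      IsBetween a b L τ z → ∃ z', IsBetween a b L τ' z' ∧ dist z z' ≤ τ' - τ := by
    rintro τ hτ τ' hτ' hle z ⟨hz, h1, h2⟩
    have hτ0 := hτ₀.le.trans hτ.1
    have hL' := hτ'.2
    obtain ⟨y, hy, h3, h4⟩ := exists_step hV (sub_nonneg.2 hle)
      (by linarith : τ' - τ ≤ L - τ) hr h2 (fun y hy h3 h4 => hball τ' hτ' y hy
        ((edist_trans_le hτ0 (by linarith) h1 h3).trans (ENNReal.ofReal_le_ofReal (by linarith)))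
        (h4.trans (ENNReal.ofReal_le_ofReal (by linarith))))
    refine ⟨y, ⟨hy, ?_, ?_⟩, ?_⟩
    · convert edist_trans_le hτ0 (sub_nonneg.2 hle) h1 h3 using 2
      ring
    · convert h4 using 2
      ring
    · simpa [supp_pt] using dist_supp_le (sub_nonneg.2 hle) h3
  have hlow : ∀ τ ∈ Icc τ₀ (L - τ₀), ∀ τ' ∈ Icc τ₀ (L - τ₀), ∀ z z', IsBetween a b L τ z →
      IsBetween a b L τ' z' → dist z z' < r → τ' - τ ≤ dist z z' := by
    rintro τ hτ τ' hτ' z z' hz ⟨hz', h1', h2'⟩ hd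
    have e := edist_pt_le_of_ball (hb τ hτ z hz) (mem_ball_self hr) (mem_ball'.2 hd)
    obtain ⟨hz, h1, h2⟩ := hz
    have e2 := edist_trans_le (add_nonneg (hτ₀.le.trans hτ.1) dist_nonneg)
      (by linarith [hτ'.2]) (edist_trans_le (hτ₀.le.trans hτ.1) dist_nonneg h1 e) h2'
    rw [hab, ENNReal.ofReal_le_ofReal_iff
      (by linarith [hτ'.2, hτ.1, dist_nonneg (x := z) (y := z')])] at e2
    linarith
  have hmid : ∀ τ ∈ Icc τ₀ (L - τ₀), ∀ τ' ∈ Icc τ₀ (L - τ₀), ∀ z z' w, ∀ σ ∈ Icc τ τ',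
      IsBetween a b L τ z → IsBetween a b L τ' z' → τ' - τ < r → dist z w ≤ σ - τ →
      dist w z' ≤ τ' - σ → IsBetween a b L σ w := by
    rintro τ hτ τ' hτ' z z' w σ hσ hz hz' hr' hd hd'
    have e := edist_pt_le_of_ball (hb τ hτ z hz) (mem_ball_self hr)
      (mem_ball'.2 (show dist z w < r by linarith [hσ.2]))
    have e' := edist_pt_le_of_ball (hb τ' hτ' z' hz')
      (mem_ball.2 (show dist w z' < r by linarith [hσ.1])) (mem_ball_self hr)
    obtain ⟨hz, h1, h2⟩ := hz
    obtain ⟨hz', h1', h2'⟩ := hz'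
    refine ⟨_, (edist_trans_le (hτ₀.le.trans hτ.1) dist_nonneg h1 e).trans ?_,
      (edist_trans_le dist_nonneg (by linarith [hτ'.2]) e' h2').trans ?_⟩
    · exact ENNReal.ofReal_le_ofReal (by linarith)
    · exact ENNReal.ofReal_le_ofReal (by linarith)
  obtain ⟨N, hN⟩ := exists_nat_gt ((L - 2 * τ₀) * 2 / r)
  let h : ℝ := (L - 2 * τ₀) / (N + 1)
  have hh : 0 < h := div_pos (by linarith) (by positivity)
  have hNh : (N + 1) * h = L - 2 * τ₀ := by simp only [h]; field_simp
  have hhr : 2 * h < r := by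
    rw [div_lt_iff₀ hr] at hN
    have : (0:ℝ) ≤ N := Nat.cast_nonneg N
    nlinarith
  have main : ∀ k : ℕ, k ≤ N → ∃ p d : Euc n, ‖d‖ = 1 ∧
      ∀ τ ∈ Icc τ₀ (τ₀ + (k + 1) * h), IsBetween a b L τ (p + τ • d) := by
    intro k
    induction k with
    | zero =>
      intro _
      have hNh' : h ≤ L - 2 * τ₀ := by
        rw [← hNh]
        nlinarith [(Nat.cast_nonneg N : (0:ℝ) ≤ N)]
      have m0 : τ₀ ∈ Icc τ₀ (L - τ₀) := ⟨le_rfl, by linarith⟩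
      have m1 : τ₀ + h ∈ Icc τ₀ (L - τ₀) := ⟨by linarith, by linarith⟩
      obtain ⟨p, hp⟩ := hstart
      obtain ⟨q, hq, hpq⟩ := hstep _ m0 _ m1 (by linarith) p hp
      have hpq' := hlow _ m0 _ m1 p q hp hq (by linarith)
      have hn : ‖q - p‖ = h := by
        rw [← dist_eq_norm, dist_comm]; linarith
      refine ⟨p - τ₀ • h⁻¹ • (q - p), h⁻¹ • (q - p), ?_, fun τ hτ => ?_⟩
      · rw [norm_smul, hn, Real.norm_of_nonneg (by positivity)]
        field_simp
      have hτ2 := hτ.2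
      simp only [Nat.cast_zero, zero_add, one_mul] at hτ2
      have e1 : p - τ₀ • h⁻¹ • (q - p) + τ • h⁻¹ • (q - p) =
          p + ((τ - τ₀) * h⁻¹) • (q - p) := by module
      have e2 : q - (p + ((τ - τ₀) * h⁻¹) • (q - p)) =
          ((τ₀ + h - τ) * h⁻¹) • (q - p) := by
        have : (τ₀ + h - τ) * h⁻¹ = 1 - (τ - τ₀) * h⁻¹ := by field_simp; ring
        rw [this]
        module
      rw [e1]
      refine hmid _ m0 _ m1 p q _ τ ⟨hτ.1, hτ2⟩ hp hq (by linarith) ?_ ?_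
      · rw [dist_self_add_right, norm_smul, hn, Real.norm_of_nonneg
          (mul_nonneg (by linarith [hτ.1]) (by positivity)), mul_assoc, inv_mul_cancel₀ hh.ne',
          mul_one]
      · rw [dist_comm, dist_eq_norm, e2, norm_smul, hn, Real.norm_of_nonneg
          (mul_nonneg (by linarith) (by positivity)), mul_assoc, inv_mul_cancel₀ hh.ne',
          mul_one]
    | succ k ih =>
      intro hk
      obtain ⟨p, d, hd, hpd⟩ := ih (by omega)
      have hkN : ((k:ℝ) + 2) * h ≤ L - 2 * τ₀ := by
        rw [← hNh]
        have : (k:ℝ) + 1 ≤ N := by exact_mod_cast hk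
        nlinarith
      have hk0 : (0:ℝ) ≤ k * h := by positivity
      push_cast
      have m0 : τ₀ + k * h ∈ Icc τ₀ (L - τ₀) := ⟨by linarith, by linarith⟩
      have m1 : τ₀ + (k + 1) * h ∈ Icc τ₀ (L - τ₀) := ⟨by linarith, by linarith⟩
      have m2 : τ₀ + (k + 2) * h ∈ Icc τ₀ (L - τ₀) := ⟨by linarith, by linarith⟩
      have g0 := hpd (τ₀ + k * h) ⟨by linarith, by linarith⟩
      have g1 := hpd (τ₀ + (k + 1) * h) ⟨by linarith, le_rfl⟩
      obtain ⟨q, hq, hpq⟩ := hstep _ m1 _ m2 (by linarith) _ g1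
      have hd01 : dist (p + (τ₀ + k * h) • d) (p + (τ₀ + (k + 1) * h) • d) = h := by
        rw [dist_add_left, dist_eq_norm, ← sub_smul, norm_smul, hd, mul_one, Real.norm_eq_abs]
        rw [show τ₀ + k * h - (τ₀ + (k + 1) * h) = -h by ring, abs_neg, abs_of_pos hh]
      have hlo := hlow _ m0 _ m2 _ q g0 hq ((dist_triangle _ _ _).trans_lt
        (lt_of_le_of_lt (add_le_add hd01.le hpq) (by linarith)))
      have hqd : q - (p + (τ₀ + (k + 1) * h) • d) = h • d := by
        refine eq_of_norm_add_ge (h := h) ?_ ?_ ?_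
        · rw [← dist_eq_norm, dist_comm]
          linarith
        · rw [norm_smul, hd, mul_one, Real.norm_of_nonneg hh.le]
        · rw [dist_comm, dist_eq_norm] at hlo
          have : q - (p + (τ₀ + (k + 1) * h) • d) + h • d = q - (p + (τ₀ + k * h) • d) := by
            module
          rw [this]
          linarith
      have hqe : q = p + (τ₀ + (k + 2) * h) • d := by
        rw [sub_eq_iff_eq_add] at hqd
        rw [hqd]
        module
      refine ⟨p, d, hd, fun τ hτ => ?_⟩
      rcases le_total τ (τ₀ + (k + 1) * h) with hcase | hcase
      · exact hpd τ ⟨hτ.1, hcase⟩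
      · have hτ2 : τ ≤ τ₀ + (k + 2) * h := by linarith [hτ.2]
        refine hmid _ m1 _ m2 _ q _ τ ⟨hcase, hτ2⟩ g1 hq (by linarith) ?_ ?_
        · rw [dist_add_left, dist_eq_norm, ← sub_smul, norm_smul, hd, mul_one, Real.norm_eq_abs,
            abs_sub_comm, abs_of_nonneg (by linarith)]
        · rw [hqe, dist_add_left, dist_eq_norm, ← sub_smul, norm_smul, hd, mul_one,
            Real.norm_eq_abs, abs_sub_comm, abs_of_nonneg (by linarith)]
  obtain ⟨p, d, hd, hpd⟩ := main N le_rfl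
  refine ⟨p, d, hd, fun τ hτ => hpd τ ⟨hτ.1, ?_⟩⟩
  rw [hNh]
  linarith [hτ.2]

theorem IsChord.map (hU : IsOpen U) (hV : IsOpen V) (F : BIso U V) (h : IsChord a b) :
    IsChord (F.toFun a) (F.toFun b) ∧
      dist (F.toFun a).supp (F.toFun b).supp = dist a.supp b.supp := by
  obtain ⟨L, hL⟩ : ∃ L, dist a.supp b.supp = L := ⟨_, rfl⟩
  have hL0 : 0 < L := by rw [← hL]; exact dist_pos.2 h.ne
  have hab : edist (F.toFun a) (F.toFun b) = ENNReal.ofReal L := by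
    rw [F.edist_eq _ _ h.left_notMem h.right_notMem, h.edist_eq, hL]
  have key : ∀ τ₀, 0 < τ₀ → 2 * τ₀ < L → ∃ p d : Euc n, ‖d‖ = 1 ∧
      ∀ τ ∈ Icc τ₀ (L - τ₀), IsBetween (F.toFun a) (F.toFun b) L τ (p + τ • d) := by
    intro τ₀ h0 h1
    obtain ⟨r, hr, hball⟩ := h.exists_ball_subset hU hV F hL h0
    exact exists_isBetween_line hV hab h0 h1 hr hball
  have hup : dist (F.toFun a).supp (F.toFun b).supp ≤ L := dist_supp_le hL0.le hab.le
  have hdist : dist (F.toFun a).supp (F.toFun b).supp = L := by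
    refine le_antisymm hup (le_of_forall_pos_le_add fun ε hε => ?_)
    have h0 : 0 < min (ε / 4) (L / 4) := by positivity
    have h1 := min_le_left (ε / 4) (L / 4)
    have h2 := min_le_right (ε / 4) (L / 4)
    set τ₀ := min (ε / 4) (L / 4)
    obtain ⟨p, d, hd, hpd⟩ := key τ₀ h0 (by linarith)
    obtain ⟨hz, e1, e2⟩ := hpd τ₀ ⟨le_rfl, by linarith⟩
    obtain ⟨hz', e1', e2'⟩ := hpd (L - τ₀) ⟨by linarith, le_rfl⟩
    have d1 := dist_supp_pt_le h0.le e1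
    rw [edist_comm] at e2'
    have d2 := dist_supp_pt_le (by linarith) e2'
    have d3 : dist (p + τ₀ • d) (p + (L - τ₀) • d) = L - 2 * τ₀ := by
      rw [dist_add_left, dist_eq_norm, ← sub_smul, norm_smul, hd, mul_one, Real.norm_eq_abs,
        abs_sub_comm, abs_of_nonneg (by linarith)]
      ring
    have d4 := dist_triangle4_left (F.toFun a).supp (F.toFun b).supp (p + τ₀ • d)
      (p + (L - τ₀) • d)
    have d5 := dist_triangle4 (p + τ₀ • d) (F.toFun a).supp (F.toFun b).supp
      (p + (L - τ₀) • d)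
    rw [dist_comm (p + τ₀ • d) (F.toFun a).supp] at d5
    linarith
  have main : ∀ z ∈ openSegment ℝ (F.toFun a).supp (F.toFun b).supp,
      IsBetween (F.toFun a) (F.toFun b) L (dist (F.toFun a).supp z) z := by
    intro z hz
    rw [openSegment_eq_image_lineMap] at hz
    obtain ⟨t, ht, rfl⟩ := hz
    have ht0 : 0 < t * L := mul_pos ht.1 hL0
    have ht1 : 0 < (1 - t) * L := mul_pos (sub_pos.2 ht.2) hL0
    have h0 : 0 < min (t * L) ((1 - t) * L) / 2 := by positivity
    have h1 := min_le_left (t * L) ((1 - t) * L)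
    have h2 := min_le_right (t * L) ((1 - t) * L)
    set τ₀ := min (t * L) ((1 - t) * L) / 2 with hτ₀
    obtain ⟨p, d, hd, hpd⟩ := key τ₀ h0 (by linarith)
    have hg := hpd (t * L) ⟨by linarith, by linarith⟩
    obtain ⟨hz, e1, e2⟩ := id hg
    rw [dist_left_lineMap, Real.norm_of_nonneg ht.1.le, hdist]
    rw [edist_comm] at e2
    have := eq_lineMap_of_dist_le (w := p + (t * L) • d) hdist hL0 ht0.le (by linarith)
      (by rw [dist_comm]; exact dist_supp_pt_le ht0.le e1)
      (by rw [dist_comm]; exact dist_supp_pt_le (by linarith) e2)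
    rw [mul_div_cancel_right₀ _ hL0.ne'] at this
    rwa [← this]
  refine ⟨⟨F.supp_notMem _ h.left_notMem, F.supp_notMem _ h.right_notMem, ?_,
    fun z hz => (main z hz).1, fun z hz => (main z hz).2.1, fun z hz => ?_⟩, by rw [hdist, hL]⟩
  · exact dist_pos.1 (by rw [hdist]; exact hL0)
  · rw [edist_comm]
    convert (main z hz).2.2 using 2
    rw [← hdist, ← dist_add_dist_of_mem_segment (openSegment_subset_segment ℝ _ _ hz),
      dist_comm z]
    ring

end ChordMap

section FanLemma

open Real

variable {n : ℕ}

theorem half_mul_sub_le_arctan_sub {t t' : ℝ} (h0 : 0 ≤ t) (htt : t ≤ t') (h1 : t' ≤ 1) :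
    (t' - t) / 2 ≤ arctan t' - arctan t := by
  have := (convex_Icc (0:ℝ) 1).mul_sub_le_image_sub_of_le_deriv (f := arctan) (C := 1 / 2)
    continuous_arctan.continuousOn differentiable_arctan.differentiableOn (fun x hx => by
      rw [interior_Icc] at hx
      simp only [Real.deriv_arctan]
      gcongr
      nlinarith [hx.1, hx.2]) t ⟨h0, htt.trans h1⟩ t' ⟨h0.trans htt, h1⟩ htt
  linarith

theorem mul_sq_le_cos_sub_cos {β ε : ℝ} (hβ : 0 ≤ β) (hβ1 : β ≤ π / 4) (hε : 0 ≤ ε) (hε1 : ε ≤ 1) :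
    4 * ε / π ^ 2 * β ^ 2 ≤ cos β - cos ((1 + ε) * β) := by
  have hπ := pi_pos
  rw [cos_sub_cos]
  have e1 : (β + (1 + ε) * β) / 2 = (1 + ε / 2) * β := by ring
  have e2 : sin ((β - (1 + ε) * β) / 2) = - sin (ε * β / 2) := by
    rw [← sin_neg]; congr 1; ring
  rw [e1, e2]
  have a1 : 2 / π * ((1 + ε / 2) * β) ≤ sin ((1 + ε / 2) * β) :=
    mul_le_sin (by positivity) (by nlinarith)
  have a2 : 2 / π * (ε * β / 2) ≤ sin (ε * β / 2) := mul_le_sin (by positivity) (by nlinarith)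
  have a3 : 2 / π * β ≤ sin ((1 + ε / 2) * β) := by
    refine le_trans ?_ a1
    gcongr
    nlinarith
  have a4 := mul_le_mul a3 a2 (by positivity) (le_trans (by positivity) a3)
  have e3 : 4 * ε / π ^ 2 * β ^ 2 = 2 * (2 / π * β * (2 / π * (ε * β / 2))) := by
    field_simp
    ring
  rw [e3]
  linarith

/-- The point on the line of slope `t` (in the frame `w, w'`) with reciprocal abscissa `u`. -/
def fanPt (w w' : Euc n) (t u : ℝ) : Euc n := u⁻¹ • (w + t • w')

variable {w w' : Euc n}

theorem inner_slope (hw : ‖w‖ = 1) (hw' : ‖w'‖ = 1) (hww : inner ℝ w w' = 0) (t t' : ℝ) :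
    inner ℝ (w + t • w') (w + t' • w') = 1 + t * t' := by
  have hww' : inner ℝ w' w = 0 := by rw [real_inner_comm]; exact hww
  simp only [inner_add_left, inner_add_right, real_inner_smul_left, real_inner_smul_right,
    real_inner_self_eq_norm_sq, hw, hw', hww, hww']
  ring

theorem norm_slope (hw : ‖w‖ = 1) (hw' : ‖w'‖ = 1) (hww : inner ℝ w w' = 0) (t : ℝ) :
    ‖w + t • w'‖ = √(1 + t ^ 2) := by
  rw [norm_eq_sqrt_real_inner, inner_slope hw hw' hww]
  ring_nf

theorem norm_fanPt (hw : ‖w‖ = 1) (hw' : ‖w'‖ = 1) (hww : inner ℝ w w' = 0) {t u : ℝ}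
    (hu : 0 < u) : ‖fanPt w w' t u‖ = √(1 + t ^ 2) / u := by
  rw [fanPt, norm_smul, norm_slope hw hw' hww, Real.norm_of_nonneg (by positivity), inv_mul_eq_div]

theorem inner_fanPt (hw : ‖w‖ = 1) (hw' : ‖w'‖ = 1) (hww : inner ℝ w w' = 0) {t t' u u' : ℝ}
    (hu : 0 < u) (hu' : 0 < u') :
    inner ℝ (fanPt w w' t u) (fanPt w w' t' u') =
      ‖fanPt w w' t u‖ * ‖fanPt w w' t' u'‖ * cos (arctan t' - arctan t) := by
  have h1 : 0 < √(1 + t ^ 2) := by positivity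
  have h2 : 0 < √(1 + t' ^ 2) := by positivity
  rw [norm_fanPt hw hw' hww hu, norm_fanPt hw hw' hww hu', fanPt, fanPt, real_inner_smul_left,
    real_inner_smul_right, inner_slope hw hw' hww, cos_sub, cos_arctan, cos_arctan, sin_arctan,
    sin_arctan]
  field_simp

theorem dist_fanPt_sq (hw : ‖w‖ = 1) (hw' : ‖w'‖ = 1) (hww : inner ℝ w w' = 0) {t t' u u' : ℝ}
    (hu : 0 < u) (hu' : 0 < u') :
    dist (fanPt w w' t u) (fanPt w w' t' u') ^ 2 =
      ‖fanPt w w' t u‖ ^ 2 + ‖fanPt w w' t' u'‖ ^ 2 -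
      2 * ‖fanPt w w' t u‖ * ‖fanPt w w' t' u'‖ * cos (arctan t' - arctan t) := by
  rw [dist_eq_norm, norm_sub_sq_real, inner_fanPt hw hw' hww hu hu']
  ring

/-- The hypotheses of the fan lemma: `u` describes a fan of segments, and `φ` the directions of the
corresponding segments of another fan whose ends are no further apart than the lengths of the
two-segment paths in the first one. -/
structure FanData (w w' : Euc n) (m c C : ℝ) (u φ : ℝ → ℝ) : Prop where
  hw : ‖w‖ = 1
  hw' : ‖w'‖ = 1
  hww : inner ℝ w w' = 0
  m_pos : 0 < m
  m_le : m ≤ 1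
  c_pos : 0 < c
  le_u : ∀ t ∈ Icc 0 m, c ≤ u t
  u_le : ∀ t ∈ Icc 0 m, u t ≤ C
  usc : UpperSemicontinuousOn u (Icc 0 m)
  cont : ContinuousOn φ (Icc 0 m)
  abs_sub_le : ∀ t ∈ Icc 0 m, ∀ t' ∈ Icc 0 m, |φ t' - φ t| ≤ π
  path : ∀ t ∈ Icc 0 m, ∀ t' ∈ Icc 0 m, t < t' → ∀ s : ℝ,
    (∀ x ∈ Icc t t', u x ≤ u t + s * (x - t)) →
    ‖fanPt w w' t (u t)‖ ^ 2 + ‖fanPt w w' t' (u t')‖ ^ 2 -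
      2 * ‖fanPt w w' t (u t)‖ * ‖fanPt w w' t' (u t')‖ * cos (φ t' - φ t) ≤
    (dist (fanPt w w' t (u t)) (fanPt w w' t' (u t + s * (t' - t))) +
      dist (fanPt w w' t' (u t + s * (t' - t))) (fanPt w w' t' (u t'))) ^ 2

namespace FanData

variable {m c C : ℝ} {u φ : ℝ → ℝ}

theorem estimate (D : FanData w w' m c C u φ) {t t' s ε K : ℝ} (ht : t ∈ Icc 0 m)
    (ht' : t' ∈ Icc 0 m) (htt : t < t') (hs : |s| ≤ K)
    (hle : ∀ x ∈ Icc t t', u x ≤ u t + s * (x - t))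
    (hgap : u t + s * (t' - t) - u t' ≤ ε * (t' - t)) :
    cos (arctan t' - arctan t) - cos (φ t' - φ t) ≤
      4 * C ^ 2 * (2 * K / c ^ 2 + 1 / c) * ε / c ^ 2 * (t' - t) ^ 2 := by
  have hc := D.c_pos
  have hΔ : 0 < t' - t := sub_pos.2 htt
  have hu0 := D.le_u t ht
  have hu1 := D.le_u t' ht'
  have hu0' : 0 < u t := hc.trans_le hu0
  have hu1' : 0 < u t' := hc.trans_le hu1
  have hl1 := hle t' ⟨htt.le, le_rfl⟩
  have hP := D.path t ht t' ht' htt s hle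
  set l := u t + s * (t' - t) with hl
  have hlc : c ≤ l := hu1.trans hl1
  have hl0 : 0 < l := hc.trans_le hlc
  have hC : 0 < C := hu0'.trans_le (D.u_le t ht)
  have hK : 0 ≤ K := (abs_nonneg s).trans hs
  have hε : 0 ≤ ε := nonneg_of_mul_nonneg_left (le_trans (by linarith) hgap) hΔ
  have hD := dist_fanPt_sq D.hw D.hw' D.hww (t := t) (t' := t') hu0' hu1'
  have hrev : (dist (fanPt w w' t (u t)) (fanPt w w' t' l) -
      dist (fanPt w w' t' l) (fanPt w w' t' (u t'))) ^ 2 ≤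
      dist (fanPt w w' t (u t)) (fanPt w w' t' (u t')) ^ 2 := by
    rw [sq_le_sq, abs_of_nonneg (dist_nonneg (x := fanPt w w' t (u t)))]
    rw [dist_comm (fanPt w w' t' l)]
    exact abs_dist_sub_le _ _ _
  have sq2 : ∀ x ∈ Icc 0 m, √(1 + x ^ 2) ≤ 2 := fun x hx => by
    rw [sqrt_le_left (by norm_num)]
    nlinarith [hx.1, hx.2, D.m_le]
  have sq1 : ∀ x : ℝ, 1 ≤ √(1 + x ^ 2) := fun x => by
    rw [one_le_sqrt]; nlinarith [sq_nonneg x]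
  have hinv : ∀ x y z : ℝ, c ≤ x → c ≤ y → |y - x| ≤ z → |x⁻¹ - y⁻¹| ≤ z / c ^ 2 :=
    fun x y z hx hy hz => by
      have hx0 := hc.trans_le hx
      have hy0 := hc.trans_le hy
      have : x⁻¹ - y⁻¹ = (y - x) / (x * y) := by field_simp
      rw [this, abs_div, abs_of_pos (mul_pos hx0 hy0)]
      have h0 : 0 ≤ z := (abs_nonneg _).trans hz
      have : c ^ 2 ≤ x * y := by nlinarith
      gcongr
  have hQ : dist (fanPt w w' t (u t)) (fanPt w w' t' l) ≤ (2 * K / c ^ 2 + 1 / c) * (t' - t) := by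
    have : fanPt w w' t (u t) - fanPt w w' t' l =
        ((u t)⁻¹ - l⁻¹) • (w + t • w') - (l⁻¹ * (t' - t)) • w' := by
      simp only [fanPt]; module
    rw [dist_eq_norm, this]
    refine (norm_sub_le _ _).trans ?_
    rw [norm_smul, norm_smul, D.hw', norm_slope D.hw D.hw' D.hww, Real.norm_eq_abs,
      Real.norm_of_nonneg (by positivity)]
    have h1 := hinv (u t) l (K * (t' - t)) hu0 hlc (by
      rw [hl, add_sub_cancel_left, abs_mul, abs_of_pos hΔ]; gcongr)
    have h2 : l⁻¹ ≤ c⁻¹ := inv_anti₀ hc hlc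
    calc _ ≤ K * (t' - t) / c ^ 2 * 2 + c⁻¹ * (t' - t) * 1 := by
          gcongr
          exact sq2 t ht
      _ = _ := by ring
  have hη : dist (fanPt w w' t' l) (fanPt w w' t' (u t')) ≤ 2 * ε / c ^ 2 * (t' - t) := by
    have : fanPt w w' t' l - fanPt w w' t' (u t') = (l⁻¹ - (u t')⁻¹) • (w + t' • w') := by
      simp only [fanPt]; module
    rw [dist_eq_norm, this, norm_smul, norm_slope D.hw D.hw' D.hww, Real.norm_eq_abs]
    have h1 := hinv l (u t') (ε * (t' - t)) hlc hu1 (by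
      rw [abs_sub_comm, abs_of_nonneg (by linarith)]; exact hgap)
    calc _ ≤ ε * (t' - t) / c ^ 2 * 2 := by
          gcongr
          exact sq2 t' ht'
      _ = _ := by ring
  have hE : ∀ x ∈ Icc 0 m, 1 / C ≤ ‖fanPt w w' x (u x)‖ := fun x hx => by
    rw [norm_fanPt D.hw D.hw' D.hww (hc.trans_le (D.le_u x hx))]
    have := hc.trans_le (D.le_u x hx)
    have := D.u_le x hx
    gcongr
    exact sq1 x
  have hEE := mul_le_mul (hE t ht) (hE t' ht') (by positivity) (norm_nonneg _)
  set Q := dist (fanPt w w' t (u t)) (fanPt w w' t' l)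
  set η := dist (fanPt w w' t' l) (fanPt w w' t' (u t'))
  set A := ‖fanPt w w' t (u t)‖
  set B := ‖fanPt w w' t' (u t')‖
  have hQη := mul_le_mul hQ hη dist_nonneg (by positivity)
  have hmain : 2 * (A * B) * (cos (arctan t' - arctan t) - cos (φ t' - φ t)) ≤ 4 * (Q * η) := by
    nlinarith
  rcases le_total (cos (arctan t' - arctan t)) (cos (φ t' - φ t)) with hcase | hcase
  · exact (sub_nonpos.2 hcase).trans (by positivity)
  · have h3 : 2 * (1 / C * (1 / C)) * (cos (arctan t' - arctan t) - cos (φ t' - φ t)) ≤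
        4 * ((2 * K / c ^ 2 + 1 / c) * (t' - t) * (2 * ε / c ^ 2 * (t' - t))) := by
      refine le_trans ?_ (hmain.trans (by linarith))
      have := sub_nonneg.2 hcase
      gcongr
    have h4 := mul_le_mul_of_nonneg_left h3 (show 0 ≤ C ^ 2 / 2 by positivity)
    calc _ = C ^ 2 / 2 * (2 * (1 / C * (1 / C)) *
        (cos (arctan t' - arctan t) - cos (φ t' - φ t))) := by field_simp
      _ ≤ _ := h4
      _ = _ := by ring

/-- From a point `t` satisfying the one-sided slope bound one can advance to a further such point
without the angle growing faster than allowed. -/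
theorem exists_jump (D : FanData w w' m c C u φ) {t N ε : ℝ} (ht : t ∈ Ico 0 m) (hε : 0 < ε)
    (hε1 : ε ≤ 1) (hN : ∀ x ∈ Icc t m, u x ≤ u t + N * (x - t)) :
    ∃ t' ∈ Ioc t m, (∀ x ∈ Icc t' m, u x ≤ u t' + N * (x - t')) ∧
      |φ t' - φ t| ≤ (1 + ε) * (arctan t' - arctan t) := by
  have hc := D.c_pos
  have htm : t ∈ Icc 0 m := Ico_subset_Icc_self ht
  have hC : 0 < C := (hc.trans_le (D.le_u t htm)).trans_le (D.u_le t htm)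
  have hπ := pi_pos
  let S : Set ℝ := (fun x => (u x - u t) / (x - t)) '' Ioc t m
  have hmS : (u m - u t) / (m - t) ∈ S := ⟨m, ⟨ht.2, le_rfl⟩, rfl⟩
  have hSN : ∀ y ∈ S, y ≤ N := by
    rintro _ ⟨x, hx, rfl⟩
    dsimp only
    rw [div_le_iff₀ (sub_pos.2 hx.1)]
    linarith [hN x ⟨hx.1.le, hx.2⟩]
  have hbdd : BddAbove S := ⟨N, hSN⟩
  set s := sSup S with hsdef
  have hsN : s ≤ N := csSup_le ⟨_, hmS⟩ hSN
  have hs : ∀ x ∈ Icc t m, u x ≤ u t + s * (x - t) := fun x hx => by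
    rcases hx.1.eq_or_lt with h0 | h0
    · simp [← h0]
    · have := le_csSup hbdd (show (u x - u t) / (x - t) ∈ S from ⟨x, ⟨h0, hx.2⟩, rfl⟩)
      rw [div_le_iff₀ (sub_pos.2 h0)] at this
      linarith
  set K := max |N| |(u m - u t) / (m - t)| with hK
  have hsK : |s| ≤ K := abs_le_max_abs_abs (le_csSup hbdd hmS) hsN |>.trans_eq (max_comm _ _)
  have hK0 : 0 ≤ K := (abs_nonneg s).trans hsK
  obtain ⟨δ, hδ, hδε⟩ : ∃ δ > 0,
      4 * C ^ 2 * (2 * K / c ^ 2 + 1 / c) * δ / c ^ 2 < ε / π ^ 2 := by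
    set G := 4 * C ^ 2 * (2 * K / c ^ 2 + 1 / c) / c ^ 2 with hG
    have hG0 : 0 < G := by positivity
    refine ⟨ε / π ^ 2 / (2 * G), by positivity, ?_⟩
    calc _ = G * (ε / π ^ 2 / (2 * G)) := by rw [hG]; ring
      _ = ε / π ^ 2 / 2 := by field_simp
      _ < _ := half_lt_self (by positivity)
  obtain ⟨t', ht', hmax⟩ : ∃ t' ∈ Icc t m, ∀ x ∈ Icc t m,
      u x + -(s - δ) * x ≤ u t' + -(s - δ) * t' := by
    have husc : UpperSemicontinuousOn (fun x => u x + -(s - δ) * x) (Icc t m) :=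
      (D.usc.mono (Icc_subset_Icc ht.1 le_rfl)).add
        ((Continuous.upperSemicontinuous (by fun_prop)).upperSemicontinuousOn _)
    exact husc.exists_isMaxOn (nonempty_Icc.2 ht.2.le) isCompact_Icc
  have htt : t < t' := by
    refine lt_of_le_of_ne ht'.1 fun h0 => ?_
    obtain ⟨_, ⟨x, hx, rfl⟩, hxs⟩ := exists_lt_of_lt_csSup ⟨_, hmS⟩ (sub_lt_self s hδ)
    dsimp only at hxs
    rw [lt_div_iff₀ (sub_pos.2 hx.1)] at hxs
    have := hmax x ⟨hx.1.le, hx.2⟩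
    rw [← h0] at this
    linarith
  have ht'm : t' ∈ Icc 0 m := ⟨ht.1.trans ht'.1, ht'.2⟩
  refine ⟨t', ⟨htt, ht'.2⟩, fun x hx => ?_, ?_⟩
  · have := hmax x ⟨ht'.1.trans hx.1, hx.2⟩
    have h2 : (s - δ) * (x - t') ≤ N * (x - t') :=
      mul_le_mul_of_nonneg_right (by linarith) (sub_nonneg.2 hx.1)
    linarith
  · have hest := D.estimate htm ht'm htt hsK (fun x hx => hs x ⟨hx.1, hx.2.trans ht'.2⟩)
      (ε := δ) (by linarith [hmax t ⟨le_rfl, ht.2.le⟩])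
    have hβ := half_mul_sub_le_arctan_sub ht.1 htt.le (ht'.2.trans D.m_le)
    have hβ1 : arctan t' - arctan t ≤ π / 4 := by
      have h1 : arctan t' ≤ arctan 1 := arctan_strictMono.monotone (ht'.2.trans D.m_le)
      have h2 : 0 ≤ arctan t := arctan_nonneg.2 ht.1
      rw [arctan_one] at h1
      linarith
    set β := arctan t' - arctan t with hβdef
    have hβ0 : 0 < β := by linarith
    by_contra! hlt
    have hcos := mul_sq_le_cos_sub_cos hβ0.le hβ1 hε.le hε1
    have hcos2 : cos (φ t' - φ t) ≤ cos ((1 + ε) * β) := by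
      rw [← cos_abs (φ t' - φ t)]
      exact cos_le_cos_of_nonneg_of_le_pi (by positivity) (D.abs_sub_le t htm t' ht'm) hlt.le
    have h5 : ε / π ^ 2 * (t' - t) ^ 2 ≤ 4 * ε / π ^ 2 * β ^ 2 := by
      have : (t' - t) ^ 2 ≤ 4 * β ^ 2 := by nlinarith
      calc _ ≤ ε / π ^ 2 * (4 * β ^ 2) := by gcongr
        _ = _ := by ring
    have h6 := mul_lt_mul_of_pos_right hδε (pow_pos (sub_pos.2 htt) 2)
    linarith

theorem abs_sub_le_of_slope (D : FanData w w' m c C u φ) {t₀ N ε : ℝ} (ht₀ : t₀ ∈ Icc 0 m)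
    (hε : 0 < ε) (hε1 : ε ≤ 1) (hN : ∀ x ∈ Icc t₀ m, u x ≤ u t₀ + N * (x - t₀)) :
    |φ m - φ t₀| ≤ (1 + ε) * (arctan m - arctan t₀) := by
  let T : Set ℝ := {t | t ∈ Icc t₀ m ∧ (∀ x ∈ Icc t m, u x ≤ u t + N * (x - t)) ∧
    |φ t - φ t₀| ≤ (1 + ε) * (arctan t - arctan t₀)}
  have hT0 : t₀ ∈ T := ⟨⟨le_rfl, ht₀.2⟩, hN, by simp⟩
  have hbdd : BddAbove T := ⟨m, fun t ht => ht.1.2⟩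
  set a := sSup T with ha
  have ham : a ∈ Icc t₀ m := ⟨le_csSup hbdd hT0, csSup_le ⟨_, hT0⟩ fun t ht => ht.1.2⟩
  have ha0 : a ∈ Icc 0 m := ⟨ht₀.1.trans ham.1, ham.2⟩
  have hfreq : ∃ᶠ t in nhdsWithin a (Icc 0 m), t ∈ T := by
    have h1 : a ∈ closure T := csSup_mem_closure ⟨_, hT0⟩ hbdd
    have h2 := mem_closure_iff_frequently.1 h1
    rw [frequently_nhdsWithin_iff]
    exact h2.mono fun t ht => ⟨ht, ht₀.1.trans ht.1.1, ht.1.2⟩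
  have haT : a ∈ T := by
    refine ⟨ham, fun x hx => ?_, ?_⟩
    · by_contra! hlt
      have husc : UpperSemicontinuousOn (fun t => u t + N * (x - t)) (Icc 0 m) :=
        D.usc.add ((Continuous.upperSemicontinuous (by fun_prop)).upperSemicontinuousOn _)
      obtain ⟨t, htT, ht⟩ := (hfreq.and_eventually (husc a ha0 _ hlt)).exists
      exact absurd (htT.2.1 x ⟨(le_csSup hbdd htT).trans hx.1, hx.2⟩) (not_le.2 ht)
    · by_contra! hlt
      have hcont : ContinuousWithinAt (fun t => |φ t - φ t₀| - (1 + ε) * (arctan t - arctan t₀))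
          (Icc 0 m) a :=
        ((D.cont a ha0).sub continuousWithinAt_const).abs.sub
          (continuousWithinAt_const.mul
            (continuous_arctan.continuousWithinAt.sub continuousWithinAt_const))
      obtain ⟨t, htT, ht⟩ := (hfreq.and_eventually
        (hcont.eventually (eventually_gt_nhds (sub_pos.2 hlt)))).exists
      linarith [htT.2.2]
  rcases ham.2.eq_or_lt with h | h
  · rw [← h]
    exact haT.2.2
  · obtain ⟨t', ht', h1, h2⟩ := D.exists_jump ⟨ha0.1, h⟩ hε hε1 haT.2.1
    refine absurd (le_csSup hbdd (show t' ∈ T from ⟨⟨ham.1.trans ht'.1.le, ht'.2⟩, h1, ?_⟩))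
      (not_le.2 ht'.1)
    have h3 := _root_.abs_sub_le (φ t') (φ a) (φ t₀)
    have h4 := haT.2.2
    linarith

/-- The fan lemma: the angle between the extreme segments of the second fan is at most the one of
the first fan. -/
theorem abs_sub_le_arctan (D : FanData w w' m c C u φ) : |φ m - φ 0| ≤ arctan m := by
  have hC : 0 ≤ C := (D.c_pos.le.trans (D.le_u 0 ⟨le_rfl, D.m_pos.le⟩)).trans
    (D.u_le 0 ⟨le_rfl, D.m_pos.le⟩)
  have key : ∀ k : ℕ, ∃ t ∈ Icc 0 m, t ≤ C * (1 / ((k:ℝ) + 1)) ∧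
      |φ m - φ t| ≤ (1 + 1 / ((k:ℝ) + 1)) * (arctan m) := by
    intro k
    have hk : (0:ℝ) < (k:ℝ) + 1 := by positivity
    obtain ⟨t, ht, hmax⟩ : ∃ t ∈ Icc 0 m, ∀ x ∈ Icc 0 m,
        u x + -((k:ℝ) + 1) * x ≤ u t + -((k:ℝ) + 1) * t := by
      have husc : UpperSemicontinuousOn (fun x => u x + -((k:ℝ) + 1) * x) (Icc 0 m) :=
        D.usc.add ((Continuous.upperSemicontinuous (by fun_prop)).upperSemicontinuousOn _)
      exact husc.exists_isMaxOn (nonempty_Icc.2 D.m_pos.le) isCompact_Icc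
    refine ⟨t, ht, ?_, ?_⟩
    · have h1 := hmax 0 ⟨le_rfl, D.m_pos.le⟩
      have h2 := D.u_le t ht
      have h3 := D.le_u 0 ⟨le_rfl, D.m_pos.le⟩
      have h4 := D.c_pos
      rw [mul_one_div, le_div_iff₀ hk]
      linarith
    · have h1 := D.abs_sub_le_of_slope (N := (k:ℝ) + 1) (ε := 1 / ((k:ℝ) + 1)) ht
        (by positivity) (by rw [div_le_one hk]; linarith [(Nat.cast_nonneg k : (0:ℝ) ≤ k)])
        (fun x hx => by linarith [hmax x ⟨ht.1.trans hx.1, hx.2⟩])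
      refine h1.trans ?_
      have := arctan_nonneg.2 ht.1
      gcongr
      linarith
  choose t ht ht0 hφ using key
  have hlim : Tendsto (fun k : ℕ => 1 / ((k:ℝ) + 1)) atTop (nhds 0) :=
    tendsto_one_div_add_atTop_nhds_zero_nat
  have htlim : Tendsto t atTop (nhdsWithin 0 (Icc 0 m)) := by
    refine tendsto_nhdsWithin_iff.2 ⟨?_, Eventually.of_forall ht⟩
    refine tendsto_of_tendsto_of_tendsto_of_le_of_le tendsto_const_nhds
      (by simpa using hlim.const_mul C) (fun k => (ht k).1) ht0
  have h1 : Tendsto (fun k => |φ m - φ (t k)|) atTop (nhds |φ m - φ 0|) :=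
    (((D.cont 0 ⟨le_rfl, D.m_pos.le⟩).tendsto.comp htlim).const_sub _).abs
  have h2 : Tendsto (fun k : ℕ => (1 + 1 / ((k:ℝ) + 1)) * arctan m) atTop (nhds (arctan m)) := by
    simpa using (hlim.const_add 1).mul_const (arctan m)
  exact le_of_tendsto_of_tendsto' h1 h2 hφ

end FanData

end FanLemma

section Dir

open Real

/-- The unit vector at angle `θ`. -/
def dir (θ : ℝ) : Euc 2 := !₂[cos θ, sin θ]

theorem inner_dir (θ φ : ℝ) : inner ℝ (dir θ) (dir φ) = cos (θ - φ) := by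
  simp only [dir, PiLp.inner_apply, Fin.sum_univ_two, cos_sub]
  simp
  ring

theorem norm_dir (θ : ℝ) : ‖dir θ‖ = 1 := by
  rw [norm_eq_sqrt_real_inner, inner_dir]
  simp

theorem dir_add (θ x : ℝ) : dir (θ + x) = cos x • dir θ + sin x • dir (θ + π / 2) := by
  ext i
  fin_cases i
  · simp [dir, cos_add]
    ring
  · simp [dir, sin_add, cos_add]
    ring

theorem continuous_dir : Continuous dir := by
  unfold dir
  fun_prop

theorem exists_eq_dir {v : Euc 2} (hv : ‖v‖ = 1) : ∃ ω, v = dir ω := by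
  have h : v 0 ^ 2 + v 1 ^ 2 = 1 := by
    have := EuclideanSpace.real_norm_sq_eq v
    rw [hv, Fin.sum_univ_two] at this
    linarith
  obtain ⟨ω, h1, h2⟩ : ∃ ω, v 0 = cos ω ∧ v 1 = sin ω := by
    refine ⟨Complex.arg ⟨v 0, v 1⟩, ?_, ?_⟩
    · have hn : ‖(⟨v 0, v 1⟩ : ℂ)‖ = 1 := by
        rw [Complex.norm_eq_sqrt_sq_add_sq, h, sqrt_one]
      rw [Complex.cos_arg (by rw [← norm_ne_zero_iff, hn]; exact one_ne_zero), hn]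
      simp
    · have hn : ‖(⟨v 0, v 1⟩ : ℂ)‖ = 1 := by
        rw [Complex.norm_eq_sqrt_sq_add_sq, h, sqrt_one]
      rw [Complex.sin_arg, hn]
      simp
  refine ⟨ω, ?_⟩
  ext i
  fin_cases i
  · simpa [dir] using h1
  · simpa [dir] using h2

theorem exists_eq_dir_of_inner_pos {v : Euc 2} {ω : ℝ} (hv : ‖v‖ = 1)
    (hpos : 0 < inner ℝ v (dir ω)) : ∃ ψ, v = dir ψ ∧ |ψ - ω| ≤ π / 2 := by
  obtain ⟨φ, rfl⟩ := exists_eq_dir hv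
  rw [inner_dir] at hpos
  refine ⟨ω + arcsin (sin (φ - ω)), ?_, ?_⟩
  · have h1 : cos (arcsin (sin (φ - ω))) = cos (φ - ω) := by
      rw [cos_arcsin, ← cos_sq', sqrt_sq hpos.le]
    have h2 : sin (arcsin (sin (φ - ω))) = sin (φ - ω) :=
      sin_arcsin (neg_one_le_sin _) (sin_le_one _)
    rw [dir_add, h1, h2, ← dir_add]
    congr 1
    ring
  · rw [add_sub_cancel_left, abs_le]
    exact ⟨neg_pi_div_two_le_arcsin _, arcsin_le_pi_div_two _⟩

theorem eq_of_dir_eq {θ φ : ℝ} (h : dir θ = dir φ) (hd : |θ - φ| ≤ π) : θ = φ := by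
  have h1 : cos (θ - φ) = 1 := by
    rw [← inner_dir, h, inner_dir, sub_self, cos_zero]
  have hπ := pi_pos
  obtain ⟨h2, h3⟩ := abs_le.1 hd
  have := (cos_eq_one_iff_of_lt_of_lt (by linarith) (by linarith)).1 h1
  linarith

theorem fanPt_dir (θ t u : ℝ) :
    fanPt (dir θ) (dir (θ + π / 2)) t u = (√(1 + t ^ 2) / u) • dir (θ + arctan t) := by
  have h : 0 < √(1 + t ^ 2) := by positivity
  rw [fanPt, dir_add θ (arctan t), cos_arctan, sin_arctan, smul_add, smul_add, smul_smul,
    smul_smul, smul_smul]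
  congr 2 <;> field_simp

theorem exists_eq_fanPt {n : ℕ} {w w' z : Euc n} {t t' u s : ℝ} (hu : 0 < u) (htt : t < t')
    (hl : 0 < u + s * (t' - t))
    (hz : z ∈ segment ℝ (fanPt w w' t u) (fanPt w w' t' (u + s * (t' - t)))) :
    ∃ x ∈ Icc t t', 0 < u + s * (x - t) ∧ z = fanPt w w' x (u + s * (x - t)) := by
  obtain ⟨a, b, ha, hb, hab, rfl⟩ := hz
  obtain ⟨l, hl'⟩ : ∃ l, l = u + s * (t' - t) := ⟨_, rfl⟩
  rw [← hl'] at hl ⊢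
  have hs : s = (l - u) / (t' - t) := by
    rw [hl']; field_simp [(sub_pos.2 htt).ne']; ring
  have hX : 0 < a / u + b / l := by
    rcases ha.eq_or_lt with h0 | h0
    · have : b = 1 := by linarith
      rw [← h0, this]; positivity
    · positivity
  set X := a / u + b / l with hXdef
  have hxX : u + s * ((a * t / u + b * t' / l) / X - t) = X⁻¹ := by
    have h1 : t' - t ≠ 0 := (sub_pos.2 htt).ne'
    have h2 : X ≠ 0 := hX.ne'
    have h3 : u * X = 1 + b * (u - l) / l := by
      rw [hXdef, eq_sub_of_add_eq hab]
      field_simp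
      ring
    have h4 : a * t / u + b * t' / l - t * X = b * (t' - t) / l := by
      rw [hXdef]
      ring
    have h5 : s * (b * (t' - t) / l) = b * (l - u) / l := by
      rw [hs]
      field_simp
    refine eq_inv_of_mul_eq_one_left ?_
    calc _ = u * X + s * ((a * t / u + b * t' / l) / X * X - t * X) := by ring
      _ = 1 := by
        rw [div_mul_cancel₀ _ h2, h4, h5, h3]
        ring
  refine ⟨(a * t / u + b * t' / l) / X, ⟨?_, ?_⟩, ?_, ?_⟩
  · rw [le_div_iff₀ hX, hXdef]
    have : b * t / l ≤ b * t' / l := by gcongr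
    calc t * (a / u + b / l) = a * t / u + b * t / l := by ring
      _ ≤ _ := by linarith
  · rw [div_le_iff₀ hX, hXdef]
    have : a * t / u ≤ a * t' / u := by gcongr
    calc _ ≤ a * t' / u + b * t' / l := by linarith
      _ = _ := by ring
  · rw [hxX]; positivity
  · rw [hxX, fanPt, fanPt, fanPt, inv_inv]
    have h1 : X • (w + ((a * t / u + b * t' / l) / X) • w') =
        X • w + (a * t / u + b * t' / l) • w' := by
      rw [smul_add, smul_smul, mul_div_cancel₀ _ hX.ne']
    rw [h1, hXdef]
    module

end Dir

/-- A family of chords from `a`, one in each direction `dir θ` with `θ ∈ I`. -/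
structure Fan {U : Set (Euc 2)} (a : ISeq U) (b : ℝ → ISeq U) (E : ℝ → ℝ) (I : Set ℝ)
    (m M : ℝ) : Prop where
  chord : ∀ θ ∈ I, IsChord a (b θ)
  supp_eq : ∀ θ ∈ I, (b θ).supp = a.supp + E θ • dir θ
  m_pos : 0 < m
  le_E : ∀ θ ∈ I, m ≤ E θ
  E_le : ∀ θ ∈ I, E θ ≤ M

namespace Fan

open Real ISeq

variable {U V : Set (Euc 2)} {a : ISeq U} {b : ℝ → ISeq U} {E : ℝ → ℝ} {I : Set ℝ} {m M : ℝ}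

theorem mono (h : Fan a b E I m M) {I' : Set ℝ} (hI : I' ⊆ I) : Fan a b E I' m M :=
  ⟨fun θ hθ => h.chord θ (hI hθ), fun θ hθ => h.supp_eq θ (hI hθ), h.m_pos,
    fun θ hθ => h.le_E θ (hI hθ), fun θ hθ => h.E_le θ (hI hθ)⟩

theorem E_pos (h : Fan a b E I m M) {θ : ℝ} (hθ : θ ∈ I) : 0 < E θ := h.m_pos.trans_le (h.le_E θ hθ)

theorem dist_supp (h : Fan a b E I m M) {θ : ℝ} (hθ : θ ∈ I) :
    dist a.supp (b θ).supp = E θ := by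
  rw [h.supp_eq θ hθ, dist_self_add_right, norm_smul, norm_dir, mul_one,
    Real.norm_of_nonneg (h.E_pos hθ).le]

theorem mem_openSegment (h : Fan a b E I m M) {θ x : ℝ} (hθ : θ ∈ I) (hx : 0 < x)
    (hxE : x < E θ) : a.supp + x • dir θ ∈ openSegment ℝ a.supp (b θ).supp := by
  rw [openSegment_eq_image_lineMap]
  refine ⟨x / E θ, ⟨div_pos hx (h.E_pos hθ), (div_lt_one (h.E_pos hθ)).2 hxE⟩, ?_⟩
  rw [AffineMap.lineMap_apply_module', h.supp_eq θ hθ, add_sub_cancel_left, smul_smul,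
    div_mul_cancel₀ _ (h.E_pos hθ).ne', add_comm]

theorem mem (h : Fan a b E I m M) {θ x : ℝ} (hθ : θ ∈ I) (hx : 0 < x)
    (hxE : x < E θ) : a.supp + x • dir θ ∈ U :=
  (h.chord θ hθ).subset (h.mem_openSegment hθ hx hxE)

theorem edist_pt_le (h : Fan a b E I m M) {θ x : ℝ} (hθ : θ ∈ I) (hx : 0 < x)
    (hxE : x < E θ) :
    edist (b θ) (pt _ (h.mem hθ hx hxE)) ≤ ENNReal.ofReal (E θ - x) := by
  convert (h.chord θ hθ).right_le _ (h.mem_openSegment hθ hx hxE) using 2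
  rw [h.supp_eq θ hθ, dist_add_left, dist_eq_norm, ← sub_smul, norm_smul, norm_dir, mul_one,
    Real.norm_of_nonneg (sub_pos.2 hxE).le]

theorem supp_notMem (h : Fan a b E I m M) {θ : ℝ} (hθ : θ ∈ I) : a.supp + E θ • dir θ ∉ U := by
  rw [← h.supp_eq θ hθ]
  exact (h.chord θ hθ).right_notMem

theorem eventually_lt (h : Fan a b E I m M) (hU : IsOpen U) {θ κ : ℝ} (hθ : θ ∈ I)
    (hκ : κ < E θ) : ∀ᶠ φ in nhdsWithin θ I, κ < E φ := by
  let f : ℝ × ℝ → Euc 2 := fun p => a.supp + p.2 • dir p.1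
  have hf : Continuous f := by
    have := continuous_dir
    fun_prop
  have hsub : ({θ} : Set ℝ) ×ˢ Icc (m / 2) κ ⊆ f ⁻¹' U := by
    rintro ⟨φ, x⟩ ⟨hφ, hx⟩
    rw [mem_singleton_iff] at hφ
    dsimp only at hφ hx
    subst hφ
    exact h.mem hθ ((half_pos h.m_pos).trans_le hx.1) (hx.2.trans_lt hκ)
  obtain ⟨A, B, hA, -, hθA, hB, hAB⟩ := generalized_tube_lemma isCompact_singleton
    (isCompact_Icc (a := m / 2) (b := κ)) (hU.preimage hf) hsub
  filter_upwards [mem_nhdsWithin_of_mem_nhds (hA.mem_nhds (hθA rfl)), self_mem_nhdsWithin]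
    with φ hφ hφI
  by_contra! hle
  have h1 := h.le_E φ hφI
  exact h.supp_notMem hφI (hAB (show (φ, E φ) ∈ A ×ˢ B from
    ⟨hφ, hB ⟨by linarith [h.m_pos], hle⟩⟩))

/-- Two-segment paths below the ends of the fan bound the intrinsic distances of the ends. -/
theorem edist_le (h : Fan a b E I m M) {θ θ' κ : ℝ} (hθ : θ ∈ I) (hθ' : θ' ∈ I) (hκ : 0 < κ)
    (hκE : κ ≤ E θ')
    (hseg : ∀ z ∈ segment ℝ (E θ • dir θ) (κ • dir θ'), ∃ φ ∈ I, ∃ x, 0 < x ∧ x ≤ E φ ∧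
      z = x • dir φ) :
    edist (b θ) (b θ') ≤ ENNReal.ofReal (dist (E θ • dir θ) (κ • dir θ') +
      dist (κ • dir θ') (E θ' • dir θ')) := by
  have key : ∀ c ∈ Ioo (0:ℝ) 1, edist (b θ) (b θ') ≤ ENNReal.ofReal
      ((E θ - c * E θ) + c * dist (E θ • dir θ) (κ • dir θ') + (E θ' - c * κ)) := by
    intro c hc
    have hE := h.E_pos hθ
    have hlt : ∀ x, 0 < x → c * x < x := fun x hx => by nlinarith [hc.2]
    have m1 := h.edist_pt_le hθ (mul_pos hc.1 hE) (hlt _ hE)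
    have m2 := h.edist_pt_le hθ' (mul_pos hc.1 hκ) ((hlt _ hκ).trans_le hκE)
    have hsub : segment ℝ (a.supp + (c * E θ) • dir θ) (a.supp + (c * κ) • dir θ') ⊆ U := by
      rintro _ ⟨p, q, hp, hq, hpq, rfl⟩
      obtain ⟨φ, hφ, x, hx, hxE, hz⟩ := hseg _ ⟨p, q, hp, hq, hpq, rfl⟩
      have := h.mem hφ (mul_pos hc.1 hx) ((hlt _ hx).trans_le hxE)
      rw [mul_smul, ← hz] at this
      convert this using 1
      rw [smul_add, smul_add, add_add_add_comm, ← add_smul, hpq]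
      module
    have m3 := edist_pt_le_dist hsub (hsub (left_mem_segment ℝ _ _))
      (hsub (right_mem_segment ℝ _ _))
    have e : dist (a.supp + (c * E θ) • dir θ) (a.supp + (c * κ) • dir θ') =
        c * dist (E θ • dir θ) (κ • dir θ') := by
      rw [dist_add_left, mul_smul, mul_smul, dist_smul₀, Real.norm_of_nonneg hc.1.le]
    rw [e] at m3
    rw [edist_comm] at m2
    refine edist_trans_le (add_nonneg (sub_nonneg.2 (hlt _ hE).le) (mul_nonneg hc.1.le dist_nonneg))
      (sub_nonneg.2 ((hlt _ hκ).le.trans hκE))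
      (edist_trans_le (sub_nonneg.2 (hlt _ hE).le) (mul_nonneg hc.1.le dist_nonneg) m1 m3) m2
  have hlim : Tendsto (fun c : ℝ => ENNReal.ofReal
      ((E θ - c * E θ) + c * dist (E θ • dir θ) (κ • dir θ') + (E θ' - c * κ)))
      (nhdsWithin 1 (Iio 1)) (nhds (ENNReal.ofReal (dist (E θ • dir θ) (κ • dir θ') +
      dist (κ • dir θ') (E θ' • dir θ')))) := by
    have h1 : dist (κ • dir θ') (E θ' • dir θ') = E θ' - κ := by
      rw [dist_comm, dist_eq_norm, ← sub_smul, norm_smul, norm_dir, mul_one,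
        Real.norm_of_nonneg (sub_nonneg.2 hκE)]
    have h2 : Continuous (fun c : ℝ =>
        ((E θ - c * E θ) + c * dist (E θ • dir θ) (κ • dir θ') + (E θ' - c * κ))) := by
      fun_prop
    have h3 := (ENNReal.continuous_ofReal.comp h2).tendsto 1
    simp only [Function.comp_def, one_mul, sub_self, zero_add] at h3
    rw [h1]
    exact h3.mono_left nhdsWithin_le_nhds
  refine ge_of_tendsto hlim ?_
  filter_upwards [Ioo_mem_nhdsLT (zero_lt_one (α := ℝ))] with c hc
  exact key c hc

theorem abs_sub_le {θ₁ θ₂ : ℝ} (h : Fan a b E (Icc θ₁ θ₂) m M) (hU : IsOpen U) {φ : ℝ → ℝ}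
    (hlt : θ₁ < θ₂) (hle : θ₂ - θ₁ ≤ π / 4) (hφ : ContinuousOn φ (Icc θ₁ θ₂))
    (hφπ : ∀ θ ∈ Icc θ₁ θ₂, ∀ θ' ∈ Icc θ₁ θ₂, |φ θ' - φ θ| ≤ π)
    (hD : ∀ θ ∈ Icc θ₁ θ₂, ∀ θ' ∈ Icc θ₁ θ₂, ∀ D, 0 ≤ D →
      edist (b θ) (b θ') ≤ ENNReal.ofReal D →
      E θ ^ 2 + E θ' ^ 2 - 2 * E θ * E θ' * cos (φ θ' - φ θ) ≤ D ^ 2) :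
    |φ θ₂ - φ θ₁| ≤ θ₂ - θ₁ := by
  have hπ := pi_pos
  set k := tan (θ₂ - θ₁) with hk
  have hark : arctan k = θ₂ - θ₁ := arctan_tan (by linarith) (by linarith)
  have hk0 : 0 < k := tan_pos_of_pos_of_lt_pi_div_two (by linarith) (by linarith)
  have hk1 : k ≤ 1 := by
    rw [← arctan_strictMono.le_iff_le, hark, arctan_one]
    exact hle
  set ϑ : ℝ → ℝ := fun t => θ₁ + arctan t with hϑ
  have hϑm : ∀ t ∈ Icc 0 k, ϑ t ∈ Icc θ₁ θ₂ := fun t ht => by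
    have h1 := arctan_nonneg.2 ht.1
    have h2 := arctan_strictMono.monotone ht.2
    rw [hark] at h2
    exact ⟨by simp only [hϑ]; linarith, by simp only [hϑ]; linarith⟩
  have hϑc : Continuous ϑ := continuous_const.add continuous_arctan
  set u : ℝ → ℝ := fun t => √(1 + t ^ 2) / E (ϑ t) with hu
  have hM : 0 < M := (h.E_pos (left_mem_Icc.2 hlt.le)).trans_le (h.E_le _ (left_mem_Icc.2 hlt.le))
  have hsq : ∀ t : ℝ, 0 < √(1 + t ^ 2) := fun t => by positivity
  have hE : ∀ t ∈ Icc 0 k, 0 < E (ϑ t) := fun t ht => h.E_pos (hϑm t ht)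
  have hpt : ∀ t ∈ Icc 0 k, fanPt (dir θ₁) (dir (θ₁ + π / 2)) t (u t) =
      E (ϑ t) • dir (ϑ t) := fun t ht => by
    rw [fanPt_dir, hu]
    have := hsq t
    have := hE t ht
    dsimp only
    congr 1
    field_simp
  have hnorm : ∀ t ∈ Icc 0 k, ‖E (ϑ t) • dir (ϑ t)‖ = E (ϑ t) := fun t ht => by
    rw [norm_smul, norm_dir, mul_one, Real.norm_of_nonneg (hE t ht).le]
  have hupos : ∀ t ∈ Icc 0 k, 0 < u t := fun t ht => div_pos (hsq t) (hE t ht)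
  have D : FanData (dir θ₁) (dir (θ₁ + π / 2)) k (1 / M) (2 / m) u (φ ∘ ϑ) := by
    refine ⟨norm_dir _, norm_dir _, ?_, hk0, hk1, by positivity, fun t ht => ?_, fun t ht => ?_,
      fun t ht y hy => ?_, ?_, fun t ht t' ht' => hφπ _ (hϑm t ht) _ (hϑm t' ht'), ?_⟩
    · rw [inner_dir]
      simp
    · have h1 := h.E_le _ (hϑm t ht)
      have h2 := hE t ht
      have h3 : 1 ≤ √(1 + t ^ 2) := by rw [one_le_sqrt]; nlinarith [sq_nonneg t]
      simp only [hu]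
      gcongr
    · have h1 := h.le_E _ (hϑm t ht)
      have h2 := h.m_pos
      have h3 : √(1 + t ^ 2) ≤ 2 := by
        rw [sqrt_le_left (by norm_num)]
        nlinarith [ht.1, ht.2]
      simp only [hu]
      gcongr
    · have hy0 : 0 < y := (hupos t ht).trans hy
      simp only [hu] at hy
      rw [div_lt_iff₀ (hE t ht), mul_comm, ← div_lt_iff₀ hy0] at hy
      obtain ⟨κ, hκ1, hκ2⟩ := exists_between hy
      have hlim : Tendsto ϑ (nhdsWithin t (Icc 0 k)) (nhdsWithin (ϑ t) (Icc θ₁ θ₂)) :=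
        hϑc.continuousWithinAt.tendsto_nhdsWithin hϑm
      have ev1 := hlim.eventually (h.eventually_lt hU (hϑm t ht) hκ2)
      have hc : Continuous fun x : ℝ => √(1 + x ^ 2) / y := by fun_prop
      have ev2 := (hc.continuousWithinAt (s := Icc 0 k) (x := t)).eventually
        (eventually_lt_nhds hκ1)
      filter_upwards [ev1, ev2, self_mem_nhdsWithin] with x h1 h2 h3
      simp only [hu]
      rw [div_lt_iff₀ (hE x h3), mul_comm, ← div_lt_iff₀ hy0]
      exact h2.trans h1
    · exact hφ.comp hϑc.continuousOn hϑm
    · intro t ht t' ht' htt s hs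
      have hl1 := hs t' ⟨htt.le, le_rfl⟩
      have hl0 := (hupos t' ht').trans_le hl1
      have hut' := hupos t' ht'
      have hseg := fun z (hz : z ∈ segment ℝ (fanPt (dir θ₁) (dir (θ₁ + π / 2)) t (u t)) _) =>
        exists_eq_fanPt (hupos t ht) htt hl0 hz
      rw [hpt t ht, hpt t' ht', hnorm t ht, hnorm t' ht']
      rw [hpt t ht] at hseg
      have hq := fanPt_dir θ₁ t' (u t + s * (t' - t))
      change _ = _ • dir (ϑ t') at hq
      have hcoef : ∀ x ∈ Icc 0 k, ∀ y, u x ≤ y → 0 < y → √(1 + x ^ 2) / y ≤ E (ϑ x) := by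
        intro x hx y hxy hy
        rw [div_le_iff₀ hy, mul_comm, ← div_le_iff₀ (hE x hx)]
        exact hxy
      rw [hq] at hseg ⊢
      refine hD _ (hϑm t ht) _ (hϑm t' ht') _ (by positivity) ?_
      refine h.edist_le (hϑm t ht) (hϑm t' ht') (div_pos (hsq _) hl0)
        (hcoef t' ht' _ hl1 hl0) ?_
      intro z hz
      obtain ⟨x, hx, hx0, rfl⟩ := hseg z hz
      have hxk : x ∈ Icc 0 k := ⟨ht.1.trans hx.1, hx.2.trans ht'.2⟩
      exact ⟨ϑ x, hϑm x hxk, _, div_pos (hsq x) hx0, hcoef x hxk _ (hs x hx) hx0,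
        fanPt_dir _ _ _⟩
  have := D.abs_sub_le_arctan
  rw [hark] at this
  simpa [hϑ, hark] using this

end Fan

theorem mul_norm_sub_sq {n : ℕ} {x y : Euc n} {c d : ℝ} (hc : 0 < c) (hd : 0 < d) (hx : ‖x‖ = c)
    (hy : ‖y‖ = d) : c * d * ‖c⁻¹ • x - d⁻¹ • y‖ ^ 2 = ‖x - y‖ ^ 2 - (d - c) ^ 2 := by
  rw [norm_sub_sq_real, norm_sub_sq_real, norm_smul, norm_smul, inner_smul_left, inner_smul_right,
    hx, hy, norm_inv, norm_inv, Real.norm_of_nonneg hc.le, Real.norm_of_nonneg hd.le]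
  simp only [conj_trivial]
  field_simp
  ring

/-- Two chords with the same origin and the same direction have the same end. -/
theorem IsChord.edist_right_eq_zero {n : ℕ} {U : Set (Euc n)} {a b c : ISeq U} {w : Euc n}
    {x y : ℝ} (hb : IsChord a b) (hc : IsChord a c) (hx : 0 < x) (hy : 0 < y)
    (hbw : b.supp = a.supp + x • w) (hcw : c.supp = a.supp + y • w) : edist b c = 0 := by
  have hw : ∀ s z : ℝ, AffineMap.lineMap a.supp (a.supp + z • w) s = a.supp + (s * z) • w := by
    intro s z
    rw [AffineMap.lineMap_apply_module', add_sub_cancel_left, smul_smul, add_comm]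
  have key : ∀ {b c : ISeq U} {x y : ℝ}, IsChord a b → IsChord a c → 0 < x → 0 < y →
      b.supp = a.supp + x • w → c.supp = a.supp + y • w → y ≤ x := by
    intro b c x y hb hc hx hy hbw hcw
    by_contra! hlt
    refine hb.right_notMem (hc.subset ?_)
    rw [openSegment_eq_image_lineMap, hcw]
    refine ⟨x / y, ⟨by positivity, (div_lt_one hy).2 hlt⟩, ?_⟩
    rw [hw, div_mul_cancel₀ _ hy.ne', hbw]
  have hxy : x = y := le_antisymm (key hc hb hy hx hcw hbw) (key hb hc hx hy hbw hcw)
  have hbc : b.supp = c.supp := by rw [hbw, hcw, hxy]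
  rw [← nonpos_iff_eq_zero]
  have hle : ∀ s ∈ Ioo (0:ℝ) 1, edist b c ≤
      ENNReal.ofReal (2 * ((1 - s) * dist a.supp b.supp)) := by
    intro s hs
    obtain ⟨z, hz, hd⟩ : ∃ z ∈ openSegment ℝ a.supp b.supp,
        dist b.supp z = (1 - s) * dist a.supp b.supp := by
      refine ⟨AffineMap.lineMap a.supp b.supp s, ?_, ?_⟩
      · rw [openSegment_eq_image_lineMap]
        exact ⟨s, hs, rfl⟩
      · rw [dist_right_lineMap, Real.norm_of_nonneg (sub_nonneg.2 hs.2.le)]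
    have h1 := hb.right_le z hz
    have hz' : z ∈ openSegment ℝ a.supp c.supp := hbc ▸ hz
    have h2 := hc.right_le z hz'
    rw [edist_comm, ← hbc, hd] at h2
    rw [hd] at h1
    have h0 : 0 ≤ (1 - s) * dist a.supp b.supp := hd ▸ dist_nonneg
    rw [two_mul]
    exact ISeq.edist_trans_le h0 h0 h1 h2
  have hlim : Tendsto (fun s : ℝ => ENNReal.ofReal (2 * ((1 - s) * dist a.supp b.supp)))
      (nhdsWithin 1 (Iio 1)) (nhds 0) := by
    have h2 : Continuous fun s : ℝ => ENNReal.ofReal (2 * ((1 - s) * dist a.supp b.supp)) :=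
      ENNReal.continuous_ofReal.comp (by fun_prop)
    have h3 := h2.tendsto 1
    simp only [sub_self, zero_mul, mul_zero, ENNReal.ofReal_zero] at h3
    exact h3.mono_left nhdsWithin_le_nhds
  refine ge_of_tendsto hlim ?_
  filter_upwards [Ioo_mem_nhdsLT (zero_lt_one (α := ℝ))] with s hs
  exact hle s hs

namespace Fan

open Real ISeq

variable {U V : Set (Euc 2)} {a : ISeq U} {b : ℝ → ISeq U} {E : ℝ → ℝ} {I : Set ℝ} {m M : ℝ}

theorem eventually_edist_le (h : Fan a b E I m M) (hU : IsOpen U) {θ ε : ℝ} (hθ : θ ∈ I)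
    (hε : 0 < ε) : ∀ᶠ φ in nhdsWithin θ I, 0 ≤ E φ - E θ + ε ∧
      edist (b θ) (b φ) ≤ ENNReal.ofReal (E φ - E θ + ε) := by
  have hE := h.E_pos hθ
  obtain ⟨η, hη0, hηE, hηε⟩ : ∃ η > 0, η < E θ ∧ 3 * η ≤ ε :=
    ⟨min (E θ / 2) (ε / 3), by positivity,
      (min_le_left _ _).trans_lt (by linarith), by linarith [min_le_right (E θ / 2) (ε / 3)]⟩
  have hκ : 0 < E θ - η := sub_pos.2 hηE
  have hκE : E θ - η < E θ := by linarith
  have hp := h.mem hθ hκ hκE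
  obtain ⟨r, hr, hball⟩ := Metric.isOpen_iff.1 hU _ hp
  have hc : Continuous fun φ => a.supp + (E θ - η) • dir φ := by
    have := continuous_dir
    fun_prop
  have hev : ∀ ρ > 0, ∀ᶠ φ in nhdsWithin θ I,
      a.supp + (E θ - η) • dir φ ∈ ball (a.supp + (E θ - η) • dir θ) ρ := fun ρ hρ =>
    hc.continuousWithinAt (ball_mem_nhds _ hρ)
  filter_upwards [h.eventually_lt hU hθ hκE, hev r hr, hev η hη0, self_mem_nhdsWithin]
    with φ h1 h2 h3 hφ
  have e1 := h.edist_pt_le hθ hκ hκE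
  have e2 := edist_pt_le_of_ball hball (mem_ball_self hr) h2
  have e3 := h.edist_pt_le hφ hκ h1
  rw [edist_comm] at e3
  refine ⟨by linarith, (edist_trans_le ?_ ?_ (edist_trans_le ?_ ?_ e1 e2) e3).trans
    (ENNReal.ofReal_le_ofReal ?_)⟩
  · exact add_nonneg (by linarith) dist_nonneg
  · linarith
  · linarith
  · exact dist_nonneg
  · rw [mem_ball'] at h3
    linarith

theorem continuousOn_direction (h : Fan a b E I m M) (hU : IsOpen U) {S : ℝ → Euc 2} {o : Euc 2}
    (hS : ∀ θ ∈ I, dist o (S θ) = E θ)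
    (hL : ∀ θ ∈ I, ∀ φ ∈ I, edist (S θ) (S φ) ≤ edist (b θ) (b φ)) :
    ContinuousOn (fun θ => (E θ)⁻¹ • (S θ - o)) I := by
  intro θ hθ
  have hm := h.m_pos
  have hM : 0 < M := (h.E_pos hθ).trans_le (h.E_le θ hθ)
  have hbound : ∀ ε > 0, ∀ᶠ φ in nhdsWithin θ I,
      ‖(E θ)⁻¹ • (S θ - o) - (E φ)⁻¹ • (S φ - o)‖ ^ 2 ≤ (ε * (2 * M + ε)) / m ^ 2 := by
    intro ε hε
    filter_upwards [h.eventually_edist_le hU hθ hε, self_mem_nhdsWithin] with φ ⟨h0, h1⟩ hφ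
    have h2 := (hL θ hθ φ hφ).trans h1
    rw [edist_dist, ENNReal.ofReal_le_ofReal_iff h0, dist_eq_norm] at h2
    have hn : ∀ φ ∈ I, ‖S φ - o‖ = E φ := fun φ hφ => by rw [← dist_eq_norm, dist_comm, hS φ hφ]
    have key := mul_norm_sub_sq (h.E_pos hθ) (h.E_pos hφ) (hn θ hθ) (hn φ hφ)
    rw [sub_sub_sub_cancel_right] at key
    have h3 : ‖S θ - S φ‖ ^ 2 ≤ (E φ - E θ + ε) ^ 2 := by gcongr
    have h4 := h.le_E θ hθ
    have h5 := h.le_E φ hφ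
    have h6 := h.E_le φ hφ
    rw [le_div_iff₀ (by positivity)]
    set N := ‖(E θ)⁻¹ • (S θ - o) - (E φ)⁻¹ • (S φ - o)‖ ^ 2 with hN
    have h7 : m * m * N ≤ E θ * E φ * N := by
      have : 0 ≤ N := by positivity
      have := h.E_pos hθ
      gcongr
    nlinarith
  rw [ContinuousWithinAt, tendsto_iff_norm_sub_tendsto_zero]
  rw [Metric.tendsto_nhds]
  intro ε hε
  have hlim : Tendsto (fun x : ℝ => (x * (2 * M + x)) / m ^ 2) (nhdsWithin 0 (Ioi 0)) (nhds 0) := by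
    have h2 : Continuous fun x : ℝ => (x * (2 * M + x)) / m ^ 2 := by fun_prop
    have h3 := h2.tendsto 0
    simp only [zero_mul, zero_div] at h3
    exact h3.mono_left nhdsWithin_le_nhds
  obtain ⟨x, hx, hx0⟩ := ((hlim.eventually (eventually_lt_nhds (sq_pos_of_pos hε))).and
    self_mem_nhdsWithin).exists
  filter_upwards [hbound x hx0] with φ hφ
  rw [Real.dist_0_eq_abs, abs_norm, norm_sub_rev]
  exact lt_of_pow_lt_pow_left₀ 2 hε.le (hφ.trans_lt hx)

/-- A map that does not increase intrinsic distances and preserves the lengths of the chords of a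
fan does not increase the angles between the chords. -/
theorem abs_angle_sub_le {θ₁ θ₂ : ℝ} (h : Fan a b E (Icc θ₁ θ₂) m M) (hU : IsOpen U)
    (hle : θ₂ - θ₁ ≤ π / 4) {S : ℝ → Euc 2} {o : Euc 2} {ψ : ℝ → ℝ} {ω : ℝ}
    (hS : ∀ θ ∈ Icc θ₁ θ₂, S θ = o + E θ • dir (ψ θ))
    (hψ : ∀ θ ∈ Icc θ₁ θ₂, |ψ θ - ω| ≤ π / 2)
    (hL : ∀ θ ∈ Icc θ₁ θ₂, ∀ φ ∈ Icc θ₁ θ₂, edist (S θ) (S φ) ≤ edist (b θ) (b φ))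
    {θ φ : ℝ} (hθ : θ ∈ Icc θ₁ θ₂) (hφ : φ ∈ Icc θ₁ θ₂) : |ψ θ - ψ φ| ≤ |θ - φ| := by
  have hcont : ContinuousOn ψ (Icc θ₁ θ₂) := by
    have h1 : ContinuousOn (fun θ => dir (ψ θ)) (Icc θ₁ θ₂) := by
      refine (h.continuousOn_direction hU (S := S) (o := o) (fun θ hθ => ?_) hL).congr
        fun θ hθ => ?_
      · rw [hS θ hθ, dist_self_add_right, norm_smul, norm_dir, mul_one,
          Real.norm_of_nonneg (h.E_pos hθ).le]
      · dsimp only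
        rw [hS θ hθ, add_sub_cancel_left, smul_smul, inv_mul_cancel₀ (h.E_pos hθ).ne', one_smul]
    have h2 : ContinuousOn (fun θ => ω + arcsin (inner ℝ (dir (ψ θ)) (dir (ω + π / 2))))
        (Icc θ₁ θ₂) :=
      continuousOn_const.add (continuous_arcsin.comp_continuousOn (h1.inner continuousOn_const))
    refine h2.congr fun θ hθ => ?_
    obtain ⟨h3, h4⟩ := abs_le.1 (hψ θ hθ)
    dsimp only
    rw [inner_dir, ← sub_sub, cos_sub_pi_div_two, arcsin_sin h3 h4, add_sub_cancel]
  wlog hlt : φ < θ generalizing θ φ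
  · rcases (not_lt.1 hlt).eq_or_lt with h0 | h0
    · simp [h0]
    · rw [abs_sub_comm, abs_sub_comm θ]
      exact this hφ hθ h0
  have hsub : Icc φ θ ⊆ Icc θ₁ θ₂ := Icc_subset_Icc hφ.1 hθ.2
  rw [abs_of_pos (sub_pos.2 hlt)]
  refine (h.mono hsub).abs_sub_le hU hlt (by linarith [hφ.1, hθ.2]) (hcont.mono hsub) ?_ ?_
  · intro x hx y hy
    have h1 := _root_.abs_sub_le (ψ y) ω (ψ x)
    have h2 := hψ x (hsub hx)
    have h3 := hψ y (hsub hy)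
    rw [abs_sub_comm] at h2
    linarith
  · intro x hx y hy D hD hxy
    have h1 := (hL x (hsub hx) y (hsub hy)).trans hxy
    rw [edist_dist, ENNReal.ofReal_le_ofReal_iff hD, hS x (hsub hx), hS y (hsub hy),
      dist_add_left, dist_eq_norm] at h1
    have h2 : ‖E x • dir (ψ x) - E y • dir (ψ y)‖ ^ 2 ≤ D ^ 2 := by gcongr
    refine le_of_eq_of_le ?_ h2
    rw [norm_sub_sq_real, norm_smul, norm_smul, norm_dir, norm_dir, inner_smul_left,
      inner_smul_right, inner_dir, ← cos_neg (ψ x - ψ y), neg_sub]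
    simp only [conj_trivial, Real.norm_eq_abs, mul_one, sq_abs]
    ring

end Fan

section Rotation

open Real

theorem eq_inner_smul_dir (x : Euc 2) (θ : ℝ) :
    x = inner ℝ x (dir θ) • dir θ + inner ℝ x (dir (θ + π / 2)) • dir (θ + π / 2) := by
  have h := sin_sq_add_cos_sq θ
  ext i
  fin_cases i
  · simp [dir, PiLp.inner_apply, Fin.sum_univ_two, cos_add, sin_add]
    linear_combination (-x 0) * h
  · simp [dir, PiLp.inner_apply, Fin.sum_univ_two, cos_add, sin_add]
    linear_combination (-x 1) * h

theorem exists_linearIsometry_dir (c σ : ℝ) (hσ : σ = 1 ∨ σ = -1) :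
    ∃ L : Euc 2 →ₗᵢ[ℝ] Euc 2, ∀ θ, L (dir θ) = dir (c + σ * θ) := by
  have hσ2 : σ ^ 2 = 1 := by rcases hσ with rfl | rfl <;> norm_num
  refine ⟨⟨{ toFun := fun x => x 0 • dir c + (σ * x 1) • dir (c + π / 2)
             map_add' := fun x y => ?_
             map_smul' := fun r x => ?_ }, fun x => ?_⟩, fun θ => ?_⟩
  · simp only [PiLp.add_apply]
    module
  · simp only [PiLp.smul_apply, smul_eq_mul, RingHom.id_apply]
    module
  · rw [← sq_eq_sq₀ (norm_nonneg _) (norm_nonneg _), EuclideanSpace.real_norm_sq_eq x,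
      Fin.sum_univ_two]
    change ‖x 0 • dir c + (σ * x 1) • dir (c + π / 2)‖ ^ 2 = _
    rw [norm_add_sq_real, norm_smul, norm_smul, norm_dir, norm_dir, inner_smul_left,
      inner_smul_right, inner_dir]
    simp only [sub_add_cancel_left, cos_neg, cos_pi_div_two, mul_zero, mul_one, Real.norm_eq_abs,
      sq_abs]
    linear_combination x 1 ^ 2 * hσ2
  · change cos θ • dir c + (σ * sin θ) • dir (c + π / 2) = _
    rw [dir_add c (σ * θ)]
    rcases hσ with rfl | rfl <;> simp

theorem LinearMap.eq_of_dir {f g : Euc 2 →ₗ[ℝ] Euc 2} {θ t : ℝ} (ht : sin t ≠ 0)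
    (h0 : f (dir θ) = g (dir θ)) (h1 : f (dir (θ + t)) = g (dir (θ + t))) : f = g := by
  rw [dir_add, map_add, map_add, map_smul, map_smul, map_smul, map_smul, h0] at h1
  have h2 := smul_right_injective _ ht (add_left_cancel h1)
  ext1 x
  rw [eq_inner_smul_dir x θ]
  simp only [map_add, map_smul, h0]
  rw [show f (dir (θ + π / 2)) = g (dir (θ + π / 2)) from h2]

theorem exists_eq_add_mul {ψ : ℝ → ℝ} {l u : ℝ} (hlu : l < u)
    (h : ∀ θ ∈ Icc l u, ∀ φ ∈ Icc l u, |ψ θ - ψ φ| = |θ - φ|) :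
    ∃ c σ, (σ = 1 ∨ σ = -1) ∧ ∀ θ ∈ Icc l u, ψ θ = c + σ * θ := by
  have hl := left_mem_Icc.2 hlu.le
  have hu := right_mem_Icc.2 hlu.le
  have h0 := h u hu l hl
  rw [abs_of_pos (sub_pos.2 hlu)] at h0
  have h1 : ∀ θ ∈ Icc l u, |ψ θ - ψ l| = θ - l ∧ |ψ u - ψ θ| = u - θ := fun θ hθ => by
    rw [h θ hθ l hl, h u hu θ hθ, abs_of_nonneg (sub_nonneg.2 hθ.1),
      abs_of_nonneg (sub_nonneg.2 hθ.2)]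
    exact ⟨rfl, rfl⟩
  rcases abs_choice (ψ u - ψ l) with h2 | h2
  · refine ⟨ψ l - l, 1, Or.inl rfl, fun θ hθ => ?_⟩
    obtain ⟨h3, h4⟩ := h1 θ hθ
    have := le_abs_self (ψ θ - ψ l)
    have := le_abs_self (ψ u - ψ θ)
    linarith
  · refine ⟨ψ l + l, -1, Or.inr rfl, fun θ hθ => ?_⟩
    obtain ⟨h3, h4⟩ := h1 θ hθ
    have := neg_le_abs (ψ θ - ψ l)
    have := neg_le_abs (ψ u - ψ θ)
    linarith

end Rotation

namespace Fan

open Real ISeq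

variable {U V : Set (Euc 2)} {a : ISeq U} {b : ℝ → ISeq U} {E : ℝ → ℝ} {I : Set ℝ} {m M : ℝ}

theorem exists_linearIsometry {θ₀ δ : ℝ} (h : Fan a b E (Icc (θ₀ - δ) (θ₀ + δ)) m M) (hδ : 0 < δ)
    (hU : IsOpen U) (hV : IsOpen V) (F : BIso U V) :
    ∃ L : Euc 2 →ₗᵢ[ℝ] Euc 2, ∀ᶠ θ in nhds θ₀,
      (F.toFun (b θ)).supp = (F.toFun a).supp + E θ • L (dir θ) := by
  have hπ := pi_pos
  set S : ℝ → Euc 2 := fun θ => (F.toFun (b θ)).supp with hSdef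
  set o := (F.toFun a).supp with ho
  set I := Icc (θ₀ - δ) (θ₀ + δ) with hI
  have hchord : ∀ θ ∈ I, IsChord (F.toFun a) (F.toFun (b θ)) := fun θ hθ =>
    ((h.chord θ hθ).map hU hV F).1
  have hdist : ∀ θ ∈ I, dist o (S θ) = E θ := fun θ hθ => by
    rw [← h.dist_supp hθ]
    exact ((h.chord θ hθ).map hU hV F).2
  have hF : ∀ θ ∈ I, ∀ φ ∈ I, edist (F.toFun (b θ)) (F.toFun (b φ)) = edist (b θ) (b φ) :=
    fun θ hθ φ hφ => F.edist_eq _ _ (h.chord θ hθ).right_notMem (h.chord φ hφ).right_notMem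
  have hL : ∀ θ ∈ I, ∀ φ ∈ I, edist (S θ) (S φ) ≤ edist (b θ) (b φ) := fun θ hθ φ hφ => by
    rw [← hF θ hθ φ hφ]
    exact edist_supp_le _ _
  set v : ℝ → Euc 2 := fun θ => (E θ)⁻¹ • (S θ - o) with hv
  have hvc : ContinuousOn v I := h.continuousOn_direction hU hdist hL
  have hvS : ∀ θ ∈ I, S θ = o + E θ • v θ := fun θ hθ => by
    simp only [hv]
    rw [smul_inv_smul₀ (h.E_pos hθ).ne', add_sub_cancel]
  have hvn : ∀ θ ∈ I, ‖v θ‖ = 1 := fun θ hθ => by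
    simp only [hv]
    rw [norm_smul, norm_inv, Real.norm_of_nonneg (h.E_pos hθ).le, ← dist_eq_norm, dist_comm,
      hdist θ hθ, inv_mul_cancel₀ (h.E_pos hθ).ne']
  have hθ₀ : θ₀ ∈ I := ⟨by linarith, by linarith⟩
  have hIn : I ∈ nhds θ₀ := Icc_mem_nhds (by linarith) (by linarith)
  obtain ⟨ω, hω⟩ := exists_eq_dir (hvn θ₀ hθ₀)
  have hpos : ∀ᶠ θ in nhds θ₀, 0 < inner ℝ (v θ) (dir ω) := by
    have h1 : ContinuousAt (fun θ => inner ℝ (v θ) (dir ω)) θ₀ :=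
      ((hvc θ₀ hθ₀).continuousAt hIn).inner continuousAt_const
    refine h1.eventually (eventually_gt_nhds ?_)
    dsimp only
    rw [hω, inner_dir, sub_self, cos_zero]
    exact one_pos
  obtain ⟨ε, hε, hball⟩ := Metric.eventually_nhds_iff.1 hpos
  obtain ⟨δ', hδ', hδ1, hδ2, hδ3⟩ : ∃ δ' > 0, δ' ≤ δ ∧ δ' < ε ∧ δ' ≤ π / 8 :=
    ⟨min δ (min (ε / 2) (π / 8)), by positivity, min_le_left _ _,
      ((min_le_right _ _).trans (min_le_left _ _)).trans_lt (by linarith),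
      (min_le_right _ _).trans (min_le_right _ _)⟩
  have hsub : Icc (θ₀ - δ') (θ₀ + δ') ⊆ I := Icc_subset_Icc (by linarith) (by linarith)
  have hex : ∀ θ ∈ Icc (θ₀ - δ') (θ₀ + δ'), ∃ ψ, v θ = dir ψ ∧ |ψ - ω| ≤ π / 2 := fun θ hθ => by
    refine exists_eq_dir_of_inner_pos (hvn θ (hsub hθ)) (hball ?_)
    rw [Real.dist_eq, abs_lt]
    exact ⟨by linarith [hθ.1], by linarith [hθ.2]⟩
  choose! ψ hψ hψω using hex
  have h' := h.mono hsub
  have hS' : ∀ θ ∈ Icc (θ₀ - δ') (θ₀ + δ'), S θ = o + E θ • dir (ψ θ) := fun θ hθ => by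
    rw [hvS θ (hsub hθ), hψ θ hθ]
  have hle : ∀ θ ∈ Icc (θ₀ - δ') (θ₀ + δ'), ∀ φ ∈ Icc (θ₀ - δ') (θ₀ + δ'),
      |ψ θ - ψ φ| ≤ |θ - φ| := fun θ hθ φ hφ =>
    h'.abs_angle_sub_le hU (by linarith) hS' hψω
      (fun θ hθ φ hφ => hL θ (hsub hθ) φ (hsub hφ)) hθ hφ
  have hψc : ContinuousOn ψ (Icc (θ₀ - δ') (θ₀ + δ')) := by
    refine LipschitzOnWith.continuousOn (K := 1) (LipschitzOnWith.of_dist_le_mul ?_)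
    intro θ hθ φ hφ
    rw [NNReal.coe_one, one_mul]
    exact hle θ hθ φ hφ
  have hge : ∀ θ ∈ Icc (θ₀ - δ') (θ₀ + δ'), ∀ φ ∈ Icc (θ₀ - δ') (θ₀ + δ'),
      |θ - φ| ≤ |ψ θ - ψ φ| := by
    intro θ hθ φ hφ
    by_cases heq : ψ θ = ψ φ
    · have h0 : edist (b θ) (b φ) = 0 := by
        rw [← hF θ (hsub hθ) φ (hsub hφ)]
        refine (hchord θ (hsub hθ)).edist_right_eq_zero (hchord φ (hsub hφ)) (h'.E_pos hθ)
          (h'.E_pos hφ) (hS' θ hθ) ?_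
        rw [heq]
        exact hS' φ hφ
      have h1 := supp_eq_of_edist_eq_zero h0
      have h2 : E θ = E φ := by rw [← h'.dist_supp hθ, ← h'.dist_supp hφ, h1]
      rw [h'.supp_eq θ hθ, h'.supp_eq φ hφ, h2] at h1
      have h3 := smul_right_injective _ (h'.E_pos hφ).ne' (add_left_cancel h1)
      rw [eq_of_dir_eq h3 ?_]
      · simp
      · rw [abs_le]
        constructor <;> linarith [hθ.1, hθ.2, hφ.1, hφ.2]
    · have huI : uIcc θ φ ⊆ Icc (θ₀ - δ') (θ₀ + δ') := uIcc_subset_Icc hθ hφ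
      have hivt := intermediate_value_uIcc (hψc.mono huI)
      have hex : ∀ x ∈ uIcc (ψ θ) (ψ φ), ∃ y ∈ Icc (θ₀ - δ') (θ₀ + δ'), ψ y = x ∧
          (x = ψ θ → y = θ) ∧ (x = ψ φ → y = φ) := by
        intro x hx
        by_cases h1 : x = ψ θ
        · exact ⟨θ, hθ, h1.symm, fun _ => rfl, fun h2 => absurd (h1.symm.trans h2) heq⟩
        by_cases h2 : x = ψ φ
        · exact ⟨φ, hφ, h2.symm, fun h3 => absurd h3 h1, fun _ => rfl⟩
        obtain ⟨y, hy, hyx⟩ := hivt hx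
        exact ⟨y, huI hy, hyx, fun h3 => absurd h3 h1, fun h3 => absurd h3 h2⟩
      choose! χ hχ hψχ hχθ hχφ using hex
      have hfan : Fan (F.toFun a) (fun x => F.toFun (b (χ x))) (fun x => E (χ x))
          (Icc (ψ θ ⊓ ψ φ) (ψ θ ⊔ ψ φ)) m M := by
        refine ⟨fun x hx => hchord _ (hsub (hχ x hx)), fun x hx => ?_, h.m_pos,
          fun x hx => h'.le_E _ (hχ x hx), fun x hx => h'.E_le _ (hχ x hx)⟩
        have := hS' _ (hχ x hx)
        rw [hψχ x hx] at this
        exact this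
      have hlen : ψ θ ⊔ ψ φ - ψ θ ⊓ ψ φ ≤ π / 4 := by
        rw [max_sub_min_eq_abs, abs_sub_comm]
        refine (hle θ hθ φ hφ).trans ?_
        rw [abs_le]
        constructor <;> linarith [hθ.1, hθ.2, hφ.1, hφ.2]
      have := hfan.abs_angle_sub_le hV hlen (S := fun x => (b (χ x)).supp) (o := a.supp)
        (ψ := χ) (ω := θ₀) (fun x hx => h'.supp_eq _ (hχ x hx)) (fun x hx => ?_)
        (fun x hx y hy => ?_) (left_mem_uIcc (a := ψ θ) (b := ψ φ)) right_mem_uIcc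
      · rwa [hχθ _ left_mem_uIcc rfl, hχφ _ right_mem_uIcc rfl] at this
      · have := hχ x hx
        rw [abs_le]
        constructor <;> linarith [this.1, this.2]
      · rw [hF _ (hsub (hχ x hx)) _ (hsub (hχ y hy))]
        exact edist_supp_le _ _
  obtain ⟨c, σ, hσ, hlin⟩ := exists_eq_add_mul (by linarith : θ₀ - δ' < θ₀ + δ')
    fun θ hθ φ hφ => le_antisymm (hle θ hθ φ hφ) (hge θ hθ φ hφ)
  obtain ⟨L, hLdir⟩ := exists_linearIsometry_dir c σ hσ
  refine ⟨L, ?_⟩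
  filter_upwards [Icc_mem_nhds (by linarith : θ₀ - δ' < θ₀) (by linarith : θ₀ < θ₀ + δ')]
    with θ hθ
  rw [hLdir, ← hlin θ hθ]
  exact hS' θ hθ

/-- The image of a fan is congruent to the fan. -/
theorem exists_linearIsometry_of_forall {I : Set ℝ} (hI : IsPreconnected I) (hIo : IsOpen I)
    (hE : ∀ θ ∈ I, 0 < E θ) {S : ℝ → Euc 2} {o : Euc 2}
    (h : ∀ θ₀ ∈ I, ∃ L : Euc 2 →ₗᵢ[ℝ] Euc 2, ∀ᶠ θ in nhds θ₀, S θ = o + E θ • L (dir θ)) :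
    ∃ L : Euc 2 →ₗᵢ[ℝ] Euc 2, ∀ θ ∈ I, S θ = o + E θ • L (dir θ) := by
  choose! L hL using h
  have hloc : IsLocallyConstant fun θ : I => L θ := by
    refine (IsLocallyConstant.iff_eventually_eq _).2 fun θ₀ => ?_
    have h1 := (hL θ₀ θ₀.2).and (hIo.mem_nhds θ₀.2)
    have h2 := continuous_subtype_val.continuousAt.eventually h1.eventually_nhds
    filter_upwards [h2] with θ hθ
    have h3 : ∀ᶠ φ in nhds (θ : ℝ), L θ (dir φ) = L θ₀ (dir φ) := by
      filter_upwards [hθ, hL θ θ.2] with φ h4 h5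
      have h6 := h5.symm.trans h4.1
      exact smul_right_injective _ (hE φ h4.2).ne' (add_left_cancel h6)
    obtain ⟨ε, hε, hball⟩ := Metric.eventually_nhds_iff.1 h3
    have hπ := pi_pos
    set t := min (ε / 2) 1 with ht
    have ht0 : 0 < t := by positivity
    have htε : t < ε := (min_le_left _ _).trans_lt (by linarith)
    have hs : sin t ≠ 0 := (sin_pos_of_pos_of_lt_pi ht0
      ((min_le_right _ _).trans_lt (by linarith [two_le_pi]))).ne'
    have := LinearMap.eq_of_dir (f := (L θ).toLinearMap) (g := (L θ₀).toLinearMap) hs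
      h3.self_of_nhds
      (hball (by rwa [Real.dist_eq, add_sub_cancel_left, abs_of_pos ht0]))
    exact LinearIsometry.toLinearMap_injective this
  rcases I.eq_empty_or_nonempty with rfl | ⟨θ₁, hθ₁⟩
  · exact ⟨LinearIsometry.id, fun θ hθ => hθ.elim⟩
  have := isPreconnected_iff_preconnectedSpace.1 hI
  refine ⟨L θ₁, fun θ hθ => ?_⟩
  rw [← hloc.apply_eq_of_preconnectedSpace ⟨θ, hθ⟩ ⟨θ₁, hθ₁⟩]
  exact (hL θ hθ).self_of_nhds

end Fan

/-- A boundary element touched by the ball of radius `r` around `p`. -/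
structure IsContact {n : ℕ} {U : Set (Euc n)} (a : ISeq U) (p : Euc n) (r : ℝ) : Prop where
  pos : 0 < r
  ball_subset : ball p r ⊆ U
  dist_eq : dist a.supp p = r
  notMem : a.supp ∉ U
  le : ∀ z (hz : z ∈ ball p r),
    edist a (ISeq.pt z (ball_subset hz)) ≤ ENNReal.ofReal (dist a.supp z)

namespace IsContact

open ISeq

section

variable {n : ℕ} {U : Set (Euc n)} {a c : ISeq U} {p q : Euc n} {r s : ℝ}

theorem exists_of_dist {α : Euc n} (hr : 0 < r) (hb : ball p r ⊆ U) (hα : dist α p = r)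
    (hαU : α ∉ U) : ∃ a : ISeq U, a.supp = α ∧ IsContact a p r := by
  have hcl : α ∈ closure (ball p r) := by
    rw [closure_ball p hr.ne']
    exact hα.le
  obtain ⟨a, ha, hle⟩ := exists_of_mem_closure (convex_ball p r) hb hcl
  exact ⟨a, ha, hr, hb, by rwa [ha], by rwa [ha], fun z hz => ha ▸ hle z hz⟩

theorem add_smul_mem_ball (h : IsContact a p r) {v : Euc n} {t : ℝ} (hv : ‖v‖ = 1) (ht : 0 < t)
    (htv : t < 2 * inner ℝ v (p - a.supp)) : a.supp + t • v ∈ ball p r := by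
  rw [mem_ball, dist_eq_norm, ← sq_lt_sq₀ (norm_nonneg _) h.pos.le]
  have h1 : a.supp + t • v - p = t • v - (p - a.supp) := by abel
  have h2 : ‖p - a.supp‖ = r := by rw [← dist_eq_norm, dist_comm, h.dist_eq]
  rw [h1, norm_sub_sq_real, norm_smul, hv, h2, inner_smul_left, mul_one, Real.norm_eq_abs, sq_abs]
  simp only [conj_trivial]
  nlinarith

theorem left_le (h : IsContact a p r) {γ : Euc n} (hseg : openSegment ℝ a.supp γ ⊆ U)
    (hin : 0 < inner ℝ (γ - a.supp) (p - a.supp)) (z : Euc n)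
    (hz : z ∈ openSegment ℝ a.supp γ) :
    edist a (pt z (hseg hz)) ≤ ENNReal.ofReal (dist a.supp z) := by
  have hne : γ - a.supp ≠ 0 := fun h0 => by simp [h0] at hin
  set l := ‖γ - a.supp‖ with hl
  have hl0 : 0 < l := norm_pos_iff.2 hne
  set v := l⁻¹ • (γ - a.supp) with hv
  have hv1 : ‖v‖ = 1 := by
    rw [hv, norm_smul, norm_inv, Real.norm_of_nonneg hl0.le, inv_mul_cancel₀ hl0.ne']
  have hvin : 0 < inner ℝ v (p - a.supp) := by
    rw [hv, inner_smul_left]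
    simp only [conj_trivial]
    positivity
  obtain ⟨x, hx, rfl⟩ : ∃ x ∈ Ioo (0:ℝ) 1, AffineMap.lineMap a.supp γ x = z := by
    rwa [openSegment_eq_image_lineMap] at hz
  have hline : ∀ y, AffineMap.lineMap a.supp γ y = a.supp + (y * l) • v := by
    intro y
    rw [AffineMap.lineMap_apply_module', hv, smul_smul, mul_assoc, mul_inv_cancel₀ hl0.ne',
      mul_one, add_comm]
  obtain ⟨y, hy0, hyx, hyin⟩ : ∃ y, 0 < y ∧ y ≤ x ∧ y * l < 2 * inner ℝ v (p - a.supp) := by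
    refine ⟨min x (inner ℝ v (p - a.supp) / l), lt_min hx.1 (by positivity), min_le_left _ _, ?_⟩
    have : min x (inner ℝ v (p - a.supp) / l) * l ≤ inner ℝ v (p - a.supp) / l * l := by
      gcongr
      exact min_le_right _ _
    rw [div_mul_cancel₀ _ hl0.ne'] at this
    linarith
  have hyb := h.add_smul_mem_ball hv1 (mul_pos hy0 hl0) hyin
  rw [← hline] at hyb
  have h1 := h.le _ hyb
  have hs : segment ℝ (AffineMap.lineMap a.supp γ y) (AffineMap.lineMap a.supp γ x) ⊆ U := by
    refine ((convex_openSegment _ _).segment_subset ?_ hz).trans hseg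
    rw [openSegment_eq_image_lineMap]
    exact ⟨y, ⟨hy0, hyx.trans_lt hx.2⟩, rfl⟩
  have h2 := edist_pt_le_dist hs (h.ball_subset hyb) (hseg hz)
  refine (edist_trans_le dist_nonneg dist_nonneg h1 h2).trans (ENNReal.ofReal_le_ofReal ?_)
  rw [dist_left_lineMap, dist_left_lineMap, dist_lineMap_lineMap, Real.norm_of_nonneg hy0.le,
    Real.norm_of_nonneg hx.1.le, dist_comm y x, Real.dist_eq, abs_of_nonneg (sub_nonneg.2 hyx)]
  exact le_of_eq (by ring)

theorem isChord (h : IsContact a p r) (hc : IsContact c q s)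
    (hseg : openSegment ℝ a.supp c.supp ⊆ U)
    (h1 : 0 < inner ℝ (c.supp - a.supp) (p - a.supp))
    (h2 : 0 < inner ℝ (a.supp - c.supp) (q - c.supp)) : IsChord a c where
  left_notMem := h.notMem
  right_notMem := hc.notMem
  ne := fun h0 => by simp [h0] at h1
  subset := hseg
  left_le := h.left_le hseg h1
  right_le z hz := hc.left_le (by rwa [openSegment_symm]) h2 z (by rwa [openSegment_symm])

/-- There is a chord in every direction pointing into the ball. -/
theorem exists_isChord (h : IsContact a p r) (hU : IsOpen U) (hbd : Bornology.IsBounded U)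
    {v : Euc n} (hv : ‖v‖ = 1) (hin : 0 < inner ℝ v (p - a.supp)) :
    ∃ b x, IsChord a b ∧ 2 * inner ℝ v (p - a.supp) ≤ x ∧ b.supp = a.supp + x • v := by
  set κ := inner ℝ v (p - a.supp) with hκ
  obtain ⟨R, hR⟩ := hbd.subset_ball a.supp
  have hfar : ∀ t, R ≤ t → a.supp + t • v ∉ U := fun t ht hmem => by
    have := hR hmem
    rw [mem_ball, dist_self_add_left, norm_smul, hv, mul_one, Real.norm_eq_abs] at this
    linarith [le_abs_self t]
  have hy : a.supp + κ • v ∈ U := h.ball_subset (h.add_smul_mem_ball hv hin (by linarith))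
  have hκR : κ < R := by
    by_contra! hle
    exact hfar _ hle hy
  obtain ⟨T, hT, hTU, hTs⟩ := exists_first_exit hU hy (hfar R le_rfl)
  have hline : ∀ t, AffineMap.lineMap (a.supp + κ • v) (a.supp + R • v) t =
      a.supp + (κ + t * (R - κ)) • v := by
    intro t
    rw [AffineMap.lineMap_apply_module']
    module
  set x := κ + T * (R - κ) with hx
  rw [hline] at hTU
  have hRκ := sub_pos.2 hκR
  have hxκ : κ < x := by
    rw [hx]
    linarith [mul_pos hT.1 hRκ]
  have hx0 : 0 < x := hin.trans hxκ
  have hmem : ∀ t, 0 < t → t < x → a.supp + t • v ∈ U := by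
    intro t ht0 htx
    rcases lt_or_ge t κ with h1 | h1
    · exact h.ball_subset (h.add_smul_mem_ball hv ht0 (by linarith))
    · have h2 := hTs ((t - κ) / (R - κ)) ⟨div_nonneg (sub_nonneg.2 h1) hRκ.le, by
        rw [div_lt_iff₀ hRκ]
        linarith⟩
      rwa [hline, div_mul_cancel₀ _ hRκ.ne', add_sub_cancel] at h2
  have hseg : openSegment ℝ a.supp (a.supp + x • v) ⊆ U := by
    rw [openSegment_eq_image_lineMap]
    rintro _ ⟨t, ht, rfl⟩
    rw [AffineMap.lineMap_apply_module', add_sub_cancel_left, smul_smul, add_comm]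
    exact hmem _ (mul_pos ht.1 hx0) (by nlinarith [ht.2])
  have hcl : a.supp + x • v ∈ closure (openSegment ℝ a.supp (a.supp + x • v)) :=
    segment_subset_closure_openSegment (right_mem_segment ℝ _ _)
  obtain ⟨γ, hγ⟩ : ∃ γ, γ = a.supp + x • v := ⟨_, rfl⟩
  rw [← hγ] at hseg hcl hTU
  obtain ⟨b, rfl, hbz⟩ := exists_of_mem_closure (convex_openSegment _ _) hseg hcl
  have hinx : 0 < inner ℝ (b.supp - a.supp) (p - a.supp) := by
    rw [hγ, add_sub_cancel_left, inner_smul_left]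
    exact mul_pos hx0 hin
  refine ⟨b, x, ⟨h.notMem, hTU, fun h0 => by simp [h0] at hinx, hseg,
    h.left_le hseg hinx, fun z hz => hbz z hz⟩, ?_, hγ⟩
  by_contra! hlt
  rw [hγ] at hTU
  exact hTU (h.ball_subset (h.add_smul_mem_ball hv hx0 hlt))

end

open Real

variable {U V : Set (Euc 2)} {a c : ISeq U} {p q : Euc 2} {r s : ℝ}

/-- The chords of a contact point form a fan locally. -/
theorem exists_fan (h : IsContact a p r) (hU : IsOpen U) (hbd : Bornology.IsBounded U) :
    ∃ b E, ∀ θ₀, 0 < inner ℝ (dir θ₀) (p - a.supp) → ∃ δ > 0, ∃ m M,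
      Fan a b E (Icc (θ₀ - δ) (θ₀ + δ)) m M ∧
        ∀ θ ∈ Icc (θ₀ - δ) (θ₀ + δ), 0 < inner ℝ (dir θ) (p - a.supp) := by
  have hex : ∀ θ, ∃ b x, 0 < inner ℝ (dir θ) (p - a.supp) → IsChord a b ∧
      2 * inner ℝ (dir θ) (p - a.supp) ≤ x ∧ b.supp = a.supp + x • dir θ := by
    intro θ
    by_cases hθ : 0 < inner ℝ (dir θ) (p - a.supp)
    · obtain ⟨b, x, hb⟩ := h.exists_isChord hU hbd (norm_dir θ) hθ
      exact ⟨b, x, fun _ => hb⟩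
    · exact ⟨a, 0, fun h0 => absurd h0 hθ⟩
  choose b E hbE using hex
  refine ⟨b, E, fun θ₀ hθ₀ => ?_⟩
  set κ := inner ℝ (dir θ₀) (p - a.supp) with hκ
  have hc : ContinuousAt (fun θ => inner ℝ (dir θ) (p - a.supp)) θ₀ :=
    continuous_dir.continuousAt.inner continuousAt_const
  obtain ⟨ε, hε, hball⟩ := Metric.eventually_nhds_iff.1
    (hc.eventually (eventually_gt_nhds (half_lt_self hθ₀)))
  have hin : ∀ θ ∈ Icc (θ₀ - ε / 2) (θ₀ + ε / 2), κ / 2 < inner ℝ (dir θ) (p - a.supp) := by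
    intro θ hθ
    refine hball ?_
    rw [Real.dist_eq, abs_lt]
    constructor <;> linarith [hθ.1, hθ.2]
  have hin0 : ∀ θ ∈ Icc (θ₀ - ε / 2) (θ₀ + ε / 2), 0 < inner ℝ (dir θ) (p - a.supp) :=
    fun θ hθ => (half_pos hθ₀).trans (hin θ hθ)
  have hcl : ∀ s : ISeq U, s.supp ∈ closure U := fun s =>
    mem_closure_of_tendsto s.tendsto_supp (Eventually.of_forall s.mem)
  refine ⟨ε / 2, half_pos hε, κ, diam (closure U), ⟨fun θ hθ => (hbE θ (hin0 θ hθ)).1,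
    fun θ hθ => (hbE θ (hin0 θ hθ)).2.2, hθ₀, fun θ hθ => ?_, fun θ hθ => ?_⟩, hin0⟩
  · linarith [hin θ hθ, (hbE θ (hin0 θ hθ)).2.1]
  · refine le_of_eq_of_le ?_ (dist_le_diam_of_mem hbd.closure (hcl a) (hcl (b θ)))
    rw [(hbE θ (hin0 θ hθ)).2.2, dist_self_add_right, norm_smul, norm_dir, mul_one,
      Real.norm_of_nonneg]
    linarith [hin0 θ hθ, (hbE θ (hin0 θ hθ)).2.1]

theorem eventually_exists_isChord (h : IsContact a p r) (hU : IsOpen U)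
    (hbd : Bornology.IsBounded U) (hac : IsChord a c) {l κ θ₀ : ℝ} (hl : 0 < l) (hκ : κ < l)
    (hc : c.supp = a.supp + l • dir θ₀) (hin : 0 < inner ℝ (dir θ₀) (p - a.supp)) :
    ∀ᶠ θ in nhds θ₀, ∃ b x, κ < x ∧ IsChord a b ∧ b.supp = a.supp + x • dir θ ∧
      0 < inner ℝ (dir θ) (p - a.supp) := by
  obtain ⟨b, E, hbE⟩ := h.exists_fan hU hbd
  obtain ⟨δ, hδ, m, M, hfan, hpos⟩ := hbE θ₀ hin
  have hn : Icc (θ₀ - δ) (θ₀ + δ) ∈ nhds θ₀ := Icc_mem_nhds (by linarith) (by linarith)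
  have h0 := mem_of_mem_nhds hn
  have heq : E θ₀ = l := by
    have h1 := supp_eq_of_edist_eq_zero ((hfan.chord θ₀ h0).edist_right_eq_zero hac
      (hfan.E_pos h0) hl (hfan.supp_eq θ₀ h0) hc)
    rw [← hfan.dist_supp h0, h1, hc, dist_self_add_right, norm_smul, norm_dir, mul_one,
      Real.norm_of_nonneg hl.le]
  have h1 := hfan.eventually_lt hU h0 (hκ.trans_eq heq.symm)
  rw [nhdsWithin_eq_nhds.2 hn] at h1
  filter_upwards [h1, hn] with θ h2 h3
  exact ⟨b θ, E θ, h2, hfan.chord θ h3, hfan.supp_eq θ h3, hpos θ h3⟩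

end IsContact

/-- A motion that agrees with `F` on the chords from the contact point `a` into the ball around
`p`. -/
structure IsRigid {U V : Set (Euc 2)} (F : BIso U V) (a : ISeq U) (p : Euc 2)
    (J : Euc 2 ≃ᵃⁱ[ℝ] Euc 2) : Prop where
  apply_supp : J a.supp = (F.toFun a).supp
  apply_chord : ∀ b, IsChord a b → 0 < inner ℝ (b.supp - a.supp) (p - a.supp) →
    J b.supp = (F.toFun b).supp

open Real ISeq in
theorem IsContact.exists_isRigid {U V : Set (Euc 2)} {a : ISeq U} {p : Euc 2} {r : ℝ}
    (h : IsContact a p r) (hU : IsOpen U) (hbd : Bornology.IsBounded U) (hV : IsOpen V)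
    (F : BIso U V) : ∃ J, IsRigid F a p J := by
  obtain ⟨b, E, hbE⟩ := h.exists_fan hU hbd
  have hpn : ‖p - a.supp‖ = r := by rw [← dist_eq_norm, dist_comm, h.dist_eq]
  obtain ⟨ω, hω⟩ : ∃ ω, r⁻¹ • (p - a.supp) = dir ω := exists_eq_dir (by
    rw [norm_smul, norm_inv, Real.norm_of_nonneg h.pos.le, hpn, inv_mul_cancel₀ h.pos.ne'])
  have hpa : p - a.supp = r • dir ω := by rw [← hω, smul_inv_smul₀ h.pos.ne']
  have hpos : ∀ θ ∈ Ioo (ω - π / 2) (ω + π / 2), 0 < inner ℝ (dir θ) (p - a.supp) := by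
    intro θ hθ
    rw [hpa, inner_smul_right, inner_dir]
    exact mul_pos h.pos (cos_pos_of_mem_Ioo ⟨by linarith [hθ.1], by linarith [hθ.2]⟩)
  have hfan : ∀ θ ∈ Ioo (ω - π / 2) (ω + π / 2), IsChord a (b θ) ∧ 0 < E θ ∧
      (b θ).supp = a.supp + E θ • dir θ := by
    intro θ hθ
    obtain ⟨δ, hδ, m, M, hf, -⟩ := hbE θ (hpos θ hθ)
    have h0 : θ ∈ Icc (θ - δ) (θ + δ) := ⟨by linarith, by linarith⟩
    exact ⟨hf.chord θ h0, hf.E_pos h0, hf.supp_eq θ h0⟩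
  obtain ⟨L, hL⟩ := Fan.exists_linearIsometry_of_forall (S := fun θ => (F.toFun (b θ)).supp)
    (o := (F.toFun a).supp) isPreconnected_Ioo isOpen_Ioo (fun θ hθ => (hfan θ hθ).2.1)
    fun θ hθ => by
      obtain ⟨δ, hδ, m, M, hf, -⟩ := hbE θ (hpos θ hθ)
      exact hf.exists_linearIsometry hδ hU hV F
  refine ⟨AffineIsometryEquiv.mk' (fun z => (F.toFun a).supp + L (z - a.supp))
    (L.toLinearIsometryEquiv rfl) a.supp fun z => ?_, ?_, fun c hc hin => ?_⟩
  · simp [add_comm]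
  · simp
  · rw [AffineIsometryEquiv.coe_mk']
    set l := ‖c.supp - a.supp‖ with hl
    have hl0 : 0 < l := norm_pos_iff.2 fun h0 => by simp [h0] at hin
    have hca : c.supp - a.supp = l • l⁻¹ • (c.supp - a.supp) := by rw [smul_inv_smul₀ hl0.ne']
    obtain ⟨φ, hφ, hφω⟩ : ∃ φ, l⁻¹ • (c.supp - a.supp) = dir φ ∧ |φ - ω| ≤ π / 2 := by
      refine exists_eq_dir_of_inner_pos ?_ ?_
      · rw [norm_smul, norm_inv, Real.norm_of_nonneg hl0.le, inv_mul_cancel₀ hl0.ne']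
      · rw [← hω, inner_smul_left, inner_smul_right]
        have := h.pos
        simp only [conj_trivial]
        positivity
    rw [hφ] at hca
    have hcs : c.supp = a.supp + l • dir φ := by rw [← hca, add_sub_cancel]
    have hφI : φ ∈ Ioo (ω - π / 2) (ω + π / 2) := by
      have h1 : 0 < cos (φ - ω) := by
        rw [hca, hpa, inner_smul_left, inner_smul_right, inner_dir] at hin
        simp only [conj_trivial] at hin
        exact pos_of_mul_pos_right (pos_of_mul_pos_right hin hl0.le) h.pos.le
      obtain ⟨h2, h3⟩ := abs_le.1 hφω
      constructor
      · refine lt_of_le_of_ne (by linarith) fun h4 => h1.ne' ?_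
        rw [← h4, sub_sub_cancel_left, cos_neg, cos_pi_div_two]
      · refine lt_of_le_of_ne (by linarith) fun h4 => h1.ne' ?_
        rw [h4, add_sub_cancel_left, cos_pi_div_two]
    obtain ⟨h1, h2, h3⟩ := hfan φ hφI
    have h4 := h1.edist_right_eq_zero hc h2 hl0 h3 hcs
    have h5 := supp_eq_of_edist_eq_zero h4
    rw [← F.edist_eq _ _ h1.right_notMem hc.right_notMem] at h4
    rw [← supp_eq_of_edist_eq_zero h4, ← h5, h3, add_sub_cancel_left, map_smul]
    exact (hL φ hφI).symm

open Real in
theorem eq_or_eq_neg_of_inner_eq_zero {u v w : Euc 2} (hu : ‖u‖ = 1) (hv : ‖v‖ = 1) (hw : ‖w‖ = 1)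
    (huv : inner ℝ v u = 0) (huw : inner ℝ w u = 0) : w = v ∨ w = -v := by
  obtain ⟨ω, rfl⟩ := exists_eq_dir hu
  have key : ∀ x : Euc 2, ‖x‖ = 1 → inner ℝ x (dir ω) = 0 →
      x = dir (ω + π / 2) ∨ x = -dir (ω + π / 2) := by
    intro x hx h0
    have h1 := eq_inner_smul_dir x ω
    rw [h0, zero_smul, zero_add] at h1
    have h2 : |inner ℝ x (dir (ω + π / 2))| = 1 := by
      rw [← hx]
      conv_rhs => rw [h1]
      rw [norm_smul, norm_dir, mul_one, Real.norm_eq_abs]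
    rcases eq_or_eq_neg_of_abs_eq h2 with h3 | h3
    · left
      rwa [h3, one_smul] at h1
    · right
      rwa [h3, neg_one_smul] at h1
  rcases key v hv huv with rfl | rfl <;> rcases key w hw huw with rfl | rfl <;> simp

open Real in
theorem lt_dist_reflection {u k o : Euc 2} (hun : ‖u‖ = 1) (hkn : ‖k‖ = 1) (hku : inner ℝ k u = 0)
    {t x y h l : ℝ} (hc0 : 0 < cos t) (hc1 : cos t < 1) (hl0 : 0 < l)
    (hhc : h * cos t = l / 2) :
    x - h + (y - h) < dist (o + x • (cos t • u + sin t • k))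
      (o + l • u + y • (-cos t • u + sin t • -k)) := by
  set w := cos t • u + sin t • k with hw
  have hwn : ‖w‖ = 1 := by
    rw [← sq_eq_sq₀ (norm_nonneg _) zero_le_one, hw, norm_add_sq_real, norm_smul, norm_smul, hun,
      hkn, inner_smul_left, inner_smul_right, real_inner_comm, hku]
    simp only [mul_zero, mul_one, Real.norm_eq_abs, sq_abs, one_pow, add_zero]
    exact cos_sq_add_sin_sq t
  have hwu : inner ℝ u w = cos t := by
    rw [hw, inner_add_right, inner_smul_right, inner_smul_right, real_inner_self_eq_norm_sq, hun,
      real_inner_comm, hku]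
    simp
  have e3 : o + x • w - (o + l • u + y • (-cos t • u + sin t • -k)) = (x + y) • w - l • u := by
    rw [hw]
    module
  rw [dist_eq_norm, e3]
  have e4 := real_inner_le_norm ((x + y) • w - l • u) w
  rw [hwn, mul_one, inner_sub_left, inner_smul_left, inner_smul_left, hwu,
    real_inner_self_eq_norm_sq, hwn] at e4
  simp only [conj_trivial, one_pow, mul_one] at e4
  have e5 : l * cos t < l := mul_lt_of_lt_one_right hl0 hc1
  have e6 : h * cos t < h := mul_lt_of_lt_one_right
    (pos_of_mul_pos_left (by linarith) hc0.le) hc1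
  linarith

theorem AffineIsometryEquiv.apply_add {n : ℕ} (J : Euc n ≃ᵃⁱ[ℝ] Euc n) (x v : Euc n) :
    J (x + v) = J x + J.linearIsometryEquiv v := by
  have := J.map_vadd x v
  rw [vadd_eq_add, vadd_eq_add] at this
  rw [add_comm x, this, add_comm]

namespace IsContact

open Real ISeq

variable {U V : Set (Euc 2)} {a c : ISeq U} {p q : Euc 2} {r s : ℝ}

set_option maxHeartbeats 1000000 in
/-- The motions of two contact points joined by a chord that points into both balls coincide. -/
theorem isRigid_eq (ha : IsContact a p r) (hc : IsContact c q s) (hU : IsOpen U)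
    (hbd : Bornology.IsBounded U) {F : BIso U V} {J K : Euc 2 ≃ᵃⁱ[ℝ] Euc 2}
    (hseg : openSegment ℝ a.supp c.supp ⊆ U)
    (h1 : 0 < inner ℝ (c.supp - a.supp) (p - a.supp))
    (h2 : 0 < inner ℝ (a.supp - c.supp) (q - c.supp))
    (hJ : IsRigid F a p J) (hK : IsRigid F c q K) : J = K := by
  have hac := ha.isChord hc hseg h1 h2
  have hJc := hJ.apply_chord c hac h1
  have hKa := hK.apply_chord a hac.symm h2
  set l := ‖c.supp - a.supp‖ with hl
  have hl0 : 0 < l := norm_pos_iff.2 fun h0 => by simp [h0] at h1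
  obtain ⟨ω, hω⟩ : ∃ ω, l⁻¹ • (c.supp - a.supp) = dir ω := exists_eq_dir (by
    rw [norm_smul, norm_inv, Real.norm_of_nonneg hl0.le, inv_mul_cancel₀ hl0.ne'])
  have hca : c.supp - a.supp = l • dir ω := by rw [← hω, smul_inv_smul₀ hl0.ne']
  have hcs : c.supp = a.supp + l • dir ω := by rw [← hca, add_sub_cancel]
  have hdirπ : ∀ t, dir (ω + π - t) = -cos t • dir ω + sin t • dir (ω + π / 2) := by
    intro t
    rw [add_sub_assoc, dir_add ω (π - t), cos_pi_sub, sin_pi_sub]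
  have hπ0 : dir (ω + π) = -dir ω := by simpa using hdirπ 0
  have has : a.supp = c.supp + l • dir (ω + π) := by rw [hcs, hπ0]; module
  set u := J.linearIsometryEquiv (dir ω) with hu
  set k := J.linearIsometryEquiv (dir (ω + π / 2)) with hk
  have hJc' : J c.supp = J a.supp + l • u := by rw [hcs, J.apply_add, map_smul]
  have hKc' : K c.supp = K a.supp + l • K.linearIsometryEquiv (dir ω) := by
    rw [hcs, K.apply_add, map_smul]
  have hJKa : J a.supp = K a.supp := hJ.apply_supp.trans hKa.symm
  have hJKc : J c.supp = K c.supp := hJc.trans hK.apply_supp.symm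
  have hKu : K.linearIsometryEquiv (dir ω) = u := by
    rw [hJc', hKc', hJKa] at hJKc
    exact (smul_right_injective _ hl0.ne' (add_left_cancel hJKc)).symm
  have hperp : inner ℝ (dir (ω + π / 2)) (dir ω) = 0 := by
    rw [inner_dir, add_sub_cancel_left, cos_pi_div_two]
  have hun : ‖u‖ = 1 := by rw [hu, LinearIsometryEquiv.norm_map, norm_dir]
  have hkn : ‖k‖ = 1 := by rw [hk, LinearIsometryEquiv.norm_map, norm_dir]
  have hku : inner ℝ k u = 0 := by rw [hu, hk, LinearIsometryEquiv.inner_map_map, hperp]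
  rcases eq_or_eq_neg_of_inner_eq_zero hun hkn
    (w := K.linearIsometryEquiv (dir (ω + π / 2)))
    (by rw [LinearIsometryEquiv.norm_map, norm_dir]) hku
    (by rw [← hKu, LinearIsometryEquiv.inner_map_map, hperp]) with hcase | hcase
  · have hlin := LinearMap.eq_of_dir (f := J.linearIsometryEquiv.toLinearEquiv.toLinearMap)
      (g := K.linearIsometryEquiv.toLinearEquiv.toLinearMap) (θ := ω) (t := π / 2)
      (by rw [sin_pi_div_two]; exact one_ne_zero) hKu.symm hcase.symm
    ext1 x
    rw [← add_sub_cancel a.supp x, J.apply_add, K.apply_add, hJKa]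
    exact congrArg _ (LinearMap.congr_fun hlin (x - a.supp))
  exfalso
  have hin1 : 0 < inner ℝ (dir ω) (p - a.supp) := by
    rw [hca, inner_smul_left] at h1
    exact pos_of_mul_pos_right h1 hl0.le
  have hin2 : 0 < inner ℝ (dir (ω + π)) (q - c.supp) := by
    rw [← neg_sub, hca, ← smul_neg, ← hπ0, inner_smul_left] at h2
    exact pos_of_mul_pos_right h2 hl0.le
  have ev1 := ha.eventually_exists_isChord hU hbd hac hl0 (κ := 3 * l / 4) (by linarith) hcs hin1
  have ev2 := hc.eventually_exists_isChord hU hbd hac.symm hl0 (κ := 3 * l / 4) (by linarith)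
    has hin2
  have t1 : Tendsto (fun t => ω + t) (nhdsWithin 0 (Ioi 0)) (nhds ω) := by
    have h3 : Continuous fun t => ω + t := by fun_prop
    have h4 := h3.tendsto 0
    rw [add_zero] at h4
    exact h4.mono_left nhdsWithin_le_nhds
  have t2 : Tendsto (fun t => ω + π - t) (nhdsWithin 0 (Ioi 0)) (nhds (ω + π)) := by
    have h3 : Continuous fun t => ω + π - t := by fun_prop
    have h4 := h3.tendsto 0
    rw [sub_zero] at h4
    exact h4.mono_left nhdsWithin_le_nhds
  have ev3 : ∀ᶠ t in nhdsWithin (0:ℝ) (Ioi 0), 2 / 3 < cos t := by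
    refine (continuous_cos.continuousAt.eventually (eventually_gt_nhds ?_)).filter_mono
      nhdsWithin_le_nhds
    rw [cos_zero]
    norm_num
  obtain ⟨t, ⟨d, x, hx, hd, hds, hdin⟩, ⟨e, y, hy, he, hes, hein⟩, hcos, ht⟩ :=
    ((t1.eventually ev1).and ((t2.eventually ev2).and
      (ev3.and (Ioo_mem_nhdsGT pi_pos)))).exists
  have hc0 : 0 < cos t := by linarith
  have hc1 : cos t < 1 := by
    have h3 := sin_pos_of_pos_of_lt_pi ht.1 ht.2
    nlinarith [sin_sq_add_cos_sq t]
  set h := l / (2 * cos t) with hh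
  have hhc : h * cos t = l / 2 := by
    rw [hh]
    field_simp
  have hh0 : 0 < h := by positivity
  have hhl : h < 3 * l / 4 := by
    rw [hh, div_lt_iff₀ (by positivity)]
    nlinarith
  have hmem : ∀ (o w : Euc 2) (x : ℝ), h < x → o + h • w ∈ openSegment ℝ o (o + x • w) := by
    intro o w x hhx
    have hx0 := hh0.trans hhx
    rw [openSegment_eq_image_lineMap]
    refine ⟨h / x, ⟨by positivity, (div_lt_one hx0).2 hhx⟩, ?_⟩
    rw [AffineMap.lineMap_apply_module', add_sub_cancel_left, smul_smul,
      div_mul_cancel₀ _ hx0.ne', add_comm]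
  have hz : a.supp + h • dir (ω + t) = c.supp + h • dir (ω + π - t) := by
    have h3 : l • dir ω = (2 * (h * cos t)) • dir ω := by rw [hhc, mul_div_cancel₀ l two_ne_zero]
    rw [hcs, hdirπ, dir_add ω t, h3]
    module
  have hz1 : a.supp + h • dir (ω + t) ∈ openSegment ℝ a.supp d.supp := by
    rw [hds]
    exact hmem _ _ _ (hhl.trans hx)
  have hz2 : a.supp + h • dir (ω + t) ∈ openSegment ℝ c.supp e.supp := by
    rw [hes, hz]
    exact hmem _ _ _ (hhl.trans hy)
  have hdz := hd.right_le _ hz1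
  have hez := he.right_le _ hz2
  have hdist : ∀ (o : Euc 2) (φ x : ℝ), h < x → dist (o + x • dir φ) (o + h • dir φ) = x - h := by
    intro o φ x hhx
    rw [dist_add_left, dist_eq_norm, ← sub_smul, norm_smul, norm_dir, mul_one,
      Real.norm_of_nonneg (sub_pos.2 hhx).le]
  have e1 : dist d.supp (a.supp + h • dir (ω + t)) = x - h := by
    rw [hds]
    exact hdist _ _ _ (hhl.trans hx)
  have e2 : dist e.supp (a.supp + h • dir (ω + t)) = y - h := by
    rw [hes, hz]
    exact hdist _ _ _ (hhl.trans hy)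
  rw [e1] at hdz
  rw [e2, edist_comm] at hez
  have hde := edist_trans_le (by linarith) (by linarith) hdz hez
  rw [← F.edist_eq _ _ hd.right_notMem he.right_notMem] at hde
  have hD := dist_supp_le (by linarith) hde
  rw [← hJ.apply_chord d hd ?_, ← hK.apply_chord e he ?_, hds, hes, J.apply_add, K.apply_add,
    map_smul, map_smul, hdirπ, dir_add ω t, map_add, map_add, map_smul, map_smul, map_smul,
    map_smul, hKu, hcase, ← hJKc, hJc', ← hu, ← hk] at hD
  · exact hD.not_gt (lt_dist_reflection hun hkn hku hc0 hc1 hl0 hhc)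
  · rw [hes, add_sub_cancel_left, real_inner_smul_left]
    exact mul_pos (by linarith) hein
  · rw [hds, add_sub_cancel_left, real_inner_smul_left]
    exact mul_pos (by linarith) hdin

end IsContact

namespace IsContact

open ISeq

section

variable {n : ℕ} {U : Set (Euc n)} {a c : ISeq U} {x p : Euc n} {r τ : ℝ}

/-- Sweeping a disc away from a contact point until it meets the boundary again yields a
second contact point visible from the first one. -/
theorem exists_sweep (ha : IsContact a x r) (hU : IsOpen U) (hbd : Bornology.IsBounded U) :
    ∃ (c : ISeq U) (p : Euc n) (τ l : ℝ) (C : Set (Euc n)), IsContact c p τ ∧ IsOpen C ∧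
      Convex ℝ C ∧ C ⊆ U ∧ c.supp ∈ closure C ∧ AffineMap.lineMap a.supp c.supp l ∈ C ∧
      AffineMap.lineMap a.supp c.supp l ∈ ball x r ∧
      0 < inner ℝ (c.supp - a.supp) (x - a.supp) ∧
      0 < inner ℝ (a.supp - c.supp) (p - c.supp) := by
  obtain ⟨α, hα⟩ : ∃ α, α = a.supp := ⟨_, rfl⟩
  have hr := ha.pos
  have hxα : ‖x - α‖ = r := by rw [hα, ← dist_eq_norm, dist_comm, ha.dist_eq]
  obtain ⟨v, hv⟩ : ∃ v, v = r⁻¹ • (x - α) := ⟨_, rfl⟩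
  have hv1 : ‖v‖ = 1 := by
    rw [hv, norm_smul, norm_inv, Real.norm_of_nonneg hr.le, hxα, inv_mul_cancel₀ hr.ne']
  have hxv : x - α = r • v := by rw [hv, smul_inv_smul₀ hr.ne']
  have hxU : x ∈ U := ha.ball_subset (mem_ball_self hr)
  obtain ⟨τ, hτ⟩ : ∃ τ, τ = r / 2 := ⟨_, rfl⟩
  have hτ0 : 0 < τ := by linarith
  have hne : (Uᶜ).Nonempty := ⟨_, ha.notMem⟩
  have hWopen : IsOpen {y : Euc n | τ < infDist y Uᶜ} :=
    isOpen_lt continuous_const (continuous_infDist_pt _)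
  have hxW : τ < infDist x Uᶜ := by
    refine lt_of_lt_of_le (b := r) (by linarith) ((le_infDist hne).2 fun y hy => ?_)
    by_contra! hlt
    exact hy (ha.ball_subset (mem_ball'.2 hlt))
  obtain ⟨R, hR⟩ := hbd.subset_ball x
  have hR0 : 0 < R := pos_of_mem_ball (hR hxU)
  have hηU : x + R • v ∉ U := fun hmem => by
    have := hR hmem
    rw [mem_ball, dist_self_add_left, norm_smul, hv1, mul_one, Real.norm_of_nonneg hR0.le] at this
    exact this.false
  obtain ⟨t, ht, htW, hlt⟩ := exists_first_exit hWopen (y := x) (η := x + R • v) hxW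
    (by
      rw [mem_ofPred_eq, infDist_zero_of_mem (mem_compl hηU)]
      exact hτ0.not_gt)
  have hline : ∀ s, AffineMap.lineMap x (x + R • v) s = x + (s * R) • v := by
    intro s
    rw [AffineMap.lineMap_apply_module', add_sub_cancel_left, smul_smul, add_comm]
  simp only [hline, mem_ofPred_eq] at htW hlt
  obtain ⟨T, hT⟩ : ∃ T, T = t * R := ⟨_, rfl⟩
  have hT0 : 0 < T := hT ▸ mul_pos ht.1 hR0
  rw [← hT, not_lt] at htW
  replace hlt : ∀ s, 0 ≤ s → s < T → τ < infDist (x + s • v) Uᶜ := by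
    intro s hs hsT
    have := hlt (s / R) ⟨by positivity, (div_lt_iff₀ hR0).2 (hT ▸ hsT)⟩
    rwa [div_mul_cancel₀ _ hR0.ne'] at this
  have hdisc : ∀ s, 0 ≤ s → s ≤ T → ball (x + s • v) τ ⊆ U := by
    intro s hs hsT w hw
    by_contra hwU
    have hcont : Continuous fun s : ℝ => dist w (x + s • v) := by fun_prop
    have h1 : ∀ s' ∈ Ico 0 T, τ ≤ dist w (x + s' • v) := fun s' hs' => by
      rw [dist_comm]
      exact (hlt s' hs'.1 hs'.2).le.trans (infDist_le_dist_of_mem hwU)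
    have h2 : s ∈ closure (Ico 0 T) := by
      rw [closure_Ico hT0.ne]
      exact ⟨hs, hsT⟩
    have h3 : τ ≤ dist w (x + s • v) :=
      (isClosed_le continuous_const hcont).closure_subset_iff.2 h1 h2
    exact (mem_ball.1 hw).not_ge h3
  obtain ⟨p, hp⟩ : ∃ p, p = x + T • v := ⟨_, rfl⟩
  rw [← hp] at htW
  obtain ⟨γ, hγU, hγ⟩ := hU.isClosed_compl.exists_infDist_eq_dist hne p
  have hγle : ∀ s, 0 ≤ s → s ≤ T → τ ≤ ‖γ - (x + s • v)‖ := fun s hs hsT => by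
    by_contra! hlt
    rw [← dist_eq_norm] at hlt
    exact hγU (hdisc s hs hsT hlt)
  have hγτ : ‖γ - p‖ = τ := le_antisymm (by rw [← dist_eq_norm, dist_comm, ← hγ]; exact htW)
    (hp ▸ hγle T hT0.le le_rfl)
  have hballp : ball p τ ⊆ U := hp ▸ hdisc T hT0.le le_rfl
  obtain ⟨c, hcs, hc⟩ := exists_of_dist hτ0 hballp (by rw [dist_eq_norm, hγτ]) hγU
  obtain ⟨s, hs⟩ : ∃ s, s = inner ℝ (γ - p) v := ⟨_, rfl⟩
  obtain ⟨w, hw⟩ : ∃ w, w = γ - p - s • v := ⟨_, rfl⟩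
  have hvv : inner ℝ v v = (1 : ℝ) := by rw [real_inner_self_eq_norm_sq, hv1, one_pow]
  have hwv : inner ℝ w v = 0 := by
    rw [hw, inner_sub_left, real_inner_smul_left, hvv, ← hs, mul_one, sub_self]
  have hvw : inner ℝ v w = 0 := by rw [real_inner_comm, hwv]
  have hγp : γ - p = s • v + w := by rw [hw, add_sub_cancel]
  have hτs : τ ^ 2 = s ^ 2 + ‖w‖ ^ 2 := by
    rw [← hγτ, hγp, norm_add_sq_real, real_inner_smul_left, hvw, norm_smul, hv1, mul_one,
      Real.norm_eq_abs, sq_abs]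
    ring
  have hs0 : 0 ≤ s := by
    by_contra! hneg
    obtain ⟨ε, hε0, hεT, hεs⟩ : ∃ ε, 0 < ε ∧ ε ≤ T ∧ ε ≤ -s :=
      ⟨min T (-s), lt_min hT0 (by linarith), min_le_left _ _, min_le_right _ _⟩
    have h1 := hγle (T - ε) (by linarith) (by linarith)
    have h2 : γ - (x + (T - ε) • v) = (s + ε) • v + w := by
      rw [add_smul, add_right_comm, ← hγp, hp]
      module
    rw [← sq_le_sq₀ hτ0.le (norm_nonneg _), h2, norm_add_sq_real, real_inner_smul_left, hvw,
      norm_smul, hv1, mul_one, Real.norm_eq_abs, sq_abs, hτs] at h1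
    nlinarith
  have hγα : γ - α = (r + T + s) • v + w := by
    have : γ - α = γ - p + (x - α) + T • v := by rw [hp]; abel
    rw [this, hγp, hxv]
    module
  have hpos : 0 < r + T + s := by linarith
  have hz : AffineMap.lineMap α γ (r / (r + T + s)) = x + (r / (r + T + s)) • w := by
    rw [AffineMap.lineMap_apply_module', hγα, smul_add, smul_smul, div_mul_cancel₀ _ hpos.ne',
      ← hxv]
    abel
  have hwτ : ‖w‖ ≤ τ := by
    rw [← sq_le_sq₀ (norm_nonneg _) hτ0.le]
    nlinarith
  have hzτ : dist (x + (r / (r + T + s)) • w) x < τ := by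
    rw [dist_self_add_left, norm_smul, Real.norm_of_nonneg (by positivity)]
    have h1 : r / (r + T + s) < 1 := (div_lt_one hpos).2 (by linarith)
    have h2 : 0 < r / (r + T + s) := by positivity
    rcases (norm_nonneg w).eq_or_lt with h0 | h0
    · rwa [← h0, mul_zero]
    · nlinarith
  have hxmem : x ∈ segment ℝ x p := left_mem_segment ℝ _ _
  refine ⟨c, p, τ, r / (r + T + s), thickening τ (segment ℝ x p), hc, isOpen_thickening,
    (convex_segment x p).thickening τ, ?_, ?_, ?_, ?_, ?_, ?_⟩
  · intro y hy
    obtain ⟨o, ho, hyo⟩ := mem_thickening_iff.1 hy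
    rw [segment_eq_image_lineMap] at ho
    obtain ⟨m, hm, rfl⟩ := ho
    rw [hp, AffineMap.lineMap_apply_module', add_sub_cancel_left, smul_smul, add_comm] at hyo
    exact hdisc _ (mul_nonneg hm.1 hT0.le) (mul_le_of_le_one_left hT0.le hm.2) hyo
  · have h1 : ball p τ ⊆ thickening τ (segment ℝ x p) :=
      ball_subset_thickening (right_mem_segment ℝ _ _) τ
    refine closure_mono h1 ?_
    rw [closure_ball p hτ0.ne', mem_closedBall, hc.dist_eq]
  · rw [hcs, ← hα, hz]
    exact mem_thickening_iff.2 ⟨x, hxmem, hzτ⟩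
  · rw [hcs, ← hα, hz]
    exact hzτ.trans (by linarith)
  · rw [hcs, ← hα, hγα, hxv, inner_add_left, real_inner_smul_left, real_inner_smul_right,
      real_inner_smul_right, hvv, hwv]
    rw [mul_one, mul_zero, add_zero]
    positivity
  · rw [hcs, ← hα, ← neg_sub γ α, ← neg_sub γ p, inner_neg_neg, hγα, hγp, inner_add_left,
      inner_add_right, inner_add_right, real_inner_smul_left, real_inner_smul_right,
      real_inner_smul_left, real_inner_smul_right, hvv, hwv, hvw, real_inner_self_eq_norm_sq]
    nlinarith [mul_nonneg hs0 hr.le, mul_nonneg hs0 hT0.le, pow_pos hτ0 2]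

theorem openSegment_subset_of_lineMap_mem {α γ : Euc n} {l : ℝ} {B C : Set (Euc n)}
    (hB : IsOpen B) (hBc : Convex ℝ B) (hC : IsOpen C) (hCc : Convex ℝ C) (hBU : B ⊆ U)
    (hCU : C ⊆ U) (hα : α ∈ closure B) (hγ : γ ∈ closure C)
    (hzB : AffineMap.lineMap α γ l ∈ B) (hzC : AffineMap.lineMap α γ l ∈ C) :
    openSegment ℝ α γ ⊆ U := by
  refine (openSegment_subset_union α γ (mem_range_self l)).trans (insert_subset (hBU hzB)
    (union_subset ?_ ?_))
  · refine (hBc.openSegment_closure_interior_subset_interior hα ?_).trans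
      (interior_subset.trans hBU)
    rwa [hB.interior_eq]
  · refine (hCc.openSegment_interior_closure_subset_interior ?_ hγ).trans
      (interior_subset.trans hCU)
    rwa [hC.interior_eq]

theorem supp_mem_closure_ball (ha : IsContact a x r) : a.supp ∈ closure (ball x r) := by
  rw [closure_ball x ha.pos.ne', mem_closedBall, ha.dist_eq]

theorem inner_pos (ha : IsContact a x r) (hc : IsContact c x r) (hne : a.supp ≠ c.supp) :
    0 < inner ℝ (c.supp - a.supp) (x - a.supp) := by
  have h1 : ‖c.supp - a.supp - (x - a.supp)‖ ^ 2 = r ^ 2 := by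
    rw [sub_sub_sub_cancel_right, ← dist_eq_norm, hc.dist_eq]
  have h2 : ‖x - a.supp‖ = r := by rw [← dist_eq_norm, dist_comm, ha.dist_eq]
  rw [norm_sub_sq_real, h2] at h1
  have h3 : 0 < ‖c.supp - a.supp‖ ^ 2 := pow_pos (norm_pos_iff.2 (sub_ne_zero.2 hne.symm)) 2
  linarith

theorem openSegment_subset (ha : IsContact a x r) (hc : IsContact c x r)
    (hne : a.supp ≠ c.supp) : openSegment ℝ a.supp c.supp ⊆ U := by
  have h := (strictConvex_closedBall ℝ x r).openSegment_subset
    (mem_closedBall.2 ha.dist_eq.le) (mem_closedBall.2 hc.dist_eq.le) hne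
  rw [interior_closedBall x ha.pos.ne'] at h
  exact h.trans ha.ball_subset

end

end IsContact

namespace BIso

open ISeq

variable {U V : Set (Euc 2)}

theorem exists_isContact {x : Euc 2} (hU : IsOpen U) (hbd : Bornology.IsBounded U) (hx : x ∈ U) :
    ∃ a : ISeq U, IsContact a x (infDist x Uᶜ) := by
  have hne : (Uᶜ).Nonempty := by
    rw [nonempty_compl]
    rintro rfl
    exact NormedSpace.unbounded_univ ℝ (Euc 2) hbd
  obtain ⟨α, hα, hd⟩ := hU.isClosed_compl.exists_infDist_eq_dist hne x
  have hpos : 0 < infDist x Uᶜ :=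
    (hU.isClosed_compl.notMem_iff_infDist_pos hne).1 (notMem_compl_iff.2 hx)
  have hball : ball x (infDist x Uᶜ) ⊆ U := fun y hy => by
    by_contra hyU
    exact (mem_ball'.1 hy).not_ge (infDist_le_dist_of_mem hyU)
  obtain ⟨a, -, ha⟩ := IsContact.exists_of_dist hpos hball (by rw [hd, dist_comm]) hα
  exact ⟨a, ha⟩

theorem tendsto_isRigid_eq (hU : IsOpen U) (hbd : Bornology.IsBounded U) (hV : IsOpen V)
    (F : BIso U V) {a : ISeq U} {x : Euc 2} {r : ℝ} {J : Euc 2 ≃ᵃⁱ[ℝ] Euc 2}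
    (ha : IsContact a x r) (hJ : IsRigid F a x J) {b : ℕ → ISeq U} {y : ℕ → Euc 2} {ρ : ℕ → ℝ}
    {K : ℕ → Euc 2 ≃ᵃⁱ[ℝ] Euc 2} (hb : ∀ k, IsContact (b k) (y k) (ρ k))
    (hK : ∀ k, IsRigid F (b k) (y k) (K k)) (hy : Tendsto y atTop (nhds x))
    (hρ : Tendsto ρ atTop (nhds r)) (hbs : Tendsto (fun k => (b k).supp) atTop (nhds a.supp)) :
    ∀ᶠ k in atTop, K k = J := by
  obtain ⟨c, p, τ, l, C, hc, hCo, hCc, hCU, hcC, hzC, hzB, h1, h2⟩ := ha.exists_sweep hU hbd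
  obtain ⟨J', hJ'⟩ := hc.exists_isRigid hU hbd hV F
  have hJJ' : J = J' := ha.isRigid_eq hc hU hbd
    (IsContact.openSegment_subset_of_lineMap_mem isOpen_ball (convex_ball x r) hCo hCc
      ha.ball_subset hCU ha.supp_mem_closure_ball hcC hzB hzC) h1 h2 hJ hJ'
  have hz : Tendsto (fun k => AffineMap.lineMap (b k).supp c.supp l) atTop
      (nhds (AffineMap.lineMap a.supp c.supp l)) := by
    simp only [AffineMap.lineMap_apply_module']
    exact ((tendsto_const_nhds.sub hbs).const_smul l).add hbs
  have e1 : ∀ᶠ k in atTop, AffineMap.lineMap (b k).supp c.supp l ∈ C :=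
    hz.eventually (hCo.mem_nhds hzC)
  have e2 : ∀ᶠ k in atTop, AffineMap.lineMap (b k).supp c.supp l ∈ ball (y k) (ρ k) :=
    (hz.dist hy).eventually_lt hρ hzB
  have e3 : ∀ᶠ k in atTop, 0 < inner ℝ (c.supp - (b k).supp) (y k - (b k).supp) :=
    ((tendsto_const_nhds.sub hbs).inner (hy.sub hbs)).eventually (lt_mem_nhds h1)
  have e4 : ∀ᶠ k in atTop, 0 < inner ℝ ((b k).supp - c.supp) (p - c.supp) :=
    ((hbs.sub_const c.supp).inner tendsto_const_nhds).eventually (lt_mem_nhds h2)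
  filter_upwards [e1, e2, e3, e4] with k k1 k2 k3 k4
  rw [hJJ']
  exact (hb k).isRigid_eq hc hU hbd
    (IsContact.openSegment_subset_of_lineMap_mem isOpen_ball (convex_ball _ _) hCo hCc
      (hb k).ball_subset hCU (hb k).supp_mem_closure_ball hcC k2 k1) k3 k4 (hK k) hJ'

/-- The motions attached to the contact points of all inscribed discs agree. -/
theorem exists_motion (hU : IsOpen U) (hUc : IsConnected U) (hbd : Bornology.IsBounded U)
    (hV : IsOpen V) (F : BIso U V) : ∃ J : Euc 2 ≃ᵃⁱ[ℝ] Euc 2, ∀ x ∈ U, ∃ a : ISeq U,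
      IsContact a x (infDist x Uᶜ) ∧ IsRigid F a x J := by
  choose a ha using fun x : U => exists_isContact hU hbd x.2
  choose J hJ using fun x : U => (ha x).exists_isRigid hU hbd hV F
  have hloc : IsLocallyConstant J := by
    refine (IsLocallyConstant.iff_eventually_eq _).2 fun x => ?_
    by_contra hfreq
    obtain ⟨y, hy, hyJ⟩ := exists_seq_forall_of_frequently (not_eventually.1 hfreq)
    obtain ⟨β, -, φ, hφ, hβ⟩ := tendsto_subseq_of_bounded (x := fun k => (a (y k)).supp)
      hbd.closure fun k => closure_mono (ha (y k)).ball_subset (ha (y k)).supp_mem_closure_ball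
    have hyφ : Tendsto (fun k => (y (φ k) : Euc 2)) atTop (nhds x) :=
      (continuous_subtype_val.tendsto x).comp (hy.comp hφ.tendsto_atTop)
    have hρ : Tendsto (fun k => infDist (y (φ k) : Euc 2) Uᶜ) atTop
        (nhds (infDist (x : Euc 2) Uᶜ)) := ((continuous_infDist_pt _).tendsto _).comp hyφ
    have hβd : dist β x = infDist (x : Euc 2) Uᶜ :=
      tendsto_nhds_unique (hβ.dist hyφ) (by
        refine hρ.congr fun k => ?_
        exact (ha (y (φ k))).dist_eq.symm)
    have hβU : β ∉ U := by
      have := hU.isClosed_compl.mem_of_tendsto hβ (.of_forall fun k => (ha (y (φ k))).notMem)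
      exact this
    have key : ∀ (c : ISeq U) (K : Euc 2 ≃ᵃⁱ[ℝ] Euc 2), c.supp = β →
        IsContact c x (infDist (x : Euc 2) Uᶜ) → IsRigid F c x K → K ≠ J x := by
      rintro c K rfl hc hK rfl
      obtain ⟨k, hk⟩ := (tendsto_isRigid_eq hU hbd hV F hc hK (fun k => ha (y (φ k)))
        (fun k => hJ (y (φ k))) hyφ hρ hβ).exists
      exact hyJ _ hk
    by_cases hne : (a x).supp = β
    · exact key (a x) (J x) hne (ha x) (hJ x) rfl
    · obtain ⟨c, rfl, hc⟩ := IsContact.exists_of_dist (ha x).pos (ha x).ball_subset hβd hβU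
      obtain ⟨K, hK⟩ := hc.exists_isRigid hU hbd hV F
      exact key c K rfl hc hK ((ha x).isRigid_eq hc hU hbd ((ha x).openSegment_subset hc hne)
        ((ha x).inner_pos hc hne) (hc.inner_pos (ha x) (Ne.symm hne)) (hJ x) hK).symm
  have := isPreconnected_iff_preconnectedSpace.1 hUc.isPreconnected
  obtain ⟨x₀, hx₀⟩ := hUc.nonempty
  refine ⟨J ⟨x₀, hx₀⟩, fun x hx => ⟨a ⟨x, hx⟩, ha ⟨x, hx⟩, ?_⟩⟩
  rw [← hloc.apply_eq_of_preconnectedSpace ⟨x, hx⟩ ⟨x₀, hx₀⟩]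
  exact hJ ⟨x, hx⟩

end BIso

namespace BIso

open ISeq

variable {U V : Set (Euc 2)}

theorem motion_mem (hU : IsOpen U) (hbd : Bornology.IsBounded U) (hV : IsOpen V) {F : BIso U V}
    {a : ISeq U} {x : Euc 2} {r : ℝ} {J : Euc 2 ≃ᵃⁱ[ℝ] Euc 2} (ha : IsContact a x r)
    (hJ : IsRigid F a x J) : J x ∈ V := by
  have hr := ha.pos
  have hxa : ‖x - a.supp‖ = r := by rw [← dist_eq_norm, dist_comm, ha.dist_eq]
  obtain ⟨v, hv⟩ : ∃ v, v = r⁻¹ • (x - a.supp) := ⟨_, rfl⟩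
  have hv1 : ‖v‖ = 1 := by
    rw [hv, norm_smul, norm_inv, Real.norm_of_nonneg hr.le, hxa, inv_mul_cancel₀ hr.ne']
  have hxv : x - a.supp = r • v := by rw [hv, smul_inv_smul₀ hr.ne']
  have hin : inner ℝ v (x - a.supp) = r := by
    rw [hxv, real_inner_smul_right, real_inner_self_eq_norm_sq, hv1, one_pow, mul_one]
  obtain ⟨b, X, hab, hX, hb⟩ := ha.exists_isChord hU hbd hv1 (hin ▸ hr)
  rw [hin] at hX
  have hX0 : 0 < X := by linarith
  have hxline : AffineMap.lineMap a.supp b.supp (r / X) = x := by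
    rw [AffineMap.lineMap_apply_module', hb, add_sub_cancel_left, smul_smul,
      div_mul_cancel₀ _ hX0.ne', ← hxv, sub_add_cancel]
  have hJb : J b.supp = (F.toFun b).supp := hJ.apply_chord b hab (by
    rw [hb, add_sub_cancel_left, real_inner_smul_left, hin]
    positivity)
  have hJx : J x = AffineMap.lineMap (F.toFun a).supp (F.toFun b).supp (r / X) := by
    rw [← hxline, ← hJ.apply_supp, ← hJb]
    exact J.toAffineEquiv.apply_lineMap _ _ _
  refine (hab.map hU hV F).1.subset ?_
  rw [openSegment_eq_image_lineMap, hJx]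
  exact mem_image_of_mem _ ⟨by positivity, (div_lt_one hX0).2 (by linarith)⟩

theorem exists_image_eq (hU : IsEucDomain U) (hbd : Bornology.IsBounded U) (hV : IsEucDomain V)
    (F : BIso U V) : ∃ J : Euc 2 ≃ᵢ Euc 2, J '' U = V := by
  obtain ⟨J, hJ⟩ := exists_motion hU.1 hU.2 hbd hV.1 F
  have hsub : J '' U ⊆ V := by
    rintro _ ⟨x, hx, rfl⟩
    obtain ⟨a, ha, hr⟩ := hJ x hx
    exact motion_mem hU.1 hbd hV.1 ha hr
  have hopen : IsOpen (J '' U) := J.toHomeomorph.isOpenMap U hU.1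
  have hne : (V ∩ J '' U).Nonempty := by
    obtain ⟨x, hx⟩ := hU.2.nonempty
    exact ⟨J x, hsub (mem_image_of_mem J hx), mem_image_of_mem J hx⟩
  refine ⟨J.toIsometryEquiv, hsub.antisymm
    (hV.2.isPreconnected.subset_of_closure_inter_subset hopen hne ?_)⟩
  rintro y ⟨hyc, hyV⟩
  obtain ⟨q, rfl⟩ := J.surjective y
  refine mem_image_of_mem J (not_not.1 fun hqU => ?_)
  obtain ⟨ε, hε, hball⟩ := Metric.isOpen_iff.1 hV.1 _ hyV
  obtain ⟨_, ⟨x, hx, rfl⟩, hxq⟩ := Metric.mem_closure_iff.1 hyc (ε / 2) (by positivity)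
  rw [J.dist_map] at hxq
  obtain ⟨a, ha, hr⟩ := hJ x hx
  have h1 : infDist x Uᶜ ≤ dist x q := infDist_le_dist_of_mem hqU
  rw [dist_comm] at hxq
  refine F.supp_notMem a ha.notMem (hr.apply_supp ▸ hball ?_)
  rw [mem_ball, J.dist_map]
  have h2 := dist_triangle a.supp x q
  rw [ha.dist_eq] at h2
  linarith

end BIso

section Bridge

open ISeq

variable {n : ℕ} {U V : Set (Euc n)}

/-- A representative of a boundary element, as a Cauchy sequence. -/
def HBSeq.toISeq (s : HBSeq U) : ISeq U := ⟨s.seq, s.mem, s.cauchy⟩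

theorem tendsto_zero_of_limsup_eq_zero {u : ℕ → ENNReal} (h : limsup u atTop = 0) :
    Tendsto u atTop (nhds 0) := by
  rw [ENNReal.tendsto_nhds_zero]
  intro ε hε
  filter_upwards [eventually_lt_of_limsup_lt (h.trans_lt hε)] with k hk using hk.le

theorem HBSeq.supp_toISeq_notMem (hU : IsOpen U) (s : HBSeq U) : s.toISeq.supp ∉ U := fun h =>
  s.notConv ⟨_, h, tendsto_zero_of_limsup_eq_zero (edist_pt_supp hU s.toISeq h)⟩

/-- The representative of a boundary element given by a Cauchy sequence with limit off `U`. -/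
def ISeq.toHBSeq (s : ISeq U) (h : s.supp ∉ U) : HBSeq U where
  seq := s.seq
  mem := s.mem
  cauchy := s.cauchy
  notConv := by
    rintro ⟨u, hu, hlim⟩
    have h1 : Tendsto s.seq atTop (nhds u) := tendsto_iff_edist_tendsto_0.2
      (tendsto_of_tendsto_of_tendsto_of_le_of_le tendsto_const_nhds hlim (fun _ => zero_le)
        fun _ => edist_le_intrinsicDist)
    exact h (tendsto_nhds_unique s.tendsto_supp h1 ▸ hu)

theorem hbEquiv_iff_edist_eq_zero {s t : HBSeq U} :
    HBEquiv U s t ↔ edist s.toISeq t.toISeq = 0 :=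
  ⟨fun h => h.limsup_eq, fun h => tendsto_zero_of_limsup_eq_zero h⟩

/-- The boundary element represented by a sequence. -/
def HausdorffBoundary.mk (s : HBSeq U) : HausdorffBoundary U := Quot.mk (HBEquiv U) s

theorem edist_toISeq_out (s : HBSeq U) :
    edist (Quot.out (HausdorffBoundary.mk s)).toISeq s.toISeq = 0 := by
  have heq : Equivalence (HBEquiv U) :=
    ⟨fun s => hbEquiv_iff_edist_eq_zero.2 (edist_self _),
      fun h => hbEquiv_iff_edist_eq_zero.2
        ((edist_comm _ _).trans (hbEquiv_iff_edist_eq_zero.1 h)),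
      fun h1 h2 => hbEquiv_iff_edist_eq_zero.2 (le_antisymm ((edist_triangle _ _ _).trans (by
        rw [hbEquiv_iff_edist_eq_zero.1 h1, hbEquiv_iff_edist_eq_zero.1 h2, add_zero]))
        zero_le)⟩
  exact hbEquiv_iff_edist_eq_zero.1
    (heq.eqvGen_iff.1 (Quot.eqvGen_exact (Quot.out_eq (Quot.mk (HBEquiv U) s))))

theorem edist_congr_of_edist_eq_zero {α : Type*} [PseudoEMetricSpace α] {a b c d : α}
    (h1 : edist a b = 0) (h2 : edist c d = 0) : edist a c = edist b d := by
  have key : ∀ {a b c d : α}, edist a b = 0 → edist c d = 0 → edist a c ≤ edist b d := by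
    intro a b c d h1 h2
    calc edist a c ≤ edist a b + edist b d + edist d c := edist_triangle4 a b d c
      _ = edist b d := by rw [h1, edist_comm d, h2, zero_add, add_zero]
  exact le_antisymm (key h1 h2)
    (key ((edist_comm _ _).trans h1) ((edist_comm _ _).trans h2))

theorem hbDist_eq_edist (a b : HausdorffBoundary U) :
    hbDist a b = edist (Quot.out a).toISeq (Quot.out b).toISeq := rfl

theorem hbDist_mk_mk (s t : HBSeq U) :
    hbDist (HausdorffBoundary.mk s) (HausdorffBoundary.mk t) = edist s.toISeq t.toISeq := by
  rw [hbDist_eq_edist]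
  exact edist_congr_of_edist_eq_zero (edist_toISeq_out s) (edist_toISeq_out t)

open Classical in
theorem IsHBIsometry.nonempty_bIso (hU : IsOpen U) (hV : IsOpen V) (hVne : V.Nonempty)
    {f : HausdorffBoundary U → HausdorffBoundary V} (hf : IsHBIsometry f) :
    Nonempty (BIso U V) := by
  obtain ⟨v, hv⟩ := hVne
  let F : ISeq U → ISeq V := fun s => if h : s.supp ∉ U then
    (Quot.out (f (HausdorffBoundary.mk (s.toHBSeq h)))).toISeq else pt v hv
  have hF : ∀ s (h : s.supp ∉ U),
      F s = (Quot.out (f (HausdorffBoundary.mk (s.toHBSeq h)))).toISeq := fun s h => dif_pos h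
  refine ⟨F, fun s h => ?_, fun s t hs ht => ?_, fun t ht => ?_⟩
  · rw [hF s h]
    exact HBSeq.supp_toISeq_notMem hV _
  · rw [hF s hs, hF t ht]
    exact (hf.2 _ _).trans (hbDist_mk_mk _ _)
  · obtain ⟨a, ha⟩ := hf.1.2 (HausdorffBoundary.mk (t.toHBSeq ht))
    have hs := HBSeq.supp_toISeq_notMem hU (Quot.out a)
    refine ⟨_, hs, ?_⟩
    have h1 : HausdorffBoundary.mk ((Quot.out a).toISeq.toHBSeq hs) = a := Quot.out_eq a
    rw [hF _ hs, h1, ha]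
    exact edist_toISeq_out _

end Bridge

/-- Corollary 1.2: every bounded plane domain is uniquely determined in the class
of all plane domains by the relative metric of its Hausdorff boundary. -/
theorem bounded_plane_domain_uniquely_determined
    (U : Set (Euc 2)) (hU : IsEucDomain U) (hb : Bornology.IsBounded U) :
    UniquelyDeterminedIn {V | IsEucDomain V} U := by
  rintro V hV ⟨f, hf⟩
  obtain ⟨F⟩ := hf.nonempty_bIso hU.1 hV.1 hV.2.nonempty
  exact F.exists_image_eq hU hb hV
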